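/- Fix T > 0. Let f_t be the bounded weak solution on [0,T] of the topological Cucker–Smale equation with initial datum f₀ ∈ L^∞(ℝ^d × ℝ^d), a probability density supported in B_{R_x} × B_{R_v}. Let (X^N_i(t),V^N_i(t)), i = 1,…,N, be a solution (defined for almost every initial datum) of the topological Cucker–Smale N-agent system Ẋ^N_i = V^N_i, V̇^N_i = (1/N) Σ_j K(M(X^N_i,|X^N_i − X^N_j|)) (V^N_j − V^N_i), with initial data (x_i,v_i) ∈ B_{R_x} × B_{R_v}, and let μ^N_t := (1/N) Σ_i δ_{X^N_i(t)} δ_{V^N_i(t)} be the associated empirical measure. Then for all 0 ≤ t ≤ T, W₁(f_t, μ^N_t) ≤ C(T) max{ W₁(f₀, μ^N₀), √(W₁(f₀, μ^N₀)) }, where C(T) depends only on T, R_x, R_v and ‖f₀‖_∞. -/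

import Mathlib

open MeasureTheory Metric Set
open scoped ENNReal

noncomputable section

/-- `M[ρ](x,r) = ∫_{|x'−x| ≤ r} ρ(x') dx'`. -/
def Mdens {d : ℕ} (ρ : EuclideanSpace ℝ (Fin d) → ℝ)
    (x : EuclideanSpace ℝ (Fin d)) (r : ℝ) : ℝ :=
  ∫ y in closedBall x r, ρ y

/-- The spatial marginal `Sf(x) = ∫ f(x,v) dv`. -/
def Smarg {d : ℕ} (f : EuclideanSpace ℝ (Fin d) × EuclideanSpace ℝ (Fin d) → ℝ)
    (x : EuclideanSpace ℝ (Fin d)) : ℝ :=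
  ∫ w, f (x, w)

/-- The interaction field
`W[ρ,f](x,v) = ∫ K(M[ρ](x,|x−y|)) (w−v) f(y,w) dy dw`. -/
def Wfield {d : ℕ} (K : ℝ → ℝ) (ρ : EuclideanSpace ℝ (Fin d) → ℝ)
    (f : EuclideanSpace ℝ (Fin d) × EuclideanSpace ℝ (Fin d) → ℝ)
    (x v : EuclideanSpace ℝ (Fin d)) : EuclideanSpace ℝ (Fin d) :=
  ∫ p : EuclideanSpace ℝ (Fin d) × EuclideanSpace ℝ (Fin d),
    (K (Mdens ρ x (dist x p.1)) * f p) • (p.2 - v)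

/-- The interaction field against a measure `ν`:
`W[ρ,ν](x,v) = ∫ K(M[ρ](x,|x−y|)) (w−v) dν(y,w)`. -/
def WfieldMeas {d : ℕ} (K : ℝ → ℝ) (ρ : EuclideanSpace ℝ (Fin d) → ℝ)
    (ν : Measure (EuclideanSpace ℝ (Fin d) × EuclideanSpace ℝ (Fin d)))
    (x v : EuclideanSpace ℝ (Fin d)) : EuclideanSpace ℝ (Fin d) :=
  ∫ p, K (Mdens ρ x (dist x p.1)) • (p.2 - v) ∂ν

/-- The `1`-Wasserstein distance, via duality with bounded `1`-Lipschitz functions. -/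
def W1 {E : Type*} [MeasurableSpace E] [PseudoMetricSpace E] (μ ν : Measure E) : ℝ :=
  sSup {a : ℝ | ∃ φ : E → ℝ, LipschitzWith 1 φ ∧ (∃ C : ℝ, ∀ x, |φ x| ≤ C) ∧
    a = (∫ x, φ x ∂μ) - ∫ x, φ x ∂ν}

/-- The empirical measure `(1/N) Σ_i δ_{x_i} δ_{v_i}` on phase space. -/
def empPair {d N : ℕ} (x v : Fin N → EuclideanSpace ℝ (Fin d)) :
    Measure (EuclideanSpace ℝ (Fin d) × EuclideanSpace ℝ (Fin d)) :=
  ((N : ℝ≥0∞))⁻¹ • ∑ i : Fin N, Measure.dirac (x i, v i)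

/-- A family `{f_t}_{t∈[0,T]}` of bounded probability densities, weakly continuous
in `t`, which is a weak solution of the topological Cucker–Smale equation with
initial datum `f₀`. -/
def IsWeakSolCS {d : ℕ} (K : ℝ → ℝ) (T : ℝ)
    (f₀ : EuclideanSpace ℝ (Fin d) × EuclideanSpace ℝ (Fin d) → ℝ)
    (f : ℝ → EuclideanSpace ℝ (Fin d) × EuclideanSpace ℝ (Fin d) → ℝ) : Prop :=
  (∀ t ∈ Set.Icc 0 T, Measurable (f t) ∧ (∀ p, 0 ≤ f t p) ∧ (∫ p, f t p) = 1) ∧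
  (∃ C : ℝ, ∀ t ∈ Set.Icc 0 T, ∀ᵐ p ∂volume, f t p ≤ C) ∧
  (∀ α : EuclideanSpace ℝ (Fin d) × EuclideanSpace ℝ (Fin d) → ℝ,
    Continuous α → (∃ C : ℝ, ∀ p, |α p| ≤ C) →
    ContinuousOn (fun t => ∫ p, α p * f t p) (Set.Icc 0 T)) ∧
  (∃ Z : ℝ → EuclideanSpace ℝ (Fin d) × EuclideanSpace ℝ (Fin d) →
      EuclideanSpace ℝ (Fin d) × EuclideanSpace ℝ (Fin d),
    (∀ p, Z 0 p = p) ∧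
    (∀ p, ∀ t ∈ Set.Icc 0 T,
      HasDerivWithinAt (fun τ => (Z τ p).1) ((Z t p).2) (Set.Icc 0 T) t ∧
      HasDerivWithinAt (fun τ => (Z τ p).2)
        (Wfield K (Smarg (f t)) (f t) (Z t p).1 (Z t p).2) (Set.Icc 0 T) t) ∧
    (∀ t ∈ Set.Icc 0 T,
      ∀ α : EuclideanSpace ℝ (Fin d) × EuclideanSpace ℝ (Fin d) → ℝ,
        Continuous α → (∃ C : ℝ, ∀ p, |α p| ≤ C) →
        (∫ p, α p * f t p) = ∫ p, α (Z t p) * f₀ p))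

/-- For a configuration `Y` of `N` points in `ℝ^d`, `M(p,r) = (1/N) #{k : |Y_k − p| ≤ r}`. -/
def Mpart {d N : ℕ} (Y : Fin N → EuclideanSpace ℝ (Fin d))
    (p : EuclideanSpace ℝ (Fin d)) (r : ℝ) : ℝ :=
  ((Finset.univ.filter fun k => dist (Y k) p ≤ r).card : ℝ) / N

/-- The topological Cucker–Smale interaction force on agent `i`. -/
def CSforce {d N : ℕ} (K : ℝ → ℝ)
    (Y W : Fin N → EuclideanSpace ℝ (Fin d)) (i : Fin N) :
    EuclideanSpace ℝ (Fin d) :=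
  (N : ℝ)⁻¹ • ∑ j : Fin N, K (Mpart Y (Y i) (dist (Y i) (Y j))) • (W j - W i)

section Wasserstein

variable {E : Type*} [MeasurableSpace E] [PseudoMetricSpace E]

theorem W1_nonneg (μ ν : Measure E) : 0 ≤ W1 μ ν := by
  refine Real.sSup_nonneg' ⟨0, ?_, le_rfl⟩
  exact ⟨fun _ => 0, LipschitzWith.const' 0, ⟨0, by simp⟩, by simp⟩

theorem W1_le {μ ν : Measure E} {c : ℝ}
    (h : ∀ φ : E → ℝ, LipschitzWith 1 φ → (∃ C : ℝ, ∀ x, |φ x| ≤ C) →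
      (∫ x, φ x ∂μ) - ∫ x, φ x ∂ν ≤ c) : W1 μ ν ≤ c := by
  refine csSup_le ⟨0, fun _ => 0, LipschitzWith.const' 0, ⟨0, by simp⟩, by simp⟩ ?_
  rintro a ⟨φ, h1, h2, rfl⟩
  exact h φ h1 h2

variable [OpensMeasurableSpace E]

theorem integral_sub_integral_le_diam {μ ν : Measure E} [IsProbabilityMeasure μ]
    [IsProbabilityMeasure ν] {S : Set E} {R : ℝ} {x₀ : E} (hS : S ⊆ closedBall x₀ R)
    (hμ : ∀ᵐ x ∂μ, x ∈ S) (hν : ∀ᵐ x ∂ν, x ∈ S) {φ : E → ℝ} (h1 : LipschitzWith 1 φ)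
    (h2 : ∃ C : ℝ, ∀ x, |φ x| ≤ C) :
    (∫ x, φ x ∂μ) - ∫ x, φ x ∂ν ≤ 2 * R := by
  obtain ⟨C, hC⟩ := h2
  have hInt : ∀ m : Measure E, IsProbabilityMeasure m → Integrable φ m := fun m _ =>
    Integrable.of_bound h1.continuous.measurable.aestronglyMeasurable C
      (Filter.Eventually.of_forall hC)
  have key : ∀ x ∈ S, |φ x - φ x₀| ≤ R := fun x hx => by
    have := h1.dist_le_mul x x₀
    rw [Real.dist_eq] at this
    have h3 := mem_closedBall.1 (hS hx)
    simp at this; linarith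
  have e1 : (∫ x, φ x ∂μ) ≤ φ x₀ + R := by
    calc _ ≤ ∫ x, (φ x₀ + R) ∂μ := integral_mono_ae (hInt μ inferInstance)
          (integrable_const _) (by
            filter_upwards [hμ] with x hx
            linarith [abs_le.1 (key x hx)])
      _ = _ := by simp
  have e2 : φ x₀ - R ≤ (∫ x, φ x ∂ν) := by
    calc _ = ∫ x, (φ x₀ - R) ∂ν := by simp
      _ ≤ _ := integral_mono_ae (integrable_const _) (hInt ν inferInstance) (by
            filter_upwards [hν] with x hx
            linarith [abs_le.1 (key x hx)])
  linarith

theorem integral_sub_integral_le_W1 {μ ν : Measure E} [IsProbabilityMeasure μ]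
    [IsProbabilityMeasure ν] {S : Set E} {R : ℝ} {x₀ : E} (hS : S ⊆ closedBall x₀ R)
    (hμ : ∀ᵐ x ∂μ, x ∈ S) (hν : ∀ᵐ x ∂ν, x ∈ S) {ψ : E → ℝ} {L : ℝ} (hL : 0 < L)
    (hψ : ∀ x ∈ S, ∀ y ∈ S, |ψ x - ψ y| ≤ L * dist x y) :
    (∫ x, ψ x ∂μ) - ∫ x, ψ x ∂ν ≤ L * W1 μ ν := by
  obtain ⟨x₁, hx₁⟩ : ∃ x, x ∈ S := hμ.exists
  have hlip : LipschitzOnWith 1 (fun x => L⁻¹ * (ψ x - ψ x₁)) S := by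
    refine LipschitzOnWith.of_dist_le_mul fun x hx y hy => ?_
    rw [Real.dist_eq, ← mul_sub, abs_mul, abs_of_pos (inv_pos.2 hL), NNReal.coe_one, one_mul,
      inv_mul_le_iff₀ hL]
    simpa using hψ x hx y hy
  obtain ⟨g, hg, hgS⟩ := hlip.extend_real
  set φ : E → ℝ := fun x => max (-(2 * R)) (min (g x) (2 * R)) with hφ
  have hφl : LipschitzWith 1 φ := (hg.min_const _).const_max _
  have hR : 0 ≤ R := dist_nonneg.trans (mem_closedBall.1 (hS hx₁))
  have hφb : ∀ x, |φ x| ≤ 2 * R := fun x =>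
    abs_le.2 ⟨le_max_left _ _, max_le (by linarith) (min_le_right _ _)⟩
  have hφS : ∀ x ∈ S, φ x = L⁻¹ * (ψ x - ψ x₁) := fun x hx => by
    have hb : |g x| ≤ 2 * R := by
      rw [← hgS hx]
      rw [abs_mul, abs_of_pos (inv_pos.2 hL), inv_mul_le_iff₀ hL]
      refine (hψ x hx x₁ hx₁).trans (mul_le_mul_of_nonneg_left ?_ hL.le)
      have := dist_triangle_right x x₁ x₀
      linarith [mem_closedBall.1 (hS hx), mem_closedBall.1 (hS hx₁)]
    have := abs_le.1 hb
    have e := hgS hx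
    simp only at e
    simp only [hφ]
    rw [min_eq_left this.2, max_eq_right this.1, e]
  have hInt : ∀ m : Measure E, IsProbabilityMeasure m → (∀ᵐ x ∂m, x ∈ S) →
      ∫ x, ψ x ∂m = L * (∫ x, φ x ∂m) + ψ x₁ := fun m _ hm => by
    have hi : Integrable φ m :=
      Integrable.of_bound hφl.continuous.measurable.aestronglyMeasurable (2 * R)
        (Filter.Eventually.of_forall hφb)
    calc _ = ∫ x, (L * φ x + ψ x₁) ∂m := integral_congr_ae (by
          filter_upwards [hm] with x hx
          rw [hφS x hx]; field_simp; ring)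
      _ = _ := by
        rw [integral_add (hi.const_mul _) (integrable_const _), integral_const_mul]; simp
  rw [hInt μ inferInstance hμ, hInt ν inferInstance hν]
  have : (∫ x, φ x ∂μ) - ∫ x, φ x ∂ν ≤ W1 μ ν := by
    refine le_csSup ⟨2 * R, ?_⟩ ⟨φ, hφl, ⟨_, hφb⟩, rfl⟩
    rintro a ⟨φ', h1, h2, rfl⟩
    exact integral_sub_integral_le_diam hS hμ hν h1 h2
  nlinarith

end Wasserstein

section LocalBoundedness

theorem exists_portion_subset_of_closed_cover {ι : Type*} [Countable ι] {F : Set ℝ}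
    (hF : IsClosed F) (hne : F.Nonempty) {A : ι → Set ℝ} (hA : ∀ i, IsClosed (A i))
    (hcov : F ⊆ ⋃ i, A i) :
    ∃ i, ∃ t₀ ∈ F, ∃ ε > 0, ∀ t ∈ F, |t - t₀| < ε → t ∈ A i := by
  have : CompleteSpace F := hF.completeSpace_coe
  have : Nonempty F := hne.to_subtype
  obtain ⟨i, ⟨t₀, ht₀⟩, hx⟩ := nonempty_interior_of_iUnion_of_closed
    (f := fun i => ((↑) : F → ℝ) ⁻¹' A i)
    (fun i => (hA i).preimage continuous_subtype_val)
    (eq_univ_of_forall fun x => by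
      obtain ⟨i, hi⟩ := mem_iUnion.1 (hcov x.2)
      exact mem_iUnion.2 ⟨i, hi⟩)
  obtain ⟨ε, hε, hb⟩ := Metric.mem_nhds_iff.1 (mem_interior_iff_mem_nhds.1 hx)
  refine ⟨i, t₀, ht₀, ε, hε, fun t ht htt => ?_⟩
  have : (⟨t, ht⟩ : F) ∈ ball (⟨t₀, ht₀⟩ : F) ε := by
    rw [mem_ball, Subtype.dist_eq, Real.dist_eq]; exact htt
  exact hb this

theorem exists_bound_of_locally_bounded {S A : Set ℝ} (hS : IsCompact S) (hSA : S ⊆ A) {g : ℝ → ℝ}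
    (h : ∀ t ∈ S, ∃ ε > 0, ∃ n, ∀ s ∈ A, |s - t| < ε → g s ≤ n) :
    ∃ n, ∀ s ∈ S, g s ≤ n := by
  refine hS.induction_on (p := fun U => ∃ n, ∀ s ∈ U, g s ≤ n) ⟨0, by simp⟩ ?_ ?_ ?_
  · rintro U V hUV ⟨n, hn⟩
    exact ⟨n, fun s hs => hn s (hUV hs)⟩
  · rintro U V ⟨n, hn⟩ ⟨m, hm⟩
    refine ⟨max n m, fun s hs => ?_⟩
    rcases hs with hs | hs
    · exact (hn s hs).trans (le_max_left _ _)
    · exact (hm s hs).trans (le_max_right _ _)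
  · intro t ht
    obtain ⟨ε, hε, n, hn⟩ := h t ht
    refine ⟨S ∩ ball t ε, inter_mem_nhdsWithin _ (ball_mem_nhds t hε), n, fun s hs => ?_⟩
    exact hn s (hSA hs.1) (by have := hs.2; rwa [mem_ball, Real.dist_eq] at this)

/-- A function which is controlled by local doubling on short intervals where it is bounded, and
which is bounded on each member of a countable closed cover, is bounded. -/
theorem exists_bound_of_doubling_of_closed_cover {ι : Type*} [Countable ι] {T δ : ℝ} (hδ : 0 < δ)
    {q : ℝ → ℝ≥0∞}
    (hdouble : ∀ s ∈ Icc 0 T, ∀ t ∈ Icc 0 T, |s - t| ≤ δ →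
      (∃ n, ∀ τ ∈ uIcc s t, (q τ).toReal ≤ n) → q s ≠ ∞ →
      q t ≠ ∞ ∧ (q t).toReal ≤ 2 * (q s).toReal)
    {A : ι → Set ℝ} (hA : ∀ i, IsClosed (A i)) (hcov : Icc 0 T ⊆ ⋃ i, A i)
    (hbd : ∀ i, ∃ n, ∀ t ∈ A i, (q t).toReal ≤ n) :
    ∃ n, ∀ t ∈ Icc 0 T, (q t).toReal ≤ n := by
  set locb : ℝ → Prop := fun t => ∃ ε > 0, ∃ n, ∀ s ∈ Icc 0 T, |s - t| < ε → (q s).toReal ≤ n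
    with hlocb
  have hopen : IsOpen {t | locb t} := by
    rw [Metric.isOpen_iff]
    rintro t ⟨ε, hε, n, hn⟩
    refine ⟨ε / 2, by positivity, fun s hs => ⟨ε / 2, by positivity, n, fun r hr hrs => hn r hr ?_⟩⟩
    rw [mem_ball, Real.dist_eq] at hs
    have := abs_sub_le r s t
    linarith
  set F : Set ℝ := Icc 0 T ∩ {t | locb t}ᶜ with hFdef
  have hFc : IsClosed F := isClosed_Icc.inter hopen.isClosed_compl
  rcases F.eq_empty_or_nonempty with hF | hF
  · refine exists_bound_of_locally_bounded isCompact_Icc (Subset.refl _) fun t ht => ?_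
    by_contra hcon
    have : t ∈ F := ⟨ht, hcon⟩
    rw [hF] at this
    exact this
  exfalso
  obtain ⟨i, t₀, ht₀, ε, hε, hport⟩ := exists_portion_subset_of_closed_cover hFc hF hA
    (fun t ht => hcov ht.1)
  obtain ⟨n, hn⟩ := hbd i
  have hnn : 0 ≤ n := ENNReal.toReal_nonneg.trans (hn t₀ (hport t₀ ht₀ (by simpa using hε)))
  refine ht₀.2 ⟨min ε δ, lt_min hε hδ, 2 * n, fun t ht htt => ?_⟩
  have htε := htt.trans_le (min_le_left _ _)
  have htδ := htt.trans_le (min_le_right _ _)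
  by_cases htF : t ∈ F
  · have := hn t (hport t htF htε)
    linarith
  by_cases hqt : q t = ∞
  · rw [hqt]; simp; exact hnn
  obtain ⟨s, hsFJ, hsmin⟩ := (isCompact_uIcc.inter_left hFc).exists_isMinOn
    (⟨t₀, ht₀, left_mem_uIcc⟩ : (F ∩ uIcc t₀ t).Nonempty)
    (f := fun s => |s - t|) (by fun_prop)
  have hst : |s - t| ≤ |t - t₀| := by
    have := hsmin (⟨ht₀, left_mem_uIcc⟩ : t₀ ∈ F ∩ uIcc t₀ t)
    simpa [abs_sub_comm] using this
  have hst0 : |s - t₀| ≤ |t - t₀| := by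
    rcases hsFJ.2 with ⟨h1, h2⟩
    rcases le_total t₀ t with h | h
    · rw [inf_eq_left.2 h] at h1
      rw [sup_eq_right.2 h] at h2
      rw [abs_of_nonneg (by linarith), abs_of_nonneg (by linarith)]; linarith
    · rw [inf_eq_right.2 h] at h1
      rw [sup_eq_left.2 h] at h2
      rw [abs_of_nonpos (by linarith), abs_of_nonpos (by linarith)]; linarith
  have hIcc : uIcc s t ⊆ Icc 0 T := uIcc_subset_Icc hsFJ.1.1 ht
  have hsub : ∀ τ ∈ uIcc s t, |τ - t| ≤ |s - t| := fun τ hτ => by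
    have := abs_sub_right_of_mem_uIcc hτ
    rwa [abs_sub_comm t τ, abs_sub_comm t s] at this
  have hloc : ∀ τ ∈ uIcc s t, τ ≠ s → locb τ := fun τ hτ hτs => by
    by_contra hcon
    have hτF : τ ∈ F := ⟨hIcc hτ, hcon⟩
    have hm : |s - t| ≤ |τ - t| :=
      hsmin (⟨hτF, (uIcc_subset_uIcc hsFJ.2 right_mem_uIcc) hτ⟩ : τ ∈ F ∩ uIcc t₀ t)
    have h2 := hsub τ hτ
    have heq : |τ - t| = |s - t| := le_antisymm h2 hm
    apply hτs
    rcases hτ with ⟨h3, h4⟩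
    rcases le_total s t with h | h
    · rw [inf_eq_left.2 h] at h3
      rw [sup_eq_right.2 h] at h4
      rw [abs_of_nonpos (by linarith), abs_of_nonpos (by linarith)] at heq; linarith
    · rw [inf_eq_right.2 h] at h3
      rw [sup_eq_left.2 h] at h4
      rw [abs_of_nonneg (by linarith), abs_of_nonneg (by linarith)] at heq; linarith
  have hq2 : ∀ τ ∈ uIcc s t, τ ≠ s → (q τ).toReal ≤ 2 * (q t).toReal := fun τ hτ hτs => by
    refine (hdouble t ht τ (hIcc hτ) ?_ ?_ hqt).2
    · rw [abs_sub_comm]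
      linarith [hsub τ hτ]
    · refine exists_bound_of_locally_bounded isCompact_uIcc (A := Icc 0 T)
        ((uIcc_subset_uIcc right_mem_uIcc hτ).trans hIcc) fun r hr => hloc r ?_ ?_
      · exact uIcc_subset_uIcc right_mem_uIcc hτ hr
      · rintro rfl
        apply hτs
        rcases hτ with ⟨h3, h4⟩
        rcases hr with ⟨h5, h6⟩
        rcases le_total r t with h | h
        · rw [inf_eq_left.2 h] at h3
          rw [sup_eq_right.2 h] at h4
          rw [inf_eq_right.2 h4] at h5
          linarith
        · rw [inf_eq_right.2 h] at h3
          rw [sup_eq_left.2 h] at h4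
          rw [sup_eq_right.2 h3] at h6
          linarith
  have hb : ∃ m, ∀ τ ∈ uIcc s t, (q τ).toReal ≤ m := by
    refine ⟨max (2 * (q t).toReal) (q s).toReal, fun τ hτ => ?_⟩
    by_cases hτs : τ = s
    · rw [hτs]; exact le_max_right _ _
    · exact (hq2 τ hτ hτs).trans (le_max_left _ _)
  have hqs := (hdouble t ht s hsFJ.1.1 (by rw [abs_sub_comm]; linarith)
    (by rwa [uIcc_comm]) hqt).1
  have hfin := (hdouble s hsFJ.1.1 t ht (by linarith) hb hqs).2
  have := hn s (hport s hsFJ.1 (by linarith))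
  linarith

theorem bound_of_doubling {T δ : ℝ} (hδ : 0 < δ)
    {q : ℝ → ℝ≥0∞}
    (hdouble : ∀ s ∈ Icc 0 T, ∀ t ∈ Icc 0 T, |s - t| ≤ δ →
      q s ≠ ∞ → q t ≠ ∞ ∧ (q t).toReal ≤ 2 * (q s).toReal) (h0 : q 0 ≠ ∞) (k : ℕ) :
    ∀ t ∈ Icc 0 T, t ≤ k * δ → q t ≠ ∞ ∧ (q t).toReal ≤ 2 ^ k * (q 0).toReal := by
  induction k with
  | zero =>
    intro t ht htk
    have : t = 0 := le_antisymm (by simpa using htk) ht.1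
    subst this
    simp [h0]
  | succ k ih =>
    intro t ht htk
    push_cast at htk
    have hm : max 0 (t - δ) ∈ Icc 0 T :=
      ⟨le_max_left _ _, max_le (ht.1.trans ht.2) (by linarith [ht.2])⟩
    obtain ⟨h1, h2⟩ := ih (max 0 (t - δ)) hm (max_le (by positivity) (by linarith))
    obtain ⟨h3, h4⟩ := hdouble _ hm t ht (by
      rw [abs_le]
      constructor
      · linarith [le_max_right 0 (t - δ)]
      · have : max 0 (t - δ) ≤ t := max_le ht.1 (by linarith)
        linarith) h1
    exact ⟨h3, by rw [pow_succ]; nlinarith⟩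

end LocalBoundedness

section InteractionField

set_option linter.unusedSectionVars false

/-- A globally defined communication weight with uniform bounds and a Lipschitz constant. -/
structure IsCommWeight (K : ℝ → ℝ) (κ K₀ L : ℝ) : Prop where
  pos : 0 < κ
  lower : ∀ a, κ ≤ K a
  upper : ∀ a, K a ≤ K₀
  lip : ∀ a b, |K a - K b| ≤ L * |a - b|

namespace IsCommWeight

variable {K : ℝ → ℝ} {κ K₀ L : ℝ}

theorem nonneg (h : IsCommWeight K κ K₀ L) (a : ℝ) : 0 ≤ K a := h.pos.le.trans (h.lower a)

theorem bound_pos (h : IsCommWeight K κ K₀ L) : 0 < K₀ :=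
  h.pos.trans_le ((h.lower 0).trans (h.upper 0))

theorem lip_nonneg (h : IsCommWeight K κ K₀ L) : 0 ≤ L := by
  have := (abs_nonneg _).trans (h.lip 0 1)
  simpa using this

theorem abs_le (h : IsCommWeight K κ K₀ L) (a : ℝ) : |K a| ≤ K₀ := by
  rw [abs_of_nonneg (h.nonneg a)]; exact h.upper a

theorem continuous (h : IsCommWeight K κ K₀ L) : Continuous K := by
  have : LipschitzWith ⟨L, h.lip_nonneg⟩ K := LipschitzWith.of_dist_le_mul fun a b => by
    rw [Real.dist_eq, Real.dist_eq]; exact h.lip a b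
  exact this.continuous

end IsCommWeight

variable {E : Type*} [NormedAddCommGroup E] [InnerProductSpace ℝ E] [FiniteDimensional ℝ E]
  [MeasurableSpace E] [BorelSpace E]

/-- The mass of the cylinder over the closed ball of radius `r` around `x`. -/
def massIn (μ : Measure (E × E)) (x : E) (r : ℝ) : ℝ := μ.real {p | dist p.1 x ≤ r}

/-- The topological interaction field generated by a measure on phase space. -/
def field (K : ℝ → ℝ) (μ : Measure (E × E)) (x v : E) : E :=
  ∫ p, K (massIn μ x (dist x p.1)) • (p.2 - v) ∂μ

/-- The mean velocity seen from `x`, weighted by communication. -/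
def fieldDrift (K : ℝ → ℝ) (μ : Measure (E × E)) (x : E) : E :=
  ∫ p, K (massIn μ x (dist x p.1)) • p.2 ∂μ

/-- The total communication weight at `x`. -/
def fieldRate (K : ℝ → ℝ) (μ : Measure (E × E)) (x : E) : ℝ :=
  ∫ p, K (massIn μ x (dist x p.1)) ∂μ

variable {K : ℝ → ℝ} {κ K₀ L : ℝ} {μ : Measure (E × E)} [IsProbabilityMeasure μ]

theorem massIn_nonneg (μ : Measure (E × E)) (x : E) (r : ℝ) : 0 ≤ massIn μ x r :=
  measureReal_nonneg

theorem massIn_le_one (x : E) (r : ℝ) : massIn μ x r ≤ 1 := measureReal_le_one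

theorem measurable_massIn : Measurable fun z : E × ℝ => massIn μ z.1 z.2 := by
  have hs : MeasurableSet {w : (E × ℝ) × (E × E) | dist w.2.1 w.1.1 ≤ w.1.2} :=
    measurableSet_le (by fun_prop) (by fun_prop)
  exact (measurable_measure_prodMk_left hs).ennreal_toReal

theorem measurable_commWeight (hK : IsCommWeight K κ K₀ L) :
    Measurable fun z : E × (E × E) => K (massIn μ z.1 (dist z.1 z.2.1)) :=
  hK.continuous.measurable.comp ((measurable_massIn (μ := μ)).comp
    (f := fun z : E × (E × E) => (z.1, dist z.1 z.2.1)) (by fun_prop))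

theorem measurable_fieldRate (hK : IsCommWeight K κ K₀ L) : Measurable (fieldRate K μ) :=
  ((measurable_commWeight (μ := μ) hK).stronglyMeasurable.integral_prod_right
    (ν := μ)).measurable

theorem measurable_fieldDrift (hK : IsCommWeight K κ K₀ L) : Measurable (fieldDrift K μ) := by
  have : Measurable fun z : E × (E × E) => K (massIn μ z.1 (dist z.1 z.2.1)) • z.2.2 :=
    (measurable_commWeight hK).smul (by fun_prop)
  exact (this.stronglyMeasurable.integral_prod_right (ν := μ)).measurable

theorem measurable_commWeight_right (hK : IsCommWeight K κ K₀ L) (x : E) :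
    Measurable fun p : E × E => K (massIn μ x (dist x p.1)) :=
  (measurable_commWeight (μ := μ) hK).comp (f := fun p : E × E => (x, p)) (by fun_prop)

theorem integrable_commWeight (hK : IsCommWeight K κ K₀ L) (x : E) :
    Integrable (fun p : E × E => K (massIn μ x (dist x p.1))) μ :=
  Integrable.of_bound (measurable_commWeight_right hK x).aestronglyMeasurable K₀
    (Filter.Eventually.of_forall fun _ => hK.abs_le _)

theorem integrable_commWeight_smul (hK : IsCommWeight K κ K₀ L) (x : E) {g : E × E → E}
    (hg : Integrable g μ) : Integrable (fun p : E × E => K (massIn μ x (dist x p.1)) • g p) μ :=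
  hg.bdd_smul K₀ (measurable_commWeight_right hK x).aestronglyMeasurable
    (Filter.Eventually.of_forall fun _ => hK.abs_le _)

theorem field_eq (hK : IsCommWeight K κ K₀ L) (hμ : Integrable (fun p : E × E => p.2) μ)
    (x v : E) : field K μ x v = fieldDrift K μ x - fieldRate K μ x • v := by
  unfold field fieldDrift fieldRate
  simp_rw [smul_sub]
  rw [integral_sub (integrable_commWeight_smul hK x hμ)
    (integrable_commWeight_smul hK x (integrable_const v)), integral_smul_const]

theorem field_eq_zero (hK : IsCommWeight K κ K₀ L) (hμ : ¬ Integrable (fun p : E × E => p.2) μ)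
    (x v : E) : field K μ x v = 0 := by
  refine integral_undef fun hi => hμ ?_
  refine ((hi.norm.const_mul κ⁻¹).add (integrable_const ‖v‖)).mono'
    (by fun_prop) (Filter.Eventually.of_forall fun p => ?_)
  have h1 := hK.lower (massIn μ x (dist x p.1))
  have h2 : κ * ‖p.2 - v‖ ≤ ‖K (massIn μ x (dist x p.1)) • (p.2 - v)‖ := by
    rw [norm_smul, Real.norm_of_nonneg (hK.nonneg _)]
    exact mul_le_mul_of_nonneg_right h1 (norm_nonneg _)
  have h3 : ‖p.2 - v‖ ≤ κ⁻¹ * ‖K (massIn μ x (dist x p.1)) • (p.2 - v)‖ := by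
    rw [inv_mul_eq_div, le_div_iff₀' hK.pos]; exact h2
  have h4 : ‖p.2‖ ≤ ‖p.2 - v‖ + ‖v‖ := by simpa using norm_add_le (p.2 - v) v
  simp only [Pi.add_apply]
  linarith

theorem fieldRate_mem (hK : IsCommWeight K κ K₀ L) (x : E) : fieldRate K μ x ∈ Icc κ K₀ := by
  constructor
  · calc κ = ∫ _p, κ ∂μ := by simp
      _ ≤ _ := integral_mono (integrable_const _) (integrable_commWeight hK x)
        fun p => hK.lower _
  · calc fieldRate K μ x ≤ ∫ _p, K₀ ∂μ :=
        integral_mono (integrable_commWeight hK x) (integrable_const _) fun p => hK.upper _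
    _ = K₀ := by simp

theorem norm_fieldDrift_le (hK : IsCommWeight K κ K₀ L) (x : E) :
    ‖fieldDrift K μ x‖ ≤ K₀ * (∫⁻ p, ‖p.2‖ₑ ∂μ).toReal := by
  by_cases hμ : Integrable (fun p : E × E => p.2) μ
  · calc ‖fieldDrift K μ x‖ ≤ ∫ p, ‖K (massIn μ x (dist x p.1)) • p.2‖ ∂μ :=
          norm_integral_le_integral_norm _
      _ ≤ ∫ p, K₀ * ‖p.2‖ ∂μ := by
          refine integral_mono (integrable_commWeight_smul hK x hμ).norm (hμ.norm.const_mul _)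
            fun p => ?_
          simp only
          rw [norm_smul, Real.norm_of_nonneg (hK.nonneg _)]
          exact mul_le_mul_of_nonneg_right (hK.upper _) (norm_nonneg _)
      _ = _ := by
          rw [integral_const_mul, integral_norm_eq_lintegral_enorm (by fun_prop)]
  · have : fieldDrift K μ x = field K μ x 0 := by simp [fieldDrift, field]
    rw [this, field_eq_zero hK hμ, norm_zero]
    exact mul_nonneg hK.bound_pos.le ENNReal.toReal_nonneg

theorem norm_field_le (hK : IsCommWeight K κ K₀ L) (x v : E) :
    ‖field K μ x v‖ ≤ K₀ * ((∫⁻ p, ‖p.2‖ₑ ∂μ).toReal + ‖v‖) := by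
  by_cases hμ : Integrable (fun p : E × E => p.2) μ
  · rw [field_eq hK hμ, mul_add]
    refine (norm_sub_le _ _).trans (add_le_add (norm_fieldDrift_le hK x) ?_)
    have := fieldRate_mem (μ := μ) hK x
    rw [norm_smul, Real.norm_of_nonneg (hK.pos.le.trans this.1)]
    exact mul_le_mul_of_nonneg_right this.2 (norm_nonneg _)
  · rw [field_eq_zero hK hμ, norm_zero]
    exact mul_nonneg hK.bound_pos.le (add_nonneg ENNReal.toReal_nonneg (norm_nonneg _))

theorem integrable_snd_iff : Integrable (fun p : E × E => p.2) μ ↔ ∫⁻ p, ‖p.2‖ₑ ∂μ ≠ ∞ := by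
  refine ⟨fun h => h.hasFiniteIntegral.ne, fun h => ⟨by fun_prop, ?_⟩⟩
  exact lt_top_iff_ne_top.2 h

end InteractionField

section KineticFlow

set_option linter.unusedSectionVars false

theorem norm_le_of_norm_deriv_le {E : Type*} [NormedAddCommGroup E] [NormedSpace ℝ E]
    {V V' : ℝ → E} {S : Set ℝ} {s t K₀ Q : ℝ} (hS : uIcc s t ⊆ S) (hK : 0 ≤ K₀)
    (hQ : 0 ≤ Q)
    (hV : ∀ τ ∈ S, HasDerivWithinAt V (V' τ) S τ)
    (hb : ∀ τ ∈ uIcc s t, ‖V' τ‖ ≤ K₀ * (Q + ‖V τ‖)) (hst : K₀ * |s - t| ≤ 1 / 4) :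
    ‖V t‖ ≤ 4 / 3 * ‖V s‖ + Q / 3 := by
  have hd : ∀ τ ∈ uIcc s t, HasDerivWithinAt V (V' τ) (uIcc s t) τ := fun τ hτ =>
    (hV τ (hS hτ)).mono hS
  have hc : ContinuousOn V (uIcc s t) := fun τ hτ => (hd τ hτ).continuousWithinAt
  obtain ⟨m, hm, hmax⟩ := isCompact_uIcc.exists_isMaxOn nonempty_uIcc hc.norm
  have hbd : ∀ τ ∈ uIcc s t, ‖V' τ‖ ≤ K₀ * (Q + ‖V m‖) := fun τ hτ =>
    (hb τ hτ).trans (mul_le_mul_of_nonneg_left (by linarith [show ‖V τ‖ ≤ ‖V m‖ from hmax hτ]) hK)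
  have h1 : ‖V m - V s‖ ≤ K₀ * (Q + ‖V m‖) * ‖m - s‖ :=
    (convex_uIcc s t).norm_image_sub_le_of_norm_hasDerivWithin_le hd hbd left_mem_uIcc hm
  have h0 : 0 ≤ K₀ * (Q + ‖V m‖) := (norm_nonneg _).trans (hbd m hm)
  have h2 : ‖m - s‖ ≤ |s - t| := by
    rw [Real.norm_eq_abs, abs_sub_comm s t]
    exact abs_sub_left_of_mem_uIcc hm
  have h3 : ‖V m - V s‖ ≤ (Q + ‖V m‖) / 4 := by
    calc _ ≤ K₀ * (Q + ‖V m‖) * |s - t| := h1.trans (mul_le_mul_of_nonneg_left h2 h0)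
      _ = (K₀ * |s - t|) * (Q + ‖V m‖) := by ring
      _ ≤ 1 / 4 * (Q + ‖V m‖) := mul_le_mul_of_nonneg_right hst (by positivity)
      _ = _ := by ring
  have h4 : ‖V m‖ ≤ ‖V m - V s‖ + ‖V s‖ := by simpa using norm_add_le (V m - V s) (V s)
  have h5 : ‖V t‖ ≤ ‖V m‖ := hmax right_mem_uIcc
  linarith

variable {E : Type*} [NormedAddCommGroup E] [InnerProductSpace ℝ E] [FiniteDimensional ℝ E]
  [MeasureSpace E] [BorelSpace E] [(volume : Measure E).IsAddHaarMeasure]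

/-- `Z` is a flow on `[0, T]` which transports `μ₀` along the field generated by its own law, and
whose law has density at most `C`. -/
structure IsKineticFlow (K : ℝ → ℝ) (T : ℝ) (μ₀ : Measure (E × E)) (C : NNReal)
    (Z : ℝ → E × E → E × E) : Prop where
  init : ∀ p, Z 0 p = p
  aemeasurable : ∀ t ∈ Icc 0 T, AEMeasurable (Z t) μ₀
  fst : ∀ p, ∀ t ∈ Icc 0 T, HasDerivWithinAt (fun τ => (Z τ p).1) (Z t p).2 (Icc 0 T) t
  snd : ∀ p, ∀ t ∈ Icc 0 T, HasDerivWithinAt (fun τ => (Z τ p).2)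
    (field K (μ₀.map (Z t)) (Z t p).1 (Z t p).2) (Icc 0 T) t
  density : ∀ t ∈ Icc 0 T, μ₀.map (Z t) ≤ (C : ℝ≥0∞) • volume

/-- The first absolute velocity moment along a flow. -/
def velMoment (μ₀ : Measure (E × E)) (Z : ℝ → E × E → E × E) (t : ℝ) : ℝ≥0∞ :=
  ∫⁻ p, ‖(Z t p).2‖ₑ ∂μ₀

namespace IsKineticFlow

variable {K : ℝ → ℝ} {κ K₀ L T : ℝ} {μ₀ : Measure (E × E)} [IsProbabilityMeasure μ₀] {C : NNReal}
  {Z : ℝ → E × E → E × E}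

theorem isProbabilityMeasure (hZ : IsKineticFlow K T μ₀ C Z) {t : ℝ} (ht : t ∈ Icc 0 T) :
    IsProbabilityMeasure (μ₀.map (Z t)) :=
  Measure.isProbabilityMeasure_map (hZ.aemeasurable t ht)

theorem velMoment_eq (hZ : IsKineticFlow K T μ₀ C Z) {t : ℝ} (ht : t ∈ Icc 0 T) :
    ∫⁻ p, ‖p.2‖ₑ ∂(μ₀.map (Z t)) = velMoment μ₀ Z t := by
  rw [lintegral_map' (by fun_prop) (hZ.aemeasurable t ht)]
  rfl

theorem norm_field_le (hK : IsCommWeight K κ K₀ L) (hZ : IsKineticFlow K T μ₀ C Z) {t : ℝ}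
    (ht : t ∈ Icc 0 T) (x v : E) :
    ‖field K (μ₀.map (Z t)) x v‖ ≤ K₀ * ((velMoment μ₀ Z t).toReal + ‖v‖) := by
  have := hZ.isProbabilityMeasure ht
  rw [← hZ.velMoment_eq ht]
  exact _root_.norm_field_le hK x v

theorem norm_snd_le (hK : IsCommWeight K κ K₀ L) (hZ : IsKineticFlow K T μ₀ C Z) {s t Q : ℝ}
    (hs : s ∈ Icc 0 T) (ht : t ∈ Icc 0 T) (hst : K₀ * |s - t| ≤ 1 / 4)
    (hQ : ∀ τ ∈ uIcc s t, (velMoment μ₀ Z τ).toReal ≤ Q) (p : E × E) :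
    ‖(Z t p).2‖ ≤ 4 / 3 * ‖(Z s p).2‖ + Q / 3 := by
  have hsub := uIcc_subset_Icc hs ht
  refine norm_le_of_norm_deriv_le (V := fun τ => (Z τ p).2) hsub hK.bound_pos.le
    (ENNReal.toReal_nonneg.trans (hQ s left_mem_uIcc)) (hZ.snd p)
    (fun τ hτ => (norm_field_le hK hZ (hsub hτ) _ _).trans ?_) hst
  exact mul_le_mul_of_nonneg_left (by linarith [hQ τ hτ]) hK.bound_pos.le

theorem velMoment_doubling (hK : IsCommWeight K κ K₀ L) (hZ : IsKineticFlow K T μ₀ C Z) {s t : ℝ}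
    (hs : s ∈ Icc 0 T) (ht : t ∈ Icc 0 T) (hst : |s - t| ≤ 1 / (4 * K₀))
    (hbd : ∃ n, ∀ τ ∈ uIcc s t, (velMoment μ₀ Z τ).toReal ≤ n) (hqs : velMoment μ₀ Z s ≠ ∞) :
    velMoment μ₀ Z t ≠ ∞ ∧ (velMoment μ₀ Z t).toReal ≤ 2 * (velMoment μ₀ Z s).toReal := by
  have hsub := uIcc_subset_Icc hs ht
  have hst' : K₀ * |s - t| ≤ 1 / 4 := by
    have := hK.bound_pos
    calc _ ≤ K₀ * (1 / (4 * K₀)) := mul_le_mul_of_nonneg_left hst this.le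
      _ = 1 / 4 := by field_simp
  have key : ∀ Q : ℝ, 0 ≤ Q → (∀ τ ∈ uIcc s t, (velMoment μ₀ Z τ).toReal ≤ Q) → ∀ τ ∈ uIcc s t,
      velMoment μ₀ Z τ ≤ ENNReal.ofReal (4 / 3 * (velMoment μ₀ Z s).toReal + Q / 3) := by
    intro Q hQ0 hQ τ hτ
    have h1 : ∀ p, ‖(Z τ p).2‖ₑ ≤
        ENNReal.ofReal (4 / 3) * ‖(Z s p).2‖ₑ + ENNReal.ofReal (Q / 3) := by
      intro p
      have h2 := norm_snd_le hK hZ hs (hsub hτ) (Q := Q)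
        ((mul_le_mul_of_nonneg_left (by
          have := abs_sub_left_of_mem_uIcc hτ
          rwa [abs_sub_comm, abs_sub_comm t s] at this) hK.bound_pos.le).trans hst')
        (fun r hr => hQ r (uIcc_subset_uIcc left_mem_uIcc hτ hr)) p
      rw [← ofReal_norm, ← ofReal_norm, ← ENNReal.ofReal_mul (by norm_num),
        ← ENNReal.ofReal_add (by positivity) (by positivity)]
      exact ENNReal.ofReal_le_ofReal h2
    calc velMoment μ₀ Z τ ≤
          ∫⁻ p, (ENNReal.ofReal (4 / 3) * ‖(Z s p).2‖ₑ + ENNReal.ofReal (Q / 3)) ∂μ₀ :=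
          lintegral_mono h1
      _ = ENNReal.ofReal (4 / 3) * velMoment μ₀ Z s + ENNReal.ofReal (Q / 3) := by
          rw [lintegral_add_right _ measurable_const, lintegral_const_mul' _ _ (by simp)]
          simp [velMoment]
      _ = _ := by
          rw [ENNReal.ofReal_add (by positivity) (by positivity), ENNReal.ofReal_mul (by norm_num),
            ENNReal.ofReal_toReal hqs]
  obtain ⟨n, hn⟩ := hbd
  have hbdd : BddAbove ((fun τ => (velMoment μ₀ Z τ).toReal) '' uIcc s t) :=
    ⟨n, by rintro _ ⟨τ, hτ, rfl⟩; exact hn τ hτ⟩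
  set Q := sSup ((fun τ => (velMoment μ₀ Z τ).toReal) '' uIcc s t) with hQdef
  have hQ : ∀ τ ∈ uIcc s t, (velMoment μ₀ Z τ).toReal ≤ Q := fun τ hτ =>
    le_csSup hbdd ⟨τ, hτ, rfl⟩
  have hQ0 : 0 ≤ Q := ENNReal.toReal_nonneg.trans (hQ s left_mem_uIcc)
  have hk := key Q hQ0 hQ
  have hreal : ∀ τ ∈ uIcc s t, (velMoment μ₀ Z τ).toReal ≤
      4 / 3 * (velMoment μ₀ Z s).toReal + Q / 3 := fun τ hτ => by
    have := ENNReal.toReal_mono ENNReal.ofReal_ne_top (hk τ hτ)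
    rwa [ENNReal.toReal_ofReal (by positivity)] at this
  have hQle : Q ≤ 4 / 3 * (velMoment μ₀ Z s).toReal + Q / 3 := by
    refine csSup_le (nonempty_uIcc.image _) ?_
    rintro _ ⟨τ, hτ, rfl⟩
    exact hreal τ hτ
  refine ⟨ne_top_of_le_ne_top ENNReal.ofReal_ne_top (hk t right_mem_uIcc), ?_⟩
  have := hQ t right_mem_uIcc
  linarith

end IsKineticFlow

end KineticFlow

section MomentBound

set_option linter.unusedSectionVars false

variable {E : Type*} [NormedAddCommGroup E] [InnerProductSpace ℝ E] [FiniteDimensional ℝ E]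
  [MeasureSpace E] [BorelSpace E] [(volume : Measure E).IsAddHaarMeasure]

theorem exists_volume_closedBall_mul_le [Nontrivial E] {a b : ℝ} (hb : 0 < b) :
    ∃ ε > 0, a * volume.real (closedBall (0 : E) ε) ≤ b := by
  have hc : ContinuousAt (fun ε : ℝ => a * (ε ^ Module.finrank ℝ E * volume.real (ball (0 : E) 1)))
      0 := by fun_prop
  have h0 : (fun ε : ℝ => a * (ε ^ Module.finrank ℝ E * volume.real (ball (0 : E) 1))) 0 < b := by
    simp [hb, Module.finrank_pos.ne']
  have := (hc.eventually (gt_mem_nhds h0)).filter_mono (nhdsWithin_le_nhds (s := Ioi 0))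
  obtain ⟨ε, h1, h2⟩ := (this.and self_mem_nhdsWithin).exists
  refine ⟨ε, h2, ?_⟩
  have h3 : volume.real (closedBall (0 : E) ε) =
      ε ^ Module.finrank ℝ E * volume.real (ball (0 : E) 1) := by
    rw [Measure.real, Measure.addHaar_closedBall _ _ (le_of_lt h2), ENNReal.toReal_mul,
      ENNReal.toReal_ofReal (pow_nonneg (le_of_lt h2) _), Measure.real]
  rw [h3]
  exact h1.le

variable {K : ℝ → ℝ} {κ K₀ L T : ℝ}

theorem measurable_field (hK : IsCommWeight K κ K₀ L) {μ : Measure (E × E)}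
    [IsProbabilityMeasure μ] : Measurable fun p : E × E => field K μ p.1 p.2 := by
  by_cases hμ : Integrable (fun p : E × E => p.2) μ
  · simp_rw [field_eq hK hμ]
    exact ((measurable_fieldDrift hK).comp measurable_fst).sub
      (((measurable_fieldRate hK).comp measurable_fst).smul measurable_snd)
  · simp_rw [field_eq_zero hK hμ]
    exact measurable_const

/-- A law with bounded density cannot concentrate near the zero set of its own field. -/
theorem le_integral_min_norm_field (hK : IsCommWeight K κ K₀ L) {μ : Measure (E × E)}
    [IsProbabilityMeasure μ] {C : NNReal} (hμ : μ ≤ (C : ℝ≥0∞) • volume)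
    (hInt : Integrable (fun p : E × E => p.2) μ) {R ε : ℝ} (hR : 0 < R) (hε : 0 < ε)
    (hRε : C * volume.real (closedBall (0 : E) R) * volume.real (closedBall (0 : E) ε) ≤ 1 / 4)
    (hX : ∫ p, min 1 (‖p.1‖ / R) ∂μ ≤ 1 / 4) :
    min 1 (κ * ε) / 2 ≤ ∫ p, min 1 ‖field K μ p.1 p.2‖ ∂μ := by
  set u : E → E := fun x => (fieldRate K μ x)⁻¹ • fieldDrift K μ x with hu
  have hum : Measurable u := (measurable_fieldRate hK).inv.smul (measurable_fieldDrift hK)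
  set A : Set (E × E) := {p | 1 ≤ min 1 (‖p.1‖ / R)} with hA
  set B : Set (E × E) := {p | p.1 ∈ closedBall 0 R ∧ p.2 ∈ closedBall (u p.1) ε} with hB
  have hBm : MeasurableSet B := by
    refine MeasurableSet.inter (measurable_fst measurableSet_closedBall) ?_
    exact measurableSet_le (measurable_snd.dist (hum.comp measurable_fst)) measurable_const
  have hA1 : μ.real A ≤ 1 / 4 := by
    have := mul_meas_ge_le_integral_of_nonneg (μ := μ) (f := fun p : E × E => min 1 (‖p.1‖ / R))
      (Filter.Eventually.of_forall fun p => le_min zero_le_one (by positivity))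
      (Integrable.of_bound (by fun_prop) 1 (Filter.Eventually.of_forall fun p => by
        rw [Real.norm_of_nonneg (le_min zero_le_one (by positivity))]; exact min_le_left _ _)) 1
    rw [one_mul] at this
    exact this.trans hX
  have hB1 : μ.real B ≤ 1 / 4 := by
    have h1 : volume B ≤ volume (closedBall (0 : E) R) * volume (closedBall (0 : E) ε) := by
      change (volume.prod volume) B ≤ _
      rw [Measure.prod_apply hBm]
      calc _ = ∫⁻ x in closedBall (0 : E) R, volume (closedBall (0 : E) ε) := by
            rw [← lintegral_indicator measurableSet_closedBall]
            refine lintegral_congr fun x => ?_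
            by_cases hx : x ∈ closedBall (0 : E) R
            · rw [indicator_of_mem hx]
              have : Prod.mk x ⁻¹' B = closedBall (u x) ε := by
                ext v; simp only [hB, mem_preimage]
                exact ⟨fun h => h.2, fun h => ⟨hx, h⟩⟩
              rw [this, Measure.addHaar_closedBall_center]
            · rw [indicator_of_notMem hx]
              have : Prod.mk x ⁻¹' B = ∅ := by
                ext v; simp only [hB, mem_preimage, mem_empty_iff_false, iff_false]
                exact fun h => hx h.1
              rw [this, measure_empty]
        _ ≤ _ := by rw [setLIntegral_const, mul_comm]
    have h2 : μ B ≤ C * (volume (closedBall (0 : E) R) * volume (closedBall (0 : E) ε)) :=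
      (hμ B).trans (by
        rw [Measure.smul_apply, smul_eq_mul]; exact mul_le_mul_right h1 _)
    have h3 := ENNReal.toReal_mono (ENNReal.mul_ne_top ENNReal.coe_ne_top
      (ENNReal.mul_ne_top measure_closedBall_lt_top.ne measure_closedBall_lt_top.ne)) h2
    rw [ENNReal.toReal_mul, ENNReal.toReal_mul, ENNReal.coe_toReal, ← mul_assoc] at h3
    exact h3.trans hRε
  have hm0 : 0 ≤ min 1 (κ * ε) := le_min zero_le_one (mul_pos hK.pos hε).le
  have hcompl : 1 / 2 ≤ μ.real (A ∪ B)ᶜ := by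
    have hAm : MeasurableSet A := measurableSet_le (by fun_prop) (by fun_prop)
    rw [probReal_compl_eq_one_sub (hAm.union hBm)]
    have := measureReal_union_le (μ := μ) A B
    linarith
  have hsub : (A ∪ B)ᶜ ⊆ {p | min 1 (κ * ε) ≤ min 1 ‖field K μ p.1 p.2‖} := by
    intro p hp
    have hpA : p ∉ A := fun h => hp (Or.inl h)
    have hpB : p ∉ B := fun h => hp (Or.inr h)
    have h1 : ‖p.1‖ ≤ R := by
      by_contra hcon
      push Not at hcon
      have h5 : 1 ≤ ‖p.1‖ / R := by rw [le_div_iff₀ hR]; linarith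
      have h6 : 1 ≤ min 1 (‖p.1‖ / R) := le_min le_rfl h5
      exact hpA h6
    have h2 : ε < dist p.2 (u p.1) := by
      by_contra hcon
      push Not at hcon
      exact hpB ⟨by simpa using h1, hcon⟩
    have hl := fieldRate_mem (μ := μ) hK p.1
    have hl0 : 0 < fieldRate K μ p.1 := hK.pos.trans_le hl.1
    have h3 : field K μ p.1 p.2 = fieldRate K μ p.1 • (u p.1 - p.2) := by
      rw [field_eq hK hInt, smul_sub, hu, smul_inv_smul₀ hl0.ne']
    have h4 : κ * ε ≤ ‖field K μ p.1 p.2‖ := by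
      rw [h3, norm_smul, Real.norm_of_nonneg hl0.le, ← dist_eq_norm, dist_comm]
      exact mul_le_mul hl.1 h2.le hε.le hl0.le
    exact min_le_min le_rfl h4
  have hmk := mul_meas_ge_le_integral_of_nonneg (μ := μ)
      (f := fun p : E × E => min 1 ‖field K μ p.1 p.2‖)
      (Filter.Eventually.of_forall fun p => le_min zero_le_one (norm_nonneg _))
      (Integrable.of_bound (measurable_const.min (measurable_field hK).norm).aestronglyMeasurable 1
        (Filter.Eventually.of_forall fun p => by
        rw [Real.norm_of_nonneg (le_min zero_le_one (norm_nonneg _))]; exact min_le_left _ _))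
      (min 1 (κ * ε))
  have := measureReal_mono (μ := μ) hsub
  calc min 1 (κ * ε) / 2 = min 1 (κ * ε) * (1 / 2) := by ring
    _ ≤ _ := mul_le_mul_of_nonneg_left (hcompl.trans this) hm0
    _ ≤ _ := hmk

end MomentBound

section MomentBoundFlow

set_option linter.unusedSectionVars false

variable {E : Type*} [NormedAddCommGroup E] [InnerProductSpace ℝ E] [FiniteDimensional ℝ E]
  [MeasureSpace E] [BorelSpace E] [(volume : Measure E).IsAddHaarMeasure]

open Filter Topology

namespace IsKineticFlow

variable {K : ℝ → ℝ} {κ K₀ L T : ℝ} {μ₀ : Measure (E × E)} [IsProbabilityMeasure μ₀] {C : NNReal}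
  {Z : ℝ → E × E → E × E}

theorem continuousOn_fst (hZ : IsKineticFlow K T μ₀ C Z) (p : E × E) :
    ContinuousOn (fun t => (Z t p).1) (Icc 0 T) := fun t ht => (hZ.fst p t ht).continuousWithinAt

theorem continuousOn_snd (hZ : IsKineticFlow K T μ₀ C Z) (p : E × E) :
    ContinuousOn (fun t => (Z t p).2) (Icc 0 T) := fun t ht => (hZ.snd p t ht).continuousWithinAt

theorem aemeasurable_fst (hZ : IsKineticFlow K T μ₀ C Z) {t : ℝ} (ht : t ∈ Icc 0 T) :
    AEMeasurable (fun p => (Z t p).1) μ₀ := measurable_fst.comp_aemeasurable (hZ.aemeasurable t ht)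

theorem aemeasurable_snd (hZ : IsKineticFlow K T μ₀ C Z) {t : ℝ} (ht : t ∈ Icc 0 T) :
    AEMeasurable (fun p => (Z t p).2) μ₀ := measurable_snd.comp_aemeasurable (hZ.aemeasurable t ht)

theorem isClosed_velMoment_le (hZ : IsKineticFlow K T μ₀ C Z) (n : ℝ≥0∞) :
    IsClosed {t | t ∈ Icc 0 T ∧ velMoment μ₀ Z t ≤ n} := by
  refine IsSeqClosed.isClosed fun u t hu hut => ?_
  have ht : t ∈ Icc 0 T := isClosed_Icc.mem_of_tendsto hut (Eventually.of_forall fun k => (hu k).1)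
  refine ⟨ht, ?_⟩
  have hut' : Tendsto u atTop (𝓝[Icc 0 T] t) :=
    tendsto_nhdsWithin_iff.2 ⟨hut, Eventually.of_forall fun k => (hu k).1⟩
  have h1 : ∀ p, ‖(Z t p).2‖ₑ = liminf (fun k => ‖(Z (u k) p).2‖ₑ) atTop := fun p =>
    (((hZ.continuousOn_snd p t ht).tendsto.comp hut').enorm.liminf_eq).symm
  calc velMoment μ₀ Z t = ∫⁻ p, liminf (fun k => ‖(Z (u k) p).2‖ₑ) atTop ∂μ₀ := lintegral_congr h1
    _ ≤ liminf (fun k => ∫⁻ p, ‖(Z (u k) p).2‖ₑ ∂μ₀) atTop :=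
        lintegral_liminf_le' fun k => (hZ.aemeasurable_snd (hu k).1).enorm
    _ ≤ n := by
        refine (liminf_le_liminf (Eventually.of_forall fun k => (hu k).2)).trans ?_
        simp

/-- The times at which positions are tight at scale `R` and the velocity increments over time
lags shorter than `δ` are small in mean compared to the lag. -/
def slowTimes (T : ℝ) (μ₀ : Measure (E × E)) (Z : ℝ → E × E → E × E) (R δ c : ℝ) : Set ℝ :=
  {t | t ∈ Icc 0 T ∧ ∫ p, min 1 (‖(Z t p).1‖ / R) ∂μ₀ ≤ 1 / 4} ∩
    ⋂ s ∈ Icc 0 T, ({t | t ∈ Icc 0 T ∧ δ ≤ |s - t|} ∪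
      {t | t ∈ Icc 0 T ∧ ∫ p, min |s - t| ‖(Z s p).2 - (Z t p).2‖ ∂μ₀ - c * |s - t| ≤ 0})

theorem continuousOn_integral_min_fst (hZ : IsKineticFlow K T μ₀ C Z) {R : ℝ} (hR : 0 < R) :
    ContinuousOn (fun t => ∫ p, min 1 (‖(Z t p).1‖ / R) ∂μ₀) (Icc 0 T) := by
  refine continuousOn_of_dominated (bound := fun _ => 1) (fun t ht => ?_)
    (fun t _ => Eventually.of_forall fun p => ?_) (integrable_const _)
    (Eventually.of_forall fun p => ?_)
  · exact (aemeasurable_const.min ((hZ.aemeasurable_fst ht).norm.div_const _)).aestronglyMeasurable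
  · rw [Real.norm_of_nonneg (le_min zero_le_one (by positivity))]
    exact min_le_left _ _
  · exact continuousOn_const.inf ((hZ.continuousOn_fst p).norm.div_const _)

theorem continuousOn_integral_min_snd (hZ : IsKineticFlow K T μ₀ C Z) {s : ℝ} (hs : s ∈ Icc 0 T) :
    ContinuousOn (fun t => ∫ p, min |s - t| ‖(Z s p).2 - (Z t p).2‖ ∂μ₀) (Icc 0 T) := by
  refine continuousOn_of_dominated (bound := fun _ => T) (fun t ht => ?_)
    (fun t ht => Eventually.of_forall fun p => ?_) (integrable_const _)
    (Eventually.of_forall fun p => ?_)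
  · exact (aemeasurable_const.min
      ((hZ.aemeasurable_snd hs).sub (hZ.aemeasurable_snd ht)).norm).aestronglyMeasurable
  · rw [Real.norm_of_nonneg (le_min (abs_nonneg _) (norm_nonneg _))]
    refine (min_le_left _ _).trans ?_
    rw [abs_le]; constructor <;> linarith [hs.1, hs.2, ht.1, ht.2]
  · exact ContinuousOn.inf (by fun_prop) (continuousOn_const.sub (hZ.continuousOn_snd p)).norm

theorem isClosed_slowTimes (hZ : IsKineticFlow K T μ₀ C Z) {R δ c : ℝ} (hR : 0 < R) :
    IsClosed (slowTimes T μ₀ Z R δ c) := by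
  refine IsClosed.inter ?_ (isClosed_biInter fun s hs => IsClosed.union ?_ ?_)
  · exact (hZ.continuousOn_integral_min_fst hR).preimage_isClosed_of_isClosed isClosed_Icc
      (isClosed_Iic (a := 1 / 4))
  · exact (continuousOn_const.sub continuousOn_id).abs.preimage_isClosed_of_isClosed isClosed_Icc
      (isClosed_Ici (a := δ))
  · exact ((hZ.continuousOn_integral_min_snd hs).sub
      (continuousOn_const.mul (continuousOn_const.sub continuousOn_id).abs)
      ).preimage_isClosed_of_isClosed isClosed_Icc (isClosed_Iic (a := 0))

theorem tendsto_integral_min_slope (hZ : IsKineticFlow K T μ₀ C Z) {t : ℝ} (ht : t ∈ Icc 0 T) :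
    Tendsto (fun s => ∫ p, min 1 ‖slope (fun τ => (Z τ p).2) t s‖ ∂μ₀) (𝓝[Icc 0 T \ {t}] t)
      (𝓝 (∫ p, min 1 ‖field K (μ₀.map (Z t)) (Z t p).1 (Z t p).2‖ ∂μ₀)) := by
  refine tendsto_integral_filter_of_dominated_convergence (fun _ => 1) ?_ ?_ (integrable_const _) ?_
  · filter_upwards [self_mem_nhdsWithin] with s hs
    simp only [slope_def_module]
    exact (aemeasurable_const.min (((hZ.aemeasurable_snd hs.1).sub
      (hZ.aemeasurable_snd ht)).const_smul _).norm).aestronglyMeasurable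
  · refine Eventually.of_forall fun s => Eventually.of_forall fun p => ?_
    rw [Real.norm_of_nonneg (le_min zero_le_one (norm_nonneg _))]
    exact min_le_left _ _
  · refine Eventually.of_forall fun p => ?_
    exact tendsto_const_nhds.min (hasDerivWithinAt_iff_tendsto_slope.1 (hZ.snd p t ht)).norm

theorem integral_min_abs_eq (s t : ℝ) (hst : s ≠ t) :
    ∫ p, min |s - t| ‖(Z s p).2 - (Z t p).2‖ ∂μ₀ =
      |s - t| * ∫ p, min 1 ‖slope (fun τ => (Z τ p).2) t s‖ ∂μ₀ := by
  rw [← integral_const_mul]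
  refine integral_congr_ae (Eventually.of_forall fun p => ?_)
  have h0 : 0 < |s - t| := abs_pos.2 (sub_ne_zero.2 hst)
  simp only [slope_def_module]
  rw [norm_smul, norm_inv, Real.norm_eq_abs, mul_min_of_nonneg _ _ h0.le, mul_one,
    mul_inv_cancel_left₀ h0.ne']

theorem mem_slowTimes_of_velMoment_eq_top (hK : IsCommWeight K κ K₀ L)
    (hZ : IsKineticFlow K T μ₀ C Z) {t : ℝ} (ht : t ∈ Icc 0 T) (hq : velMoment μ₀ Z t = ∞)
    {c : ℕ → ℝ} (hc : ∀ k, 0 < c k) :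
    ∃ k m : ℕ, t ∈ slowTimes T μ₀ Z (k + 1) (1 / (m + 1)) (c k) := by
  have hprob := hZ.isProbabilityMeasure ht
  have hR : Tendsto (fun k : ℕ => ∫ p, min 1 (‖(Z t p).1‖ / (k + 1)) ∂μ₀) atTop
      (𝓝 (∫ _p, (0 : ℝ) ∂μ₀)) := by
    refine tendsto_integral_of_dominated_convergence (fun _ => 1) (fun k => ?_)
      (integrable_const _) (fun k => Eventually.of_forall fun p => ?_)
      (Eventually.of_forall fun p => ?_)
    · exact (aemeasurable_const.min
        ((hZ.aemeasurable_fst ht).norm.div_const _)).aestronglyMeasurable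
    · rw [Real.norm_of_nonneg (le_min zero_le_one (by positivity))]
      exact min_le_left _ _
    · have h1 : Tendsto (fun k : ℕ => ‖(Z t p).1‖ * (1 / ((k : ℝ) + 1))) atTop (𝓝 0) := by
        simpa using tendsto_one_div_add_atTop_nhds_zero_nat.const_mul ‖(Z t p).1‖
      simp_rw [mul_one_div] at h1
      have := (tendsto_const_nhds (x := (1 : ℝ))).min h1
      rwa [min_eq_right zero_le_one] at this
  rw [integral_zero] at hR
  obtain ⟨k, hk⟩ := (hR.eventually (ge_mem_nhds (show (0 : ℝ) < 1 / 4 by norm_num))).exists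
  have hfield : ∀ x v, field K (μ₀.map (Z t)) x v = 0 := fun x v =>
    field_eq_zero hK (by rw [integrable_snd_iff, hZ.velMoment_eq ht, hq]; simp) x v
  have hlim := hZ.tendsto_integral_min_slope ht
  simp only [hfield, norm_zero, zero_le_one, min_eq_right, integral_zero] at hlim
  have hev := hlim.eventually (ge_mem_nhds (hc k))
  rw [eventually_nhdsWithin_iff, Metric.eventually_nhds_iff] at hev
  obtain ⟨δ, hδ, hs⟩ := hev
  obtain ⟨m, hm⟩ := exists_nat_one_div_lt hδ
  refine ⟨k, m, ⟨ht, hk⟩, mem_iInter₂.2 fun s hsI => ?_⟩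
  by_cases hst : 1 / ((m : ℝ) + 1) ≤ |s - t|
  · exact Or.inl ⟨ht, hst⟩
  refine Or.inr ⟨ht, ?_⟩
  by_cases h : s = t
  · simp [h]
  rw [integral_min_abs_eq s t h]
  have := hs (y := s) (by rw [Real.dist_eq]; linarith) ⟨hsI, h⟩
  nlinarith [abs_nonneg (s - t)]

theorem velMoment_eq_top_of_mem_slowTimes (hT : 0 < T) (hK : IsCommWeight K κ K₀ L)
    (hZ : IsKineticFlow K T μ₀ C Z) {R δ ε : ℝ} (hδ : 0 < δ) (hR : 0 < R) (hε : 0 < ε)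
    (hRε : C * volume.real (closedBall (0 : E) R) * volume.real (closedBall (0 : E) ε) ≤ 1 / 4)
    {t : ℝ} (ht : t ∈ slowTimes T μ₀ Z R δ (min 1 (κ * ε) / 4)) : velMoment μ₀ Z t = ∞ := by
  obtain ⟨⟨htI, hX⟩, hV⟩ := ht
  by_contra hq
  have hprob := hZ.isProbabilityMeasure htI
  have h1 := le_integral_min_norm_field hK (hZ.density t htI)
    (by rw [integrable_snd_iff, hZ.velMoment_eq htI]; exact hq) hR hε hRε (by
      rw [integral_map (hZ.aemeasurable t htI) (by fun_prop)]; exact hX)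
  rw [integral_map (hZ.aemeasurable t htI)
    (measurable_const.min (measurable_field hK).norm).aestronglyMeasurable] at h1
  have hne : (𝓝[Icc 0 T \ {t}] t).NeBot := by
    exact accPt_principal_iff_nhdsWithin.1
      (uniqueDiffWithinAt_iff_accPt.1 (uniqueDiffOn_Icc hT t htI))
  have hpos : 0 < min 1 (κ * ε) := lt_min zero_lt_one (mul_pos hK.pos hε)
  have h2 : ∫ p, min 1 ‖field K (μ₀.map (Z t)) (Z t p).1 (Z t p).2‖ ∂μ₀ ≤ min 1 (κ * ε) / 4 := by
    refine le_of_tendsto (hZ.tendsto_integral_min_slope htI) ?_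
    have hball : ∀ᶠ s in 𝓝[Icc 0 T \ {t}] t, |s - t| < δ :=
      nhdsWithin_le_nhds (Metric.ball_mem_nhds t hδ)
    filter_upwards [self_mem_nhdsWithin, hball] with s hs hsδ
    rcases mem_iInter₂.1 hV s hs.1 with h | h
    · exact absurd h.2 (not_le.2 hsδ)
    · have h3 := h.2
      have hst : s ≠ t := hs.2
      rw [integral_min_abs_eq s t hst] at h3
      have h0 : 0 < |s - t| := abs_pos.2 (sub_ne_zero.2 hst)
      have h4 := sub_nonpos.1 h3
      rw [mul_comm _ |s - t|] at h4
      exact le_of_mul_le_mul_left h4 h0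
  linarith

theorem exists_velMoment_bound [Nontrivial E] (hT : 0 < T) (hK : IsCommWeight K κ K₀ L)
    (hZ : IsKineticFlow K T μ₀ C Z) :
    ∃ n, ∀ t ∈ Icc 0 T, (velMoment μ₀ Z t).toReal ≤ n := by
  choose ε hε hRε using fun k : ℕ => exists_volume_closedBall_mul_le (E := E)
    (a := C * volume.real (closedBall (0 : E) ((k : ℝ) + 1))) (b := 1 / 4) (by norm_num)
  have hδ : 0 < 1 / (4 * K₀) := by have := hK.bound_pos; positivity
  refine exists_bound_of_doubling_of_closed_cover (ι := ℕ ⊕ (ℕ × ℕ)) hδ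
    (fun s hs t ht => hZ.velMoment_doubling hK hs ht)
    (A := Sum.elim (fun n => {t | t ∈ Icc 0 T ∧ velMoment μ₀ Z t ≤ (n : ℝ≥0∞)})
      fun km => slowTimes T μ₀ Z (km.1 + 1) (1 / (km.2 + 1)) (min 1 (κ * ε km.1) / 4)) ?_ ?_ ?_
  · rintro (n | ⟨k, m⟩)
    · exact hZ.isClosed_velMoment_le n
    · exact hZ.isClosed_slowTimes (by positivity)
  · intro t ht
    by_cases hq : velMoment μ₀ Z t = ∞
    · obtain ⟨k, m, h⟩ := hZ.mem_slowTimes_of_velMoment_eq_top hK ht hq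
        (c := fun k => min 1 (κ * ε k) / 4) fun k => by
          have := lt_min zero_lt_one (mul_pos hK.pos (hε k))
          positivity
      exact mem_iUnion.2 ⟨Sum.inr (k, m), h⟩
    · obtain ⟨n, hn⟩ := ENNReal.exists_nat_gt hq
      exact mem_iUnion.2 ⟨Sum.inl n, ht, hn.le⟩
  · rintro (n | ⟨k, m⟩)
    · exact ⟨n, fun t ht => by simpa using ENNReal.toReal_mono (by simp) ht.2⟩
    · refine ⟨0, fun t ht => ?_⟩
      rw [hZ.velMoment_eq_top_of_mem_slowTimes hT hK (by positivity) (by positivity) (hε k)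
        (hRε k) ht]
      simp

/-- The first velocity moment grows at most exponentially. -/
theorem velMoment_le [Nontrivial E] (hT : 0 < T) (hK : IsCommWeight K κ K₀ L)
    (hZ : IsKineticFlow K T μ₀ C Z) (h0 : velMoment μ₀ Z 0 ≠ ∞) {t : ℝ} (ht : t ∈ Icc 0 T) :
    velMoment μ₀ Z t ≠ ∞ ∧
      (velMoment μ₀ Z t).toReal ≤ 2 ^ ⌈T * (4 * K₀)⌉₊ * (velMoment μ₀ Z 0).toReal := by
  obtain ⟨n, hn⟩ := hZ.exists_velMoment_bound hT hK
  have hK0 := hK.bound_pos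
  have hδ : 0 < 1 / (4 * K₀) := by positivity
  refine bound_of_doubling hδ (fun s hs t ht hst hq => hZ.velMoment_doubling hK hs ht hst
    ⟨n, fun τ hτ => hn τ (uIcc_subset_Icc hs ht hτ)⟩ hq) h0 _ t ht ?_
  rw [mul_one_div, le_div_iff₀ (by positivity)]
  exact (mul_le_mul_of_nonneg_right ht.2 (by positivity)).trans (Nat.le_ceil _)

end IsKineticFlow

end MomentBoundFlow

section FieldRegularity

set_option linter.unusedSectionVars false

variable {E : Type*} [NormedAddCommGroup E] [InnerProductSpace ℝ E] [FiniteDimensional ℝ E]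
  [MeasureSpace E] [BorelSpace E] [(volume : Measure E).IsAddHaarMeasure]

open Filter Topology

/-- Lipschitz constant of the mass function of a law with density at most `D`, supported in the
product of two balls of radius `a`. -/
def massLip (E : Type*) [NormedAddCommGroup E] [InnerProductSpace ℝ E] [MeasureSpace E]
    (D a : ℝ) : ℝ :=
  D * (volume.real (ball (0 : E) 1) * (Module.finrank ℝ E * (2 * a) ^ (Module.finrank ℝ E - 1))) *
    volume.real (closedBall (0 : E) a)

theorem massLip_nonneg {D a : ℝ} (hD : 0 ≤ D) (ha : 0 ≤ a) : 0 ≤ massLip E D a := by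
  unfold massLip; positivity

theorem massIn_mono {μ : Measure (E × E)} [IsProbabilityMeasure μ] (x : E) {r r' : ℝ}
    (h : r ≤ r') : massIn μ x r ≤ massIn μ x r' :=
  measureReal_mono fun _ hp => le_trans hp h

theorem volume_real_closedBall_sub_le (x : E) {r r' b : ℝ} (hr : 0 ≤ r) (hrr : r ≤ r')
    (hb : r' ≤ b) :
    volume.real (closedBall x r' \ closedBall x r) ≤
      volume.real (ball (0 : E) 1) * (Module.finrank ℝ E * b ^ (Module.finrank ℝ E - 1)) *
        (r' - r) := by
  have h3 : ∀ s, 0 ≤ s → volume.real (closedBall x s) =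
      s ^ Module.finrank ℝ E * volume.real (ball (0 : E) 1) := fun s hs => by
    rw [Measure.real, Measure.addHaar_closedBall _ _ hs, ENNReal.toReal_mul,
      ENNReal.toReal_ofReal (pow_nonneg hs _), Measure.real]
  rw [measureReal_sdiff (closedBall_subset_closedBall hrr) measurableSet_closedBall
    measure_closedBall_lt_top.ne, h3 _ hr, h3 _ (hr.trans hrr), ← sub_mul]
  have h4 : r' ^ Module.finrank ℝ E - r ^ Module.finrank ℝ E ≤
      (r' - r) * Module.finrank ℝ E * b ^ (Module.finrank ℝ E - 1) := by
    have := abs_pow_sub_pow_le r' r (Module.finrank ℝ E)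
    rw [abs_of_nonneg (sub_nonneg.2 hrr), abs_of_nonneg hr, abs_of_nonneg (hr.trans hrr),
      max_eq_left hrr] at this
    refine (le_abs_self _).trans (this.trans ?_)
    have h0 := sub_nonneg.2 hrr
    have h1 : 0 ≤ r' := hr.trans hrr
    gcongr
  calc _ ≤ ((r' - r) * Module.finrank ℝ E * b ^ (Module.finrank ℝ E - 1)) *
        volume.real (ball (0 : E) 1) := mul_le_mul_of_nonneg_right h4 measureReal_nonneg
    _ = _ := by ring

theorem massIn_le_add {μ : Measure (E × E)} [IsProbabilityMeasure μ] {D : NNReal}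
    (hμ : μ ≤ (D : ℝ≥0∞) • volume) {a : ℝ} (hs : ∀ᵐ p ∂μ, ‖p.1‖ ≤ a ∧ ‖p.2‖ ≤ a) {x : E}
    (hx : ‖x‖ ≤ a) {r r' : ℝ} (hr : 0 ≤ r) (hrr : r ≤ r') :
    massIn μ x r' ≤ massIn μ x r + massLip E D a * (r' - r) := by
  have ha : 0 ≤ a := (norm_nonneg x).trans hx
  set A : Set E := closedBall x (min r' (2 * a)) \ closedBall x (min r (2 * a)) with hA
  have h1 : μ.real ({p | dist p.1 x ≤ r'} \ {p | dist p.1 x ≤ r}) ≤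
      D * (volume.real A * volume.real (closedBall (0 : E) a)) := by
    have h2 : μ ({p | dist p.1 x ≤ r'} \ {p | dist p.1 x ≤ r}) ≤ μ (A ×ˢ closedBall (0 : E) a) := by
      refine measure_mono_ae ?_
      filter_upwards [hs] with p hp hpr
      have h3 : dist p.1 x ≤ r' := hpr.1
      have h4 : ¬ dist p.1 x ≤ r := hpr.2
      have h5 : dist p.1 x ≤ 2 * a := by
        have := dist_triangle_right p.1 x 0
        rw [dist_zero_right, dist_zero_right] at this
        linarith [hp.1]
      refine ⟨⟨mem_closedBall.2 (le_min h3 h5), fun h => h4 ?_⟩, by simpa using hp.2⟩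
      exact (mem_closedBall.1 h).trans (min_le_left _ _)
    have h3 : volume (A ×ˢ closedBall (0 : E) a) = volume A * volume (closedBall (0 : E) a) :=
      Measure.prod_prod _ _
    have h4 := h2.trans (hμ (A ×ˢ closedBall (0 : E) a))
    rw [Measure.smul_apply, smul_eq_mul, h3] at h4
    have hAf : volume A ≠ ∞ :=
      ne_top_of_le_ne_top measure_closedBall_lt_top.ne (measure_mono sdiff_subset)
    have h5 := ENNReal.toReal_mono (ENNReal.mul_ne_top ENNReal.coe_ne_top
      (ENNReal.mul_ne_top hAf measure_closedBall_lt_top.ne)) h4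
    rwa [ENNReal.toReal_mul, ENNReal.toReal_mul, ENNReal.coe_toReal] at h5
  have h6 : volume.real A ≤ volume.real (ball (0 : E) 1) *
      (Module.finrank ℝ E * (2 * a) ^ (Module.finrank ℝ E - 1)) * (r' - r) := by
    refine (volume_real_closedBall_sub_le x (le_min hr (by positivity)) (min_le_min hrr le_rfl)
      (min_le_right _ _)).trans (mul_le_mul_of_nonneg_left ?_ (by positivity))
    rcases le_total r' (2 * a) with h | h
    · rw [min_eq_left h, min_eq_left (hrr.trans h)]
    · rw [min_eq_right h]
      rcases le_total r (2 * a) with h' | h'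
      · rw [min_eq_left h']; linarith
      · rw [min_eq_right h']; linarith
  have h7 : massIn μ x r' ≤ massIn μ x r +
      μ.real ({p | dist p.1 x ≤ r'} \ {p | dist p.1 x ≤ r}) := by
    unfold massIn
    refine le_trans (measureReal_mono ?_) (measureReal_union_le _ _)
    intro p hp
    by_cases h : dist p.1 x ≤ r
    · exact Or.inl h
    · exact Or.inr ⟨hp, h⟩
  refine h7.trans (add_le_add_right (h1.trans ?_) _)
  calc _ ≤ (D : ℝ) * ((volume.real (ball (0 : E) 1) *
      (Module.finrank ℝ E * (2 * a) ^ (Module.finrank ℝ E - 1)) * (r' - r)) *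
        volume.real (closedBall (0 : E) a)) := by gcongr
    _ = _ := by unfold massLip; ring

theorem massIn_zero [Nontrivial E] {μ : Measure (E × E)} {D : NNReal}
    (hμ : μ ≤ (D : ℝ≥0∞) • volume) (x : E) : massIn μ x 0 = 0 := by
  have h1 : {p : E × E | dist p.1 x ≤ 0} = {x} ×ˢ univ := by
    ext p
    change dist p.1 x ≤ 0 ↔ _
    rw [dist_le_zero]
    simp
  have h2 : volume ({x} ×ˢ univ : Set (E × E)) = 0 := by
    change (volume.prod volume) _ = 0
    rw [Measure.prod_prod, measure_singleton, zero_mul]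
  have h3 : μ ({x} ×ˢ univ) ≤ 0 := (hμ _).trans (by simp [h2])
  rw [massIn, h1, Measure.real, nonpos_iff_eq_zero.1 h3, ENNReal.toReal_zero]

end FieldRegularity

section ConfinedFlow

set_option linter.unusedSectionVars false

variable {E : Type*} [NormedAddCommGroup E] [InnerProductSpace ℝ E] [FiniteDimensional ℝ E]
  [MeasureSpace E] [BorelSpace E] [(volume : Measure E).IsAddHaarMeasure]

open Filter Topology

/-- Almost every trajectory starts in `S`, and trajectories starting in `S` stay in a bounded
region of phase space. -/
structure IsConfined (T : ℝ) (μ₀ : Measure (E × E)) (Z : ℝ → E × E → E × E) (S : Set (E × E))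
    (a : ℝ) : Prop where
  ae_mem : ∀ᵐ p ∂μ₀, p ∈ S
  fst_le : ∀ p ∈ S, ∀ t ∈ Icc 0 T, ‖(Z t p).1‖ ≤ a
  snd_le : ∀ p ∈ S, ∀ t ∈ Icc 0 T, ‖(Z t p).2‖ ≤ a

namespace IsKineticFlow

variable {K : ℝ → ℝ} {κ K₀ L T a : ℝ} {μ₀ : Measure (E × E)} [IsProbabilityMeasure μ₀] {D : NNReal}
  {Z : ℝ → E × E → E × E} {S : Set (E × E)}

theorem ae_map (hZ : IsKineticFlow K T μ₀ D Z) (hc : IsConfined T μ₀ Z S a) {t : ℝ}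
    (ht : t ∈ Icc 0 T) : ∀ᵐ p ∂(μ₀.map (Z t)), ‖p.1‖ ≤ a ∧ ‖p.2‖ ≤ a := by
  rw [ae_map_iff (hZ.aemeasurable t ht)]
  · filter_upwards [hc.ae_mem] with p hp using ⟨hc.fst_le p hp t ht, hc.snd_le p hp t ht⟩
  · exact (measurableSet_le measurable_fst.norm measurable_const).inter
      (measurableSet_le measurable_snd.norm measurable_const)

theorem radius_nonneg (hT : 0 ≤ T) (hc : IsConfined T μ₀ Z S a) : 0 ≤ a := by
  obtain ⟨p, hp⟩ := hc.ae_mem.exists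
  exact (norm_nonneg _).trans (hc.fst_le p hp 0 ⟨le_rfl, hT⟩)

theorem velMoment_toReal_le (hc : IsConfined T μ₀ Z S a) {t : ℝ}
    (ht : t ∈ Icc 0 T) : (velMoment μ₀ Z t).toReal ≤ a := by
  have ha := radius_nonneg (ht.1.trans ht.2) hc
  refine ENNReal.toReal_le_of_le_ofReal ha ?_
  calc velMoment μ₀ Z t ≤ ∫⁻ _p, ENNReal.ofReal a ∂μ₀ := by
        refine lintegral_mono_ae ?_
        filter_upwards [hc.ae_mem] with p hp
        rw [← ofReal_norm]
        exact ENNReal.ofReal_le_ofReal (hc.snd_le p hp t ht)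
    _ = _ := by simp

theorem norm_fst_sub_le (hZ : IsKineticFlow K T μ₀ D Z) (hc : IsConfined T μ₀ Z S a) {s t : ℝ}
    (hs : s ∈ Icc 0 T) (ht : t ∈ Icc 0 T) {p : E × E} (hp : p ∈ S) :
    ‖(Z t p).1 - (Z s p).1‖ ≤ a * |t - s| :=
  (convex_Icc 0 T).norm_image_sub_le_of_norm_hasDerivWithin_le (hZ.fst p)
    (fun τ hτ => hc.snd_le p hp τ hτ) hs ht

theorem norm_snd_sub_le (hK : IsCommWeight K κ K₀ L) (hZ : IsKineticFlow K T μ₀ D Z)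
    (hc : IsConfined T μ₀ Z S a) {s t : ℝ}
    (hs : s ∈ Icc 0 T) (ht : t ∈ Icc 0 T) {p : E × E} (hp : p ∈ S) :
    ‖(Z t p).2 - (Z s p).2‖ ≤ 2 * K₀ * a * |t - s| :=
  (convex_Icc 0 T).norm_image_sub_le_of_norm_hasDerivWithin_le (hZ.snd p)
    (fun τ hτ => (norm_field_le hK hZ hτ _ _).trans (by
      have h1 := velMoment_toReal_le hc hτ
      have h2 := hc.snd_le p hp τ hτ
      have := hK.bound_pos
      calc _ ≤ K₀ * (a + a) := by gcongr
        _ = _ := by ring)) hs ht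

theorem field_map (hK : IsCommWeight K κ K₀ L) (hZ : IsKineticFlow K T μ₀ D Z) {t : ℝ}
    (ht : t ∈ Icc 0 T) (x v : E) : field K (μ₀.map (Z t)) x v =
      ∫ p, K (massIn (μ₀.map (Z t)) x (dist x (Z t p).1)) • ((Z t p).2 - v) ∂μ₀ := by
  have := hZ.isProbabilityMeasure ht
  rw [field, integral_map (hZ.aemeasurable t ht)]
  exact ((measurable_commWeight_right hK x).smul
    (measurable_snd.sub_const v)).aestronglyMeasurable

theorem massIn_map (hZ : IsKineticFlow K T μ₀ D Z) {t : ℝ} (ht : t ∈ Icc 0 T) (x : E) (r : ℝ) :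
    massIn (μ₀.map (Z t)) x r = μ₀.real {p | dist (Z t p).1 x ≤ r} := by
  rw [massIn, Measure.real, Measure.map_apply_of_aemeasurable (hZ.aemeasurable t ht)
    (measurableSet_le (by fun_prop) (by fun_prop))]
  rfl

theorem massIn_le_massIn (hZ : IsKineticFlow K T μ₀ D Z) (hc : IsConfined T μ₀ Z S a) {s t : ℝ}
    (hs : s ∈ Icc 0 T) (ht : t ∈ Icc 0 T) (x x' : E) (r : ℝ) :
    massIn (μ₀.map (Z s)) x r ≤ massIn (μ₀.map (Z t)) x' (r + dist x x' + a * |s - t|) := by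
  rw [hZ.massIn_map hs, hZ.massIn_map ht]
  refine ENNReal.toReal_mono (measure_ne_top _ _) (measure_mono_ae ?_)
  filter_upwards [hc.ae_mem] with p hp hpr
  have h1 : dist (Z s p).1 x ≤ r := hpr
  have h2 := hZ.norm_fst_sub_le hc hs ht hp
  rw [← dist_eq_norm, abs_sub_comm] at h2
  change dist (Z t p).1 x' ≤ _
  have h3 := dist_triangle (Z t p).1 (Z s p).1 x'
  have h4 := dist_triangle (Z s p).1 x x'
  linarith

theorem massIn_sub_le (hZ : IsKineticFlow K T μ₀ D Z) (hc : IsConfined T μ₀ Z S a) {b : ℝ}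
    (hab : a ≤ b) {s t : ℝ} (hs : s ∈ Icc 0 T) (ht : t ∈ Icc 0 T) (x y y' : E) {x' : E}
    (hx' : ‖x'‖ ≤ b) :
    massIn (μ₀.map (Z s)) x (dist x y) - massIn (μ₀.map (Z t)) x' (dist x' y') ≤
      massLip E D b * (2 * dist x x' + dist y y' + b * |s - t|) := by
  have hprob := hZ.isProbabilityMeasure ht
  have ha := radius_nonneg (hs.1.trans hs.2) hc
  have h1 := hZ.massIn_le_massIn hc hs ht x x' (dist x y)
  have h0 : 0 ≤ 2 * dist x x' + dist y y' + b * |s - t| := by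
    have : 0 ≤ b := ha.trans hab
    positivity
  have h2 : massIn (μ₀.map (Z t)) x' (dist x y + dist x x' + a * |s - t|) ≤
      massIn (μ₀.map (Z t)) x' (dist x' y' + (2 * dist x x' + dist y y' + b * |s - t|)) := by
    refine massIn_mono x' ?_
    have h3 := dist_triangle4 x x' y' y
    rw [dist_comm y' y] at h3
    have h4 : a * |s - t| ≤ b * |s - t| := mul_le_mul_of_nonneg_right hab (abs_nonneg _)
    linarith
  have h3 := massIn_le_add (hZ.density t ht) (a := b)
    ((hZ.ae_map hc ht).mono fun p hp => ⟨hp.1.trans hab, hp.2.trans hab⟩) hx'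
    (dist_nonneg (x := x') (y := y')) (le_add_of_nonneg_right h0)
  rw [add_sub_cancel_left] at h3
  linarith

theorem abs_massIn_sub_le (hZ : IsKineticFlow K T μ₀ D Z) (hc : IsConfined T μ₀ Z S a) {b : ℝ}
    (hab : a ≤ b) {s t : ℝ} (hs : s ∈ Icc 0 T) (ht : t ∈ Icc 0 T) (y y' : E) {x x' : E}
    (hx : ‖x‖ ≤ b) (hx' : ‖x'‖ ≤ b) :
    |massIn (μ₀.map (Z s)) x (dist x y) - massIn (μ₀.map (Z t)) x' (dist x' y')| ≤
      massLip E D b * (2 * dist x x' + dist y y' + b * |s - t|) := by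
  rw [abs_le']
  refine ⟨hZ.massIn_sub_le hc hab hs ht x y y' hx', ?_⟩
  have h := hZ.massIn_sub_le hc hab ht hs x' y' y hx
  rwa [neg_sub, dist_comm x x', dist_comm y y', abs_sub_comm s t]

/-- Lipschitz constant, jointly in time and phase space, of the field along a confined flow. -/
def _root_.fieldLip (E : Type*) [NormedAddCommGroup E] [InnerProductSpace ℝ E] [MeasureSpace E]
    (K₀ L D b : ℝ) : ℝ :=
  4 * L * massLip E D b * b * (1 + b) + K₀ * (1 + 2 * K₀ * b)

theorem norm_field_sub_le (hK : IsCommWeight K κ K₀ L) (hZ : IsKineticFlow K T μ₀ D Z)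
    (hc : IsConfined T μ₀ Z S a) {b : ℝ} (hab : a ≤ b) {s t : ℝ} (hs : s ∈ Icc 0 T)
    (ht : t ∈ Icc 0 T) {x x' v v' : E} (hx : ‖x‖ ≤ b) (hx' : ‖x'‖ ≤ b) (hv : ‖v‖ ≤ b) :
    ‖field K (μ₀.map (Z s)) x v - field K (μ₀.map (Z t)) x' v'‖ ≤
      fieldLip E K₀ L D b * (|s - t| + dist x x' + dist v v') := by
  have hps := hZ.isProbabilityMeasure hs
  have hpt := hZ.isProbabilityMeasure ht
  have hInt : ∀ t ∈ Icc 0 T, ∀ x v : E, Integrable (fun p =>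
      K (massIn (μ₀.map (Z t)) x (dist x (Z t p).1)) • ((Z t p).2 - v)) μ₀ := by
    intro t ht x v
    have hpt := hZ.isProbabilityMeasure ht
    have h1 : AEMeasurable (fun p => K (massIn (μ₀.map (Z t)) x (dist x (Z t p).1))) μ₀ :=
      (measurable_commWeight_right hK x).comp_aemeasurable (hZ.aemeasurable t ht)
    refine Integrable.of_bound
      (h1.smul ((hZ.aemeasurable_snd ht).sub_const v)).aestronglyMeasurable (K₀ * (a + ‖v‖)) ?_
    filter_upwards [hc.ae_mem] with p hp
    rw [norm_smul]
    exact mul_le_mul (hK.abs_le _) ((norm_sub_le _ _).trans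
      (by linarith [hc.snd_le p hp t ht])) (norm_nonneg _) hK.bound_pos.le
  rw [hZ.field_map hK hs, hZ.field_map hK ht, ← integral_sub (hInt s hs x v) (hInt t ht x' v')]
  have hb : 0 ≤ b := (norm_nonneg _).trans hx
  have hΛ : 0 ≤ massLip E D b := massLip_nonneg D.coe_nonneg hb
  have hK0 := hK.bound_pos
  have hL := hK.lip_nonneg
  refine (norm_integral_le_of_norm_le_const
    (C := fieldLip E K₀ L D b * (|s - t| + dist x x' + dist v v')) ?_).trans (by simp)
  filter_upwards [hc.ae_mem] with p hp
  set k := K (massIn (μ₀.map (Z s)) x (dist x (Z s p).1)) with hk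
  set k' := K (massIn (μ₀.map (Z t)) x' (dist x' (Z t p).1)) with hk'
  have e : k • ((Z s p).2 - v) - k' • ((Z t p).2 - v') =
      (k - k') • ((Z s p).2 - v) + k' • (((Z s p).2 - (Z t p).2) - (v - v')) := by
    simp only [smul_sub, sub_smul]; abel
  have h1 : |k - k'| ≤ L * (massLip E D b * (2 * dist x x' + 2 * b * |s - t|)) := by
    refine (hK.lip _ _).trans (mul_le_mul_of_nonneg_left ?_ hL)
    refine (hZ.abs_massIn_sub_le hc hab hs ht _ _ hx hx').trans
      (mul_le_mul_of_nonneg_left ?_ hΛ)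
    have h2 := hZ.norm_fst_sub_le hc ht hs hp
    rw [← dist_eq_norm] at h2
    have h4 : a * |s - t| ≤ b * |s - t| := mul_le_mul_of_nonneg_right hab (abs_nonneg _)
    linarith
  have h2 : ‖(Z s p).2 - v‖ ≤ 2 * b :=
    (norm_sub_le _ _).trans (by linarith [hc.snd_le p hp s hs])
  have h3 : ‖((Z s p).2 - (Z t p).2) - (v - v')‖ ≤ 2 * K₀ * b * |s - t| + dist v v' := by
    refine (norm_sub_le _ _).trans ?_
    rw [← dist_eq_norm v v']
    have h4 := norm_snd_sub_le hK hZ hc ht hs hp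
    have : 2 * K₀ * a * |s - t| ≤ 2 * K₀ * b * |s - t| := by gcongr
    linarith
  rw [e]
  calc ‖(k - k') • ((Z s p).2 - v) + k' • (((Z s p).2 - (Z t p).2) - (v - v'))‖
      ≤ |k - k'| * ‖(Z s p).2 - v‖ + |k'| * ‖((Z s p).2 - (Z t p).2) - (v - v')‖ := by
        refine (norm_add_le _ _).trans ?_
        rw [norm_smul, norm_smul, Real.norm_eq_abs, Real.norm_eq_abs]
    _ ≤ L * (massLip E D b * (2 * dist x x' + 2 * b * |s - t|)) * (2 * b) +
        K₀ * (2 * K₀ * b * |s - t| + dist v v') := by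
        gcongr
        exact hK.abs_le _
    _ ≤ _ := by
        unfold fieldLip
        have d1 := dist_nonneg (x := x) (y := x')
        have d2 := dist_nonneg (x := v) (y := v')
        have d3 := abs_nonneg (s - t)
        have m : 0 ≤ L * massLip E D b * b := by positivity
        have m2 : 0 ≤ K₀ * (K₀ * b) := by positivity
        nlinarith [mul_nonneg m d1, mul_nonneg m d2, mul_nonneg m d3, mul_nonneg m2 d1,
          mul_nonneg m2 d2, mul_nonneg m2 d3, mul_nonneg hK0.le d1, mul_nonneg hK0.le d2,
          mul_nonneg hK0.le d3, mul_nonneg (mul_nonneg m hb) d1, mul_nonneg (mul_nonneg m hb) d2,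
          mul_nonneg (mul_nonneg m hb) d3]

end IsKineticFlow

end ConfinedFlow

section Confinement

set_option linter.unusedSectionVars false

variable {E : Type*} [NormedAddCommGroup E] [InnerProductSpace ℝ E] [FiniteDimensional ℝ E]
  [MeasureSpace E] [BorelSpace E] [(volume : Measure E).IsAddHaarMeasure]

open Filter Topology

/-- A bound for velocities of the flow with initial data of size at most `Rv`. -/
def velRadius (K₀ T Rv : ℝ) : ℝ :=
  gronwallBound Rv K₀ (K₀ * (2 ^ ⌈T * (4 * K₀)⌉₊ * Rv)) T

/-- A bound for positions and velocities of the flow with initial data in balls of radii `Rx` and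
`Rv`. -/
def flowRadius (K₀ T Rx Rv : ℝ) : ℝ := Rx + (T + 1) * velRadius K₀ T Rv

theorem velRadius_nonneg {K₀ T Rv : ℝ} (hK : 0 ≤ K₀) (hT : 0 ≤ T) (hRv : 0 ≤ Rv) :
    Rv ≤ velRadius K₀ T Rv := by
  have := gronwallBound_mono (δ := Rv) (ε := K₀ * (2 ^ ⌈T * (4 * K₀)⌉₊ * Rv)) hRv (by positivity)
    hK hT
  rwa [gronwallBound_x0] at this

theorem norm_le_gronwallBound_of_Icc {F : Type*} [NormedAddCommGroup F] [NormedSpace ℝ F]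
    {f f' : ℝ → F} {T K₀ δ ε : ℝ} (hf : ∀ t ∈ Icc 0 T, HasDerivWithinAt f (f' t) (Icc 0 T) t)
    (h0 : ‖f 0‖ ≤ δ) (hb : ∀ t ∈ Icc 0 T, ‖f' t‖ ≤ K₀ * ‖f t‖ + ε) (hδ : 0 ≤ δ) (hε : 0 ≤ ε)
    (hK : 0 ≤ K₀) {t : ℝ} (ht : t ∈ Icc 0 T) : ‖f t‖ ≤ gronwallBound δ K₀ ε T := by
  have h := norm_le_gronwallBound_of_norm_deriv_right_le (f := f) (f' := f') (a := 0) (b := T)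
    (fun s hs => (hf s hs).continuousWithinAt)
    (fun s hs => (hf s ⟨hs.1, hs.2.le⟩).mono_of_mem_nhdsWithin (Icc_mem_nhdsGE_of_mem hs)) h0
    (fun s hs => hb s ⟨hs.1, hs.2.le⟩) t ht
  rw [sub_zero] at h
  exact h.trans (gronwallBound_mono hδ hε hK ht.2)

namespace IsKineticFlow

variable {K : ℝ → ℝ} {κ K₀ L T a : ℝ} {μ₀ : Measure (E × E)} [IsProbabilityMeasure μ₀] {D : NNReal}
  {Z : ℝ → E × E → E × E}

theorem isConfined [Nontrivial E] (hT : 0 < T) (hK : IsCommWeight K κ K₀ L)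
    (hZ : IsKineticFlow K T μ₀ D Z) {Rx Rv : ℝ} (hRv : 0 ≤ Rv)
    (hμ : ∀ᵐ p ∂μ₀, p ∈ closedBall (0 : E) Rx ×ˢ closedBall (0 : E) Rv) :
    IsConfined T μ₀ Z (closedBall (0 : E) Rx ×ˢ closedBall (0 : E) Rv)
      (flowRadius K₀ T Rx Rv) := by
  have hK0 := hK.bound_pos
  have hm0 : velMoment μ₀ Z 0 ≤ ENNReal.ofReal Rv := by
    calc velMoment μ₀ Z 0 ≤ ∫⁻ _p, ENNReal.ofReal Rv ∂μ₀ := by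
          refine lintegral_mono_ae ?_
          filter_upwards [hμ] with p hp
          rw [hZ.init, ← ofReal_norm]
          exact ENNReal.ofReal_le_ofReal (by simpa using hp.2)
      _ = _ := by simp
  set Q := 2 ^ ⌈T * (4 * K₀)⌉₊ * Rv with hQ
  have hQ0 : 0 ≤ Q := by positivity
  have hmom : ∀ t ∈ Icc 0 T, (velMoment μ₀ Z t).toReal ≤ Q := fun t ht =>
    (hZ.velMoment_le hT hK (ne_top_of_le_ne_top ENNReal.ofReal_ne_top hm0) ht).2.trans
      (mul_le_mul_of_nonneg_left (ENNReal.toReal_le_of_le_ofReal hRv hm0) (by positivity))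
  have hRR := velRadius_nonneg hK0.le hT.le hRv
  have hV : ∀ p ∈ closedBall (0 : E) Rx ×ˢ closedBall (0 : E) Rv, ∀ t ∈ Icc 0 T,
      ‖(Z t p).2‖ ≤ velRadius K₀ T Rv := fun p hp t ht => by
    refine norm_le_gronwallBound_of_Icc (f := fun τ => (Z τ p).2) (hZ.snd p) ?_ (fun s hs => ?_)
      hRv (by positivity) hK0.le ht
    · rw [hZ.init]; simpa using hp.2
    · refine (norm_field_le hK hZ hs _ _).trans ?_
      have := mul_le_mul_of_nonneg_left (hmom s hs) hK0.le
      linarith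
  have hX : ∀ p ∈ closedBall (0 : E) Rx ×ˢ closedBall (0 : E) Rv, ∀ t ∈ Icc 0 T,
      ‖(Z t p).1‖ ≤ Rx + T * velRadius K₀ T Rv := fun p hp t ht => by
    have h1 := (convex_Icc 0 T).norm_image_sub_le_of_norm_hasDerivWithin_le (hZ.fst p)
      (fun τ hτ => hV p hp τ hτ) ⟨le_rfl, hT.le⟩ ht
    rw [hZ.init, sub_zero, Real.norm_of_nonneg ht.1] at h1
    have h2 : ‖p.1‖ ≤ Rx := by simpa using hp.1
    have h3 : ‖(Z t p).1‖ ≤ ‖(Z t p).1 - p.1‖ + ‖p.1‖ := by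
      simpa using norm_add_le ((Z t p).1 - p.1) p.1
    have h4 : velRadius K₀ T Rv * t ≤ velRadius K₀ T Rv * T :=
      mul_le_mul_of_nonneg_left ht.2 (hRv.trans hRR)
    linarith
  have hRx : 0 ≤ Rx := by
    obtain ⟨p, hp⟩ := hμ.exists
    exact (norm_nonneg p.1).trans (by simpa using hp.1)
  refine ⟨hμ, fun p hp t ht => (hX p hp t ht).trans ?_, fun p hp t ht => (hV p hp t ht).trans ?_⟩
  · unfold flowRadius; linarith
  · unfold flowRadius
    have : 0 ≤ T * velRadius K₀ T Rv := mul_nonneg hT.le (hRv.trans hRR)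
    linarith

end IsKineticFlow

end Confinement

section DensityBound

set_option linter.unusedSectionVars false

variable {E : Type*} [NormedAddCommGroup E] [InnerProductSpace ℝ E] [FiniteDimensional ℝ E]
  [MeasureSpace E] [BorelSpace E] [(volume : Measure E).IsAddHaarMeasure]

open Filter Topology

theorem measurePreserving_shear (h : ℝ) :
    MeasurePreserving (fun p : E × E => (p.1 + h • p.2, p.2)) := by
  have h1 : MeasurePreserving (fun p : E × E => (p.1, p.2 + h • p.1)) (volume.prod volume)
      (volume.prod volume) := by
    refine (MeasurePreserving.id volume).skew_product (g := fun a x => x + h • a) (by fun_prop) ?_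
    exact Eventually.of_forall fun a => (measurePreserving_add_right volume _).map_eq
  exact (Measure.measurePreserving_swap.comp h1).comp Measure.measurePreserving_swap

theorem volume_map_affine_le {b : E → E} {l : E → ℝ} (hb : Measurable b) (hl : Measurable l)
    {c : ℝ} (hc : 0 < c) (hlc : ∀ x, c ≤ l x) :
    (volume : Measure (E × E)).map (fun p => (p.1, l p.1 • p.2 + b p.1)) ≤
      ENNReal.ofReal ((c ^ Module.finrank ℝ E)⁻¹) • volume := by
  have hm : Measurable fun p : E × E => (p.1, l p.1 • p.2 + b p.1) := by fun_prop
  refine Measure.le_iff.2 fun U hU => ?_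
  rw [Measure.map_apply hm hU, Measure.smul_apply, smul_eq_mul, Measure.volume_eq_prod,
    Measure.prod_apply (hm hU), Measure.prod_apply hU,
    ← lintegral_const_mul _ (measurable_measure_prodMk_left hU)]
  refine lintegral_mono fun x => ?_
  have h0 : 0 < l x := hc.trans_le (hlc x)
  have e : Prod.mk x ⁻¹' ((fun p : E × E => (p.1, l p.1 • p.2 + b p.1)) ⁻¹' U) =
      (fun v => l x • v) ⁻¹' ((fun v => v + b x) ⁻¹' (Prod.mk x ⁻¹' U)) := rfl
  rw [e, Measure.addHaar_preimage_smul _ h0.ne', measure_preimage_add_right]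
  refine mul_le_mul_left (ENNReal.ofReal_le_ofReal ?_) _
  rw [abs_of_nonneg (by positivity)]
  gcongr
  exact hlc x

/-- One step of a splitting scheme for the kinetic flow. -/
def eulerStep (K : ℝ → ℝ) (μ : Measure (E × E)) (h : ℝ) (p : E × E) : E × E :=
  (p.1 + h • p.2, p.2 + h • field K μ (p.1 + h • p.2) p.2)

/-- Iterates of the splitting scheme along a sequence of measures. -/
def eulerFlow (K : ℝ → ℝ) (μ : ℕ → Measure (E × E)) (h : ℝ) : ℕ → E × E → E × E
  | 0, p => p
  | k + 1, p => eulerStep K (μ k) h (eulerFlow K μ h k p)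

variable {K : ℝ → ℝ} {κ K₀ L T a : ℝ}

theorem eulerStep_eq {μ : Measure (E × E)} [IsProbabilityMeasure μ] (hK : IsCommWeight K κ K₀ L)
    (hμ : Integrable (fun p : E × E => p.2) μ) (h : ℝ) : eulerStep K μ h =
      (fun p => (p.1, (1 - h * fieldRate K μ p.1) • p.2 + h • fieldDrift K μ p.1)) ∘
        fun p : E × E => (p.1 + h • p.2, p.2) := by
  funext p
  simp only [eulerStep, Function.comp, Prod.mk.injEq, true_and]
  rw [field_eq hK hμ, smul_sub, sub_smul, one_smul, smul_smul]
  abel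

theorem measurable_eulerStep {μ : Measure (E × E)} [IsProbabilityMeasure μ]
    (hK : IsCommWeight K κ K₀ L) (hμ : Integrable (fun p : E × E => p.2) μ) (h : ℝ) :
    Measurable (eulerStep K μ h) := by
  rw [eulerStep_eq hK hμ]
  have h1 := measurable_fieldRate (μ := μ) hK
  have h2 := measurable_fieldDrift (μ := μ) hK
  fun_prop

theorem volume_map_eulerStep_le {μ : Measure (E × E)} [IsProbabilityMeasure μ]
    (hK : IsCommWeight K κ K₀ L) (hμ : Integrable (fun p : E × E => p.2) μ) {h : ℝ} (h0 : 0 ≤ h)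
    (h1 : h * K₀ ≤ 1 / 2) : (volume : Measure (E × E)).map (eulerStep K μ h) ≤
      ENNReal.ofReal (((1 - h * K₀) ^ Module.finrank ℝ E)⁻¹) • volume := by
  have m1 := measurable_fieldRate (μ := μ) hK
  have m2 := measurable_fieldDrift (μ := μ) hK
  rw [eulerStep_eq hK hμ, ← Measure.map_map (by fun_prop) (by fun_prop),
    (measurePreserving_shear h).map_eq]
  refine volume_map_affine_le (b := fun x => h • fieldDrift K μ x)
    (l := fun x => 1 - h * fieldRate K μ x) (by fun_prop) (by fun_prop) (by linarith) fun x => ?_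
  linarith [mul_le_mul_of_nonneg_left (fieldRate_mem (μ := μ) hK x).2 h0]

theorem measurable_eulerFlow {μ : ℕ → Measure (E × E)} (hK : IsCommWeight K κ K₀ L) (h : ℝ) {m : ℕ}
    (hp : ∀ k < m, IsProbabilityMeasure (μ k))
    (hμ : ∀ k < m, Integrable (fun p : E × E => p.2) (μ k)) :
    Measurable (eulerFlow K μ h m) := by
  induction m with
  | zero => exact measurable_id
  | succ k ih =>
    have := hp k k.lt_succ_self
    exact (measurable_eulerStep hK (hμ k k.lt_succ_self) h).comp
      (ih (fun j hj => hp j (hj.trans k.lt_succ_self)) fun j hj => hμ j (hj.trans k.lt_succ_self))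

theorem volume_map_eulerFlow_le {μ : ℕ → Measure (E × E)} (hK : IsCommWeight K κ K₀ L) {h : ℝ}
    (h0 : 0 ≤ h) (h1 : h * K₀ ≤ 1 / 2) {m : ℕ} (hp : ∀ k < m, IsProbabilityMeasure (μ k))
    (hμ : ∀ k < m, Integrable (fun p : E × E => p.2) (μ k)) :
    (volume : Measure (E × E)).map (eulerFlow K μ h m) ≤
      ENNReal.ofReal (((1 - h * K₀) ^ Module.finrank ℝ E)⁻¹ ^ m) • volume := by
  induction m with
  | zero =>
    have : eulerFlow K μ h 0 = id := rfl
    simp [this]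
  | succ k ih =>
    have := hp k k.lt_succ_self
    have hp' := fun j (hj : j < k) => hp j (hj.trans k.lt_succ_self)
    have hμ' := fun j (hj : j < k) => hμ j (hj.trans k.lt_succ_self)
    have e : eulerFlow K μ h (k + 1) = eulerStep K (μ k) h ∘ eulerFlow K μ h k := rfl
    have ms := measurable_eulerStep hK (hμ k k.lt_succ_self) h
    have hnn : 0 ≤ ((1 - h * K₀) ^ Module.finrank ℝ E)⁻¹ :=
      inv_nonneg.2 (pow_nonneg (by linarith) _)
    rw [e, ← Measure.map_map ms (measurable_eulerFlow hK h hp' hμ')]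
    refine (Measure.map_mono (ih hp' hμ') ms).trans ?_
    rw [Measure.map_smul, pow_succ, ENNReal.ofReal_mul (pow_nonneg hnn _), mul_smul]
    have hle := volume_map_eulerStep_le hK (hμ k k.lt_succ_self) h0 h1
    exact Measure.le_iff.2 fun s _ => mul_le_mul_right (hle s) _

theorem inv_one_sub_pow_pow_le {x : ℝ} (hx0 : 0 ≤ x) (hx : x ≤ 1 / 2) (n m : ℕ) :
    ((1 - x) ^ n)⁻¹ ^ m ≤ Real.exp (2 * n * (m * x)) := by
  have h1 : (1 - x)⁻¹ ≤ Real.exp (2 * x) := by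
    rw [inv_le_comm₀ (by linarith) (Real.exp_pos _), ← Real.exp_neg]
    have := Real.one_sub_inv_le_log_of_pos (show 0 < 1 - x by linarith)
    rw [← Real.le_log_iff_exp_le (by linarith)]
    refine le_trans ?_ this
    have : (1 - x)⁻¹ ≤ 1 + 2 * x := by
      rw [inv_le_iff_one_le_mul₀ (by linarith)]
      nlinarith
    linarith
  have h2 : (0:ℝ) ≤ (1 - x)⁻¹ := inv_nonneg.2 (by linarith)
  calc ((1 - x) ^ n)⁻¹ ^ m = (1 - x)⁻¹ ^ (n * m) := by rw [← inv_pow, pow_mul]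
    _ ≤ Real.exp (2 * x) ^ (n * m) := pow_le_pow_left₀ h2 h1 _
    _ = _ := by rw [← Real.exp_nat_mul]; congr 1; push_cast; ring

theorem norm_eulerStep_snd_le {μ : Measure (E × E)} [IsProbabilityMeasure μ]
    (hK : IsCommWeight K κ K₀ L) (hμ : ∀ᵐ p ∂μ, ‖p.2‖ ≤ a) {h : ℝ} (h0 : 0 ≤ h) (h1 : h * K₀ ≤ 1)
    {p : E × E} (hp : ‖p.2‖ ≤ a) : ‖(eulerStep K μ h p).2‖ ≤ a := by
  have hi : Integrable (fun p : E × E => p.2) μ := Integrable.of_bound (by fun_prop) a hμ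
  simp only [eulerStep]
  set x := p.1 + h • p.2
  have hr := fieldRate_mem (μ := μ) hK x
  have hd : ‖fieldDrift K μ x‖ ≤ fieldRate K μ x * a := by
    unfold fieldRate fieldDrift
    rw [← integral_mul_const]
    refine norm_integral_le_of_norm_le ((integrable_commWeight hK x).mul_const a) ?_
    filter_upwards [hμ] with q hq
    rw [norm_smul, Real.norm_of_nonneg (hK.nonneg _)]
    exact mul_le_mul_of_nonneg_left hq (hK.nonneg _)
  have e : p.2 + h • field K μ x p.2 =
      (1 - h * fieldRate K μ x) • p.2 + h • fieldDrift K μ x := by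
    rw [field_eq hK hi, smul_sub, sub_smul, one_smul, smul_smul]; abel
  have h2 : h * fieldRate K μ x ≤ 1 := (mul_le_mul_of_nonneg_left hr.2 h0).trans h1
  rw [e]
  calc _ ≤ ‖(1 - h * fieldRate K μ x) • p.2‖ + ‖h • fieldDrift K μ x‖ := norm_add_le _ _
    _ ≤ (1 - h * fieldRate K μ x) * a + h * (fieldRate K μ x * a) := by
      rw [norm_smul, norm_smul, Real.norm_of_nonneg (sub_nonneg.2 h2), Real.norm_of_nonneg h0]
      gcongr
    _ = a := by ring

theorem fieldLip_nonneg {D b : ℝ} (hK0 : 0 ≤ K₀) (hL : 0 ≤ L) (hD : 0 ≤ D) (hb : 0 ≤ b) :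
    0 ≤ fieldLip E K₀ L D b := by
  have := massLip_nonneg (E := E) hD hb
  unfold fieldLip
  positivity

theorem le_of_recursive_error {e : ℕ → ℝ} {m : ℕ} {h M A : ℝ} (hh : 0 ≤ h) (hM : 0 ≤ M) (hA : 0 ≤ A)
    (h0 : e 0 = 0) (hrec : ∀ k < m, e (k + 1) ≤ (1 + h * M) * e k + A * h ^ 2) :
    e m ≤ A * (m * h) * Real.exp (M * (m * h)) * h := by
  have key : ∀ k ≤ m, e k ≤ k * (A * h ^ 2) * (1 + h * M) ^ k := by
    intro k hk
    induction k with
    | zero => simp [h0]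
    | succ k ih =>
      have h1 : 1 ≤ 1 + h * M := by nlinarith [mul_nonneg hh hM]
      have h2 : (1:ℝ) ≤ (1 + h * M) ^ (k + 1) := one_le_pow₀ h1
      calc e (k + 1) ≤ (1 + h * M) * e k + A * h ^ 2 := hrec k hk
        _ ≤ (1 + h * M) * (k * (A * h ^ 2) * (1 + h * M) ^ k) +
            A * h ^ 2 * (1 + h * M) ^ (k + 1) := by
          have h4 := mul_le_mul_of_nonneg_left (ih (by omega)) (by linarith : 0 ≤ 1 + h * M)
          have h5 : A * h ^ 2 ≤ A * h ^ 2 * (1 + h * M) ^ (k + 1) :=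
            le_mul_of_one_le_right (by positivity) h2
          linarith
        _ = _ := by push_cast; ring
  refine (key m le_rfl).trans ?_
  have h3 : (1 + h * M) ^ m ≤ Real.exp (M * (m * h)) := by
    calc (1 + h * M) ^ m ≤ Real.exp (h * M) ^ m := by
          gcongr; linarith [Real.add_one_le_exp (h * M)]
      _ = _ := by rw [← Real.exp_nat_mul]; ring_nf
  calc (m:ℝ) * (A * h ^ 2) * (1 + h * M) ^ m ≤ m * (A * h ^ 2) * Real.exp (M * (m * h)) := by gcongr
    _ = _ := by ring

end DensityBound

section DensityBoundFlow

set_option linter.unusedSectionVars false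

variable {E : Type*} [NormedAddCommGroup E] [InnerProductSpace ℝ E] [FiniteDimensional ℝ E]
  [MeasureSpace E] [BorelSpace E] [(volume : Measure E).IsAddHaarMeasure]

open Filter Topology

namespace IsKineticFlow

variable {K : ℝ → ℝ} {κ K₀ L T a : ℝ} {μ₀ : Measure (E × E)} [IsProbabilityMeasure μ₀] {D : NNReal}
  {Z : ℝ → E × E → E × E} {S : Set (E × E)}

theorem integrable_snd (hZ : IsKineticFlow K T μ₀ D Z) (hc : IsConfined T μ₀ Z S a) {t : ℝ}
    (ht : t ∈ Icc 0 T) : Integrable (fun p : E × E => p.2) (μ₀.map (Z t)) := by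
  have := hZ.isProbabilityMeasure ht
  exact Integrable.of_bound (by fun_prop) a ((hZ.ae_map hc ht).mono fun p hp => hp.2)

theorem norm_fst_add_sub_le (hK : IsCommWeight K κ K₀ L) (hZ : IsKineticFlow K T μ₀ D Z)
    (hc : IsConfined T μ₀ Z S a) {t h : ℝ} (ht : t ∈ Icc 0 T) (hh : 0 ≤ h)
    (hth : t + h ∈ Icc 0 T) {p : E × E} (hp : p ∈ S) :
    ‖(Z (t + h) p).1 - (Z t p).1 - h • (Z t p).2‖ ≤ 2 * K₀ * a * h ^ 2 := by
  have hsub : Icc t (t + h) ⊆ Icc 0 T := Icc_subset_Icc ht.1 hth.2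
  have h1 := (convex_Icc t (t + h)).norm_image_sub_le_of_norm_hasDerivWithin_le
    (f := fun s => (Z s p).1 - s • (Z t p).2) (f' := fun s => (Z s p).2 - (Z t p).2)
    (C := 2 * K₀ * a * h) (x := t) (y := t + h)
    (fun s hs => by
      have := ((hasDerivWithinAt_id s (Icc t (t + h))).smul_const (Z t p).2)
      rw [one_smul] at this
      exact ((hZ.fst p s (hsub hs)).mono hsub).sub this)
    (fun s hs => by
      refine (norm_snd_sub_le hK hZ hc ht (hsub hs) hp).trans ?_
      have ha := radius_nonneg (ht.1.trans ht.2) hc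
      have := hK.bound_pos
      gcongr
      rw [abs_of_nonneg (by linarith [hs.1])]
      linarith [hs.2]) ⟨le_rfl, by linarith⟩ ⟨by linarith, le_rfl⟩
  have e : (Z (t + h) p).1 - (t + h) • (Z t p).2 - ((Z t p).1 - t • (Z t p).2) =
      (Z (t + h) p).1 - (Z t p).1 - h • (Z t p).2 := by
    rw [add_smul]; abel
  rw [e, add_sub_cancel_left, Real.norm_of_nonneg hh] at h1
  linarith

theorem norm_snd_add_sub_le (hK : IsCommWeight K κ K₀ L) (hZ : IsKineticFlow K T μ₀ D Z)
    (hc : IsConfined T μ₀ Z S a) {t h : ℝ} (ht : t ∈ Icc 0 T) (hh : 0 ≤ h)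
    (hth : t + h ∈ Icc 0 T) {p : E × E} (hp : p ∈ S) :
    ‖(Z (t + h) p).2 - (Z t p).2 - h • field K (μ₀.map (Z t)) (Z t p).1 (Z t p).2‖ ≤
      fieldLip E K₀ L D a * (1 + a + 2 * K₀ * a) * h ^ 2 := by
  have ha := radius_nonneg (ht.1.trans ht.2) hc
  have hK0 := hK.bound_pos
  have hf := fieldLip_nonneg (E := E) hK0.le hK.lip_nonneg D.coe_nonneg ha
  have hsub : Icc t (t + h) ⊆ Icc 0 T := Icc_subset_Icc ht.1 hth.2
  set w := field K (μ₀.map (Z t)) (Z t p).1 (Z t p).2 with hw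
  have h1 := (convex_Icc t (t + h)).norm_image_sub_le_of_norm_hasDerivWithin_le
    (f := fun s => (Z s p).2 - s • w)
    (f' := fun s => field K (μ₀.map (Z s)) (Z s p).1 (Z s p).2 - w)
    (C := fieldLip E K₀ L D a * (1 + a + 2 * K₀ * a) * h) (x := t) (y := t + h)
    (fun s hs => by
      have := ((hasDerivWithinAt_id s (Icc t (t + h))).smul_const w)
      rw [one_smul] at this
      exact ((hZ.snd p s (hsub hs)).mono hsub).sub this)
    (fun s hs => by
      refine (norm_field_sub_le hK hZ hc le_rfl (hsub hs) ht (hc.fst_le p hp s (hsub hs))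
        (hc.fst_le p hp t ht) (hc.snd_le p hp s (hsub hs))).trans ?_
      have h2 := hZ.norm_fst_sub_le hc ht (hsub hs) hp
      have h3 := norm_snd_sub_le hK hZ hc ht (hsub hs) hp
      rw [← dist_eq_norm] at h2 h3
      rw [mul_assoc]
      refine mul_le_mul_of_nonneg_left ?_ hf
      have h4 : |s - t| ≤ h := by
        rw [abs_of_nonneg (by linarith [hs.1])]
        linarith [hs.2]
      calc _ ≤ |s - t| + a * |s - t| + 2 * K₀ * a * |s - t| := by gcongr
        _ = (1 + a + 2 * K₀ * a) * |s - t| := by ring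
        _ ≤ _ := by gcongr) ⟨le_rfl, by linarith⟩ ⟨by linarith, le_rfl⟩
  have e : (Z (t + h) p).2 - (t + h) • w - ((Z t p).2 - t • w) =
      (Z (t + h) p).2 - (Z t p).2 - h • w := by
    rw [add_smul]; abel
  rw [e, add_sub_cancel_left, Real.norm_of_nonneg hh] at h1
  linarith

theorem norm_eulerFlow_le (hK : IsCommWeight K κ K₀ L) (hZ : IsKineticFlow K T μ₀ D Z)
    (hc : IsConfined T μ₀ Z S a) {h : ℝ} (hh : 0 ≤ h) (h1 : h * K₀ ≤ 1 / 2) {m : ℕ}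
    (hm : m * h ≤ T) {p : E × E} (hp : p ∈ S) :
    ‖(eulerFlow K (fun k => μ₀.map (Z (k * h))) h m p).1‖ ≤ a + m * h * a ∧
      ‖(eulerFlow K (fun k => μ₀.map (Z (k * h))) h m p).2‖ ≤ a := by
  have hT : 0 ≤ T := le_trans (by positivity) hm
  induction m with
  | zero =>
    have h1 := hc.fst_le p hp 0 ⟨le_rfl, hT⟩
    have h2 := hc.snd_le p hp 0 ⟨le_rfl, hT⟩
    rw [hZ.init] at h1 h2
    simpa [eulerFlow] using ⟨h1, h2⟩
  | succ k ih =>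
    push_cast at hm
    have hk : (k : ℝ) * h ∈ Icc 0 T := ⟨by positivity, by linarith⟩
    have := hZ.isProbabilityMeasure hk
    obtain ⟨i1, i2⟩ := ih hk.2
    refine ⟨?_, norm_eulerStep_snd_le hK ((hZ.ae_map hc hk).mono fun p hp => hp.2) hh
      (by linarith) i2⟩
    simp only [eulerFlow, eulerStep]
    refine (norm_add_le _ _).trans ?_
    rw [norm_smul, Real.norm_of_nonneg hh]
    push_cast
    linarith [mul_le_mul_of_nonneg_left i2 hh]

theorem dist_eulerFlow_le (hK : IsCommWeight K κ K₀ L) (hZ : IsKineticFlow K T μ₀ D Z)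
    (hc : IsConfined T μ₀ Z S a) {p : E × E} (hp : p ∈ S) :
    ∃ M, ∀ (m : ℕ) (h : ℝ), 0 ≤ h → h * K₀ ≤ 1 / 2 → m * h ≤ T →
      dist (Z (m * h) p) (eulerFlow K (fun k => μ₀.map (Z (k * h))) h m p) ≤ M * h := by
  by_cases hT : 0 ≤ T
  swap
  · exact ⟨0, fun m h hh _ hm => absurd (le_trans (by positivity) hm) hT⟩
  have ha := radius_nonneg hT hc
  have hK0 := hK.bound_pos
  set b := a + T * a with hb
  have hab : a ≤ b := le_add_of_nonneg_right (by positivity)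
  have hb0 := ha.trans hab
  have hf := fieldLip_nonneg (E := E) hK0.le hK.lip_nonneg D.coe_nonneg ha
  have hfb := fieldLip_nonneg (E := E) hK0.le hK.lip_nonneg D.coe_nonneg hb0
  set F := fieldLip E K₀ L D b with hF
  set F' := fieldLip E K₀ L D a * (1 + a + 2 * K₀ * a) with hF'
  have hF'0 : 0 ≤ F' := by positivity
  set A := 2 * K₀ * a + F' + F * a with hA
  have hA0 : 0 ≤ A := by positivity
  refine ⟨A * T * Real.exp ((F + 1) * T), fun m h hh h1 hm => ?_⟩
  set Ψ := eulerFlow K (fun k => μ₀.map (Z (k * h))) h with hΨ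
  set e : ℕ → ℝ := fun k => ‖(Z (k * h) p).1 - (Ψ k p).1‖ + ‖(Z (k * h) p).2 - (Ψ k p).2‖ with he
  have hrec : ∀ k < m, e (k + 1) ≤ (1 + h * (F + 1)) * e k + A * h ^ 2 := by
    intro k hk
    have hk1 : (k : ℝ) + 1 ≤ m := by exact_mod_cast hk
    have hkh : ((k : ℝ) + 1) * h ≤ T := (mul_le_mul_of_nonneg_right hk1 hh).trans hm
    have hk0 : (k : ℝ) * h ∈ Icc 0 T := ⟨by positivity, by linarith⟩
    have hks : (k : ℝ) * h + h ∈ Icc 0 T := ⟨by positivity, by linarith⟩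
    obtain ⟨i1, i2⟩ := norm_eulerFlow_le hK hZ hc hh h1 hk0.2 hp
    have hx' : ‖(Ψ k p).1 + h • (Ψ k p).2‖ ≤ b := by
      refine (norm_add_le _ _).trans ?_
      rw [norm_smul, Real.norm_of_nonneg hh]
      have h3 : h * ‖(Ψ k p).2‖ ≤ h * a := mul_le_mul_of_nonneg_left i2 hh
      have h4 : ((k : ℝ) + 1) * h * a ≤ T * a := mul_le_mul_of_nonneg_right hkh ha
      linarith
    have j1 := norm_fst_add_sub_le hK hZ hc hk0 hh hks hp
    have j2 := norm_snd_add_sub_le hK hZ hc hk0 hh hks hp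
    set X := (Z (k * h) p).1
    set V := (Z (k * h) p).2
    set x := (Ψ k p).1
    set v := (Ψ k p).2
    have j3 := norm_field_sub_le hK hZ hc hab hk0 hk0 (x := X) (x' := x + h • v) (v := V) (v' := v)
      ((hc.fst_le p hp _ hk0).trans hab) hx' ((hc.snd_le p hp _ hk0).trans hab)
    have j4 : dist X (x + h • v) ≤ ‖X - x‖ + h * a := by
      rw [dist_eq_norm, ← sub_sub]
      refine (norm_sub_le _ _).trans ?_
      rw [norm_smul, Real.norm_of_nonneg hh]
      gcongr
    rw [sub_self, abs_zero, zero_add, dist_eq_norm V v] at j3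
    have j5 := j3.trans (mul_le_mul_of_nonneg_left (add_le_add_left j4 _) hfb)
    set w := field K (μ₀.map (Z (k * h))) X V
    set w' := field K (μ₀.map (Z (k * h))) (x + h • v) v
    have k1 : (Ψ (k + 1) p) = (x + h • v, v + h • w') := rfl
    have k2 : ((k + 1 : ℕ) : ℝ) * h = k * h + h := by push_cast; ring
    have b1 : ‖(Z (k * h + h) p).1 - (x + h • v)‖ ≤
        2 * K₀ * a * h ^ 2 + (‖X - x‖ + h * ‖V - v‖) := by
      have : (Z (k * h + h) p).1 - (x + h • v) =
          ((Z (k * h + h) p).1 - X - h • V) + ((X - x) + h • (V - v)) := by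
        rw [smul_sub]; abel
      rw [this]
      refine (norm_add_le _ _).trans (add_le_add j1 ((norm_add_le _ _).trans ?_))
      rw [norm_smul, Real.norm_of_nonneg hh]
    have b2 : ‖(Z (k * h + h) p).2 - (v + h • w')‖ ≤
        F' * h ^ 2 + (‖V - v‖ + h * ‖w - w'‖) := by
      have : (Z (k * h + h) p).2 - (v + h • w') =
          ((Z (k * h + h) p).2 - V - h • w) + ((V - v) + h • (w - w')) := by
        rw [smul_sub]; abel
      rw [this]
      refine (norm_add_le _ _).trans (add_le_add j2 ((norm_add_le _ _).trans ?_))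
      rw [norm_smul, Real.norm_of_nonneg hh]
    have b3 := mul_le_mul_of_nonneg_left j5 hh
    simp only [he]
    rw [k1, k2]
    have n1 := mul_nonneg hh (norm_nonneg (X - x))
    refine (add_le_add b1 b2).trans ?_
    change _ ≤ (1 + h * (F + 1)) * (‖X - x‖ + ‖V - v‖) + A * h ^ 2
    rw [hA]
    linarith
  have h0 : e 0 = 0 := by simp [he, hΨ, eulerFlow, hZ.init]
  have hfin := le_of_recursive_error (m := m) hh (by positivity) hA0 h0 hrec
  rw [Prod.dist_eq, dist_eq_norm, dist_eq_norm]
  refine (max_le_add_of_nonneg (norm_nonneg _) (norm_nonneg _)).trans (hfin.trans ?_)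
  gcongr

/-- The density bound propagated from the initial datum. -/
def _root_.densBound (E : Type*) [NormedAddCommGroup E] [InnerProductSpace ℝ E] (B : NNReal)
    (K₀ T : ℝ) : NNReal :=
  B * (Real.exp (2 * Module.finrank ℝ E * (T * K₀))).toNNReal

theorem map_le_densBound (hK : IsCommWeight K κ K₀ L) (hZ : IsKineticFlow K T μ₀ D Z)
    (hc : IsConfined T μ₀ Z S a) {B : NNReal} (hB : μ₀ ≤ (B : ℝ≥0∞) • volume) {t : ℝ}
    (ht : t ∈ Icc 0 T) :
    μ₀.map (Z t) ≤ (densBound E B K₀ T : ℝ≥0∞) • volume := by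
  have hK0 := hK.bound_pos
  set h : ℕ → ℝ := fun m => t / m with hh
  have hh0 : ∀ m, 0 ≤ h m := fun m => div_nonneg ht.1 m.cast_nonneg
  have hlim : Tendsto h atTop (𝓝 0) := tendsto_const_div_atTop_nhds_zero_nat t
  have hsmall : ∀ᶠ m in atTop, h m * K₀ ≤ 1 / 2 ∧ (m : ℝ) * h m = t := by
    have h1 : Tendsto (fun m => h m * K₀) atTop (𝓝 (0 * K₀)) := hlim.mul_const _
    rw [zero_mul] at h1
    filter_upwards [h1.eventually_le_const (by norm_num : (0:ℝ) < 1 / 2), eventually_ge_atTop 1]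
      with m h2 hm
    exact ⟨h2, mul_div_cancel₀ t (by exact_mod_cast (by omega : m ≠ 0))⟩
  obtain ⟨m₀, hm₀⟩ := eventually_atTop.1 hsmall
  set Ψ : ℕ → E × E → E × E := fun m => eulerFlow K (fun k => μ₀.map (Z (k * h m))) (h m) m with hΨ
  have hpt : ∀ p ∈ S, Tendsto (fun m => Ψ m p) atTop (𝓝 (Z t p)) := by
    intro p hp
    obtain ⟨M, hM⟩ := dist_eulerFlow_le hK hZ hc hp
    have h1 : Tendsto (fun m => M * h m) atTop (𝓝 (M * 0)) := hlim.const_mul M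
    rw [mul_zero] at h1
    refine tendsto_iff_dist_tendsto_zero.2 (squeeze_zero' (Eventually.of_forall fun _ =>
      dist_nonneg) ?_ h1)
    filter_upwards [hsmall] with m hm
    have := hM m (h m) (hh0 m) hm.1 (hm.2.le.trans ht.2)
    rw [hm.2] at this
    rwa [dist_comm]
  have hvol : ∀ m ≥ m₀, ∀ U : Set (E × E), IsOpen U →
      μ₀ (Ψ m ⁻¹' U) ≤ (densBound E B K₀ T : ℝ≥0∞) * volume U := by
    intro m hm U hU
    have hmm := hm₀ m hm
    have hmem : ∀ k < m, (k : ℝ) * h m ∈ Icc 0 T := fun k hk =>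
      ⟨mul_nonneg k.cast_nonneg (hh0 m), (mul_le_mul_of_nonneg_right
        (Nat.cast_le.2 hk.le) (hh0 m)).trans (hmm.2.le.trans ht.2)⟩
    have hp : ∀ k < m, IsProbabilityMeasure (μ₀.map (Z (k * h m))) := fun k hk =>
      hZ.isProbabilityMeasure (hmem k hk)
    have hi : ∀ k < m, Integrable (fun p : E × E => p.2) (μ₀.map (Z (k * h m))) := fun k hk =>
      hZ.integrable_snd hc (hmem k hk)
    have hmeas := measurable_eulerFlow (μ := fun k => μ₀.map (Z (k * h m))) hK (h m) hp hi
    have hv := volume_map_eulerFlow_le (μ := fun k => μ₀.map (Z (k * h m))) hK (hh0 m) hmm.1 hp hi U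
    rw [Measure.map_apply hmeas hU.measurableSet, Measure.smul_apply, smul_eq_mul] at hv
    refine (hB _).trans ?_
    rw [Measure.smul_apply, smul_eq_mul]
    refine (mul_le_mul_right hv _).trans ?_
    rw [← mul_assoc]
    refine mul_le_mul_left ?_ _
    rw [densBound, ENNReal.coe_mul]
    refine mul_le_mul_right ?_ _
    refine ENNReal.ofReal_le_ofReal ((inv_one_sub_pow_pow_le
      (mul_nonneg (hh0 m) hK0.le) hmm.1 _ _).trans ?_)
    rw [← mul_assoc (m : ℝ), hmm.2]
    have := ht.2
    gcongr
  have hopen : ∀ U : Set (E × E), IsOpen U →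
      μ₀.map (Z t) U ≤ (densBound E B K₀ T : ℝ≥0∞) * volume U := by
    intro U hU
    rw [Measure.map_apply_of_aemeasurable (hZ.aemeasurable t ht) hU.measurableSet]
    have hsub : μ₀ (Z t ⁻¹' U) ≤ μ₀ (⋃ n : ℕ, ⋂ m ≥ max n m₀, Ψ m ⁻¹' U) := by
      refine measure_mono_ae ?_
      filter_upwards [hc.ae_mem] with p hp hpU
      obtain ⟨n, hn⟩ := eventually_atTop.1 ((hpt p hp).eventually (hU.mem_nhds hpU))
      exact mem_iUnion.2 ⟨n, mem_iInter₂.2 fun m hm => hn m ((le_max_left _ _).trans hm)⟩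
    refine hsub.trans ?_
    rw [Monotone.measure_iUnion]
    · exact iSup_le fun n => (measure_mono (iInter₂_subset (max n m₀)
        le_rfl)).trans (hvol _ (le_max_right _ _) U hU)
    · intro n n' hnn
      exact biInter_subset_biInter_left fun m hm => le_trans (max_le_max_right _ hnn) hm
  refine Measure.le_iff'.2 fun A => ?_
  have := Measure.OuterRegular.smul (volume : Measure (E × E))
    (ENNReal.coe_ne_top (r := densBound E B K₀ T))
  rw [Set.measure_eq_iInf_isOpen A ((densBound E B K₀ T : ℝ≥0∞) • (volume : Measure (E × E)))]
  exact le_iInf₂ fun U hAU => le_iInf fun hU => (measure_mono hAU).trans (hopen U hU)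

/-- The law of a confined flow satisfies the density bound propagated from the initial datum. -/
theorem isKineticFlow_densBound (hK : IsCommWeight K κ K₀ L)
    (hZ : IsKineticFlow K T μ₀ D Z)
    (hc : IsConfined T μ₀ Z S a) {B : NNReal} (hB : μ₀ ≤ (B : ℝ≥0∞) • volume) :
    IsKineticFlow K T μ₀ (densBound E B K₀ T) Z :=
  ⟨hZ.init, hZ.aemeasurable, hZ.fst, hZ.snd, fun _ ht => hZ.map_le_densBound hK hc hB ht⟩

end IsKineticFlow

end DensityBoundFlow

section Bridge

/-- The extension of a weight on `[0, 1]` to the real line by clamping the argument. -/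
def clampWeight (K : ℝ → ℝ) (a : ℝ) : ℝ := K (projIcc (0 : ℝ) 1 zero_le_one a)

theorem clampWeight_eq (K : ℝ → ℝ) {a : ℝ} (ha : a ∈ Icc (0 : ℝ) 1) : clampWeight K a = K a := by
  rw [clampWeight, projIcc_of_mem _ ha]

theorem isCommWeight_clampWeight {K : ℝ → ℝ} (hKpos : ∀ z ∈ Icc (0 : ℝ) 1, 0 < K z)
    (hKanti : AntitoneOn K (Icc (0 : ℝ) 1)) {LK : NNReal}
    (hKlip : LipschitzOnWith LK K (Icc (0 : ℝ) 1)) :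
    IsCommWeight (clampWeight K) (K 1) (K 0) LK := by
  have h0 : (0 : ℝ) ∈ Icc (0 : ℝ) 1 := ⟨le_rfl, zero_le_one⟩
  have h1 : (1 : ℝ) ∈ Icc (0 : ℝ) 1 := ⟨zero_le_one, le_rfl⟩
  refine ⟨hKpos 1 h1, fun a => hKanti (Subtype.prop _) h1 (projIcc 0 1 _ a).2.2,
    fun a => hKanti h0 (Subtype.prop _) (projIcc 0 1 _ a).2.1, fun a b => ?_⟩
  rw [← Real.dist_eq, ← Real.dist_eq]
  refine (hKlip.dist_le_mul _ (Subtype.prop _) _ (Subtype.prop _)).trans ?_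
  refine mul_le_mul_of_nonneg_left ?_ LK.coe_nonneg
  simpa [Subtype.dist_eq] using (LipschitzWith.projIcc (zero_le_one' ℝ)).dist_le_mul a b

section Density

variable {Ω : Type*} [MeasurableSpace Ω] {μ : Measure Ω} {f : Ω → ℝ}

theorem isProbabilityMeasure_withDensity_ofReal (hf0 : ∀ p, 0 ≤ f p) (h1 : ∫ p, f p ∂μ = 1) :
    IsProbabilityMeasure (μ.withDensity fun p => ENNReal.ofReal (f p)) := by
  constructor
  rw [withDensity_apply _ MeasurableSet.univ, Measure.restrict_univ,
    ← ofReal_integral_eq_lintegral_ofReal (integrable_of_integral_eq_one h1)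
      (Filter.Eventually.of_forall hf0), h1, ENNReal.ofReal_one]

theorem withDensity_ofReal_le {B : ℝ} (hB : ∀ᵐ p ∂μ, f p ≤ B) :
    μ.withDensity (fun p => ENNReal.ofReal (f p)) ≤ (B.toNNReal : ℝ≥0∞) • μ := by
  rw [← withDensity_const]
  exact withDensity_mono (hB.mono fun p hp => ENNReal.ofReal_le_ofReal hp)

theorem integral_withDensity_ofReal {F : Type*} [NormedAddCommGroup F] [NormedSpace ℝ F]
    (hf : Measurable f) (hf0 : ∀ p, 0 ≤ f p) (g : Ω → F) :
    ∫ p, g p ∂(μ.withDensity fun p => ENNReal.ofReal (f p)) = ∫ p, f p • g p ∂μ := by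
  rw [show (fun p => ENNReal.ofReal (f p)) = fun p => ((f p).toNNReal : ℝ≥0∞) from rfl,
    integral_withDensity_eq_integral_smul hf.real_toNNReal]
  refine integral_congr_ae (Filter.Eventually.of_forall fun p => ?_)
  change ((f p).toNNReal : ℝ) • g p = _
  rw [Real.coe_toNNReal _ (hf0 p)]

theorem ae_withDensity_ofReal {S : Set Ω} (hS : MeasurableSet S) (h : ∀ p, f p ≠ 0 → p ∈ S) :
    ∀ᵐ p ∂(μ.withDensity fun p => ENNReal.ofReal (f p)), p ∈ S := by
  rw [ae_iff]
  change (μ.withDensity _) Sᶜ = 0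
  rw [withDensity_apply _ hS.compl, setLIntegral_congr_fun (g := 0) hS.compl]
  · simp
  · intro p hp
    have : f p = 0 := by
      by_contra h'
      exact hp (h p h')
    simp [this]

theorem aemeasurable_comp_of_integral_ne_zero {G : Ω → ℝ} (hf : Measurable f) (hf0 : ∀ p, 0 ≤ f p)
    (h : ∫ p, G p * f p ∂μ ≠ 0) :
    AEMeasurable G (μ.withDensity fun p => ENNReal.ofReal (f p)) := by
  have hi : Integrable (fun p => G p * f p) μ := by
    by_contra h'
    exact h (integral_undef h')
  rw [show (fun p => ENNReal.ofReal (f p)) = fun p => ((f p).toNNReal : ℝ≥0∞) from rfl]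
  refine ((aestronglyMeasurable_withDensity_iff hf.real_toNNReal).2 ?_).aemeasurable
  refine hi.aestronglyMeasurable.congr (Filter.Eventually.of_forall fun p => ?_)
  change G p * f p = ((f p).toNNReal : ℝ) • G p
  rw [Real.coe_toNNReal _ (hf0 p), smul_eq_mul, mul_comm]

end Density

theorem measurable_real_tan : Measurable Real.tan := by
  have : Real.tan = fun x => Real.sin x / Real.cos x := by
    funext x; exact Real.tan_eq_sin_div_cos x
  rw [this]
  exact Real.measurable_sin.div Real.measurable_cos

variable {d : ℕ}

theorem aemeasurable_of_arctan_coord {Ω : Type*} [MeasurableSpace Ω] {μ : Measure Ω}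
    {g : Ω → EuclideanSpace ℝ (Fin d)}
    (h : ∀ i, AEMeasurable (fun ω => Real.arctan (g ω i)) μ) : AEMeasurable g μ := by
  have h1 : AEMeasurable (fun ω => (g ω).ofLp) μ := by
    refine aemeasurable_pi_iff.2 fun i => ?_
    have := measurable_real_tan.comp_aemeasurable (h i)
    refine this.congr (Filter.Eventually.of_forall fun ω => ?_)
    exact Real.tan_arctan _
  exact (WithLp.measurable_toLp 2 (Fin d → ℝ)).comp_aemeasurable h1

variable {T : ℝ} {K : ℝ → ℝ}
  {f₀ : EuclideanSpace ℝ (Fin d) × EuclideanSpace ℝ (Fin d) → ℝ}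
  {f : ℝ → EuclideanSpace ℝ (Fin d) × EuclideanSpace ℝ (Fin d) → ℝ}
  {g : EuclideanSpace ℝ (Fin d) × EuclideanSpace ℝ (Fin d) → ℝ}

theorem massIn_withDensity (hg0 : ∀ p, 0 ≤ g p) (hg1 : ∫ p, g p = 1)
    (x : EuclideanSpace ℝ (Fin d)) (r : ℝ) :
    massIn (volume.withDensity fun p => ENNReal.ofReal (g p)) x r = Mdens (Smarg g) x r := by
  have hi := integrable_of_integral_eq_one hg1
  have e : {p : EuclideanSpace ℝ (Fin d) × EuclideanSpace ℝ (Fin d) | dist p.1 x ≤ r} =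
      closedBall x r ×ˢ univ := by
    ext p; simp
  have hm : MeasurableSet (closedBall x r ×ˢ (univ : Set (EuclideanSpace ℝ (Fin d)))) :=
    measurableSet_closedBall.prod MeasurableSet.univ
  rw [massIn, e, Measure.real, withDensity_apply _ hm,
    ← ofReal_integral_eq_lintegral_ofReal hi.integrableOn (Filter.Eventually.of_forall hg0),
    ENNReal.toReal_ofReal (integral_nonneg hg0), Measure.volume_eq_prod,
    setIntegral_prod _ (by rw [← Measure.volume_eq_prod]; exact hi.integrableOn)]
  simp [Mdens, Smarg]

theorem massIn_mem {E : Type*} [NormedAddCommGroup E] [MeasurableSpace E]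
    [InnerProductSpace ℝ E] [FiniteDimensional ℝ E] [BorelSpace E]
    (μ : Measure (E × E)) [IsProbabilityMeasure μ] (x : E) (r : ℝ) :
    massIn μ x r ∈ Icc (0 : ℝ) 1 := ⟨massIn_nonneg _ _ _, massIn_le_one _ _⟩

theorem wfield_eq_field (hg : Measurable g) (hg0 : ∀ p, 0 ≤ g p) (hg1 : ∫ p, g p = 1)
    (x v : EuclideanSpace ℝ (Fin d)) :
    Wfield K (Smarg g) g x v =
      field (clampWeight K) (volume.withDensity fun p => ENNReal.ofReal (g p)) x v := by
  have := isProbabilityMeasure_withDensity_ofReal (μ := volume) hg0 hg1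
  rw [field, integral_withDensity_ofReal hg hg0, Wfield]
  congr 1
  funext p
  rw [clampWeight_eq K (massIn_mem _ _ _), massIn_withDensity hg0 hg1, smul_smul, mul_comm]

theorem aemeasurable_of_forall_integral_eq {f₀ f₁ : EuclideanSpace ℝ (Fin d) ×
    EuclideanSpace ℝ (Fin d) → ℝ} {Z : EuclideanSpace ℝ (Fin d) × EuclideanSpace ℝ (Fin d) →
      EuclideanSpace ℝ (Fin d) × EuclideanSpace ℝ (Fin d)} (hf : Measurable f₀)
    (hf0 : ∀ p, 0 ≤ f₀ p) (hg0 : ∀ p, 0 ≤ f₁ p) (hg1 : ∫ p, f₁ p = 1)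
    (h : ∀ α : EuclideanSpace ℝ (Fin d) × EuclideanSpace ℝ (Fin d) → ℝ, Continuous α →
      (∃ C : ℝ, ∀ p, |α p| ≤ C) → (∫ p, α p * f₁ p) = ∫ p, α (Z p) * f₀ p) :
    AEMeasurable Z (volume.withDensity fun p => ENNReal.ofReal (f₀ p)) := by
  have hi := integrable_of_integral_eq_one hg1
  have key : ∀ α : EuclideanSpace ℝ (Fin d) × EuclideanSpace ℝ (Fin d) → ℝ, Continuous α →
      (∃ C : ℝ, ∀ p, |α p| ≤ C) →
      AEMeasurable (fun p => α (Z p)) (volume.withDensity fun p => ENNReal.ofReal (f₀ p)) := by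
    rintro α hα ⟨C, hC⟩
    have hb : ∀ p, |α p + (C + 1)| ≤ C + (C + 1) := fun p => by
      have h1 := abs_le.1 (hC p)
      have h2 := (abs_nonneg _).trans (hC p)
      rw [abs_of_nonneg (by linarith)]
      linarith
    have hne : ∫ p, (α (Z p) + (C + 1)) * f₀ p ≠ 0 := by
      rw [← h (fun p => α p + (C + 1)) (by fun_prop) ⟨_, hb⟩]
      have : ∫ p, f₁ p ≤ ∫ p, (α p + (C + 1)) * f₁ p := by
        refine integral_mono hi (hi.bdd_mul (c := C + (C + 1)) (by fun_prop)
          (Filter.Eventually.of_forall hb)) fun p => ?_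
        have h1 := abs_le.1 (hC p)
        exact le_mul_of_one_le_left (hg0 p) (by linarith)
      linarith
    have := (aemeasurable_comp_of_integral_ne_zero hf hf0 hne).sub_const (C + 1)
    simpa using this
  refine AEMeasurable.prodMk (f := fun p => (Z p).1) (g := fun p => (Z p).2)
    (aemeasurable_of_arctan_coord fun i => ?_) (aemeasurable_of_arctan_coord fun i => ?_)
  · exact key (fun p => Real.arctan (p.1 i)) (by fun_prop)
      ⟨Real.pi / 2, fun p => abs_le.2 ⟨(Real.neg_pi_div_two_lt_arctan _).le,
        (Real.arctan_lt_pi_div_two _).le⟩⟩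
  · exact key (fun p => Real.arctan (p.2 i)) (by fun_prop)
      ⟨Real.pi / 2, fun p => abs_le.2 ⟨(Real.neg_pi_div_two_lt_arctan _).le,
        (Real.arctan_lt_pi_div_two _).le⟩⟩

theorem map_withDensity_eq {f₀ f₁ : EuclideanSpace ℝ (Fin d) ×
    EuclideanSpace ℝ (Fin d) → ℝ} {Z : EuclideanSpace ℝ (Fin d) × EuclideanSpace ℝ (Fin d) →
      EuclideanSpace ℝ (Fin d) × EuclideanSpace ℝ (Fin d)} (hf : Measurable f₀)
    (hf0 : ∀ p, 0 ≤ f₀ p) (hf1 : ∫ p, f₀ p = 1) (hg : Measurable f₁) (hg0 : ∀ p, 0 ≤ f₁ p)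
    (hg1 : ∫ p, f₁ p = 1)
    (h : ∀ α : EuclideanSpace ℝ (Fin d) × EuclideanSpace ℝ (Fin d) → ℝ, Continuous α →
      (∃ C : ℝ, ∀ p, |α p| ≤ C) → (∫ p, α p * f₁ p) = ∫ p, α (Z p) * f₀ p) :
    (volume.withDensity fun p => ENNReal.ofReal (f₀ p)).map Z =
      volume.withDensity fun p => ENNReal.ofReal (f₁ p) := by
  have hZ := aemeasurable_of_forall_integral_eq hf hf0 hg0 hg1 h
  have h0 := isProbabilityMeasure_withDensity_ofReal (μ := volume) hf0 hf1
  have h1 := isProbabilityMeasure_withDensity_ofReal (μ := volume) hg0 hg1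
  have h2 := Measure.isProbabilityMeasure_map hZ
  refine ext_of_forall_integral_eq_of_IsFiniteMeasure fun α => ?_
  rw [integral_map hZ α.continuous.aestronglyMeasurable, integral_withDensity_ofReal hf hf0,
    integral_withDensity_ofReal hg hg0]
  have := h α α.continuous ⟨‖α‖, fun p => α.norm_coe_le_norm p⟩
  simp only [smul_eq_mul]
  simp_rw [mul_comm (f₁ _), mul_comm (f₀ _)]
  exact this.symm

/-- A weak solution is transported by a kinetic flow. -/
theorem IsWeakSolCS.exists_isKineticFlow (h : IsWeakSolCS K T f₀ f) (hf : Measurable f₀)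
    (hf0 : ∀ p, 0 ≤ f₀ p) (hf1 : ∫ p, f₀ p = 1) :
    ∃ (C : NNReal) (Z : ℝ → EuclideanSpace ℝ (Fin d) × EuclideanSpace ℝ (Fin d) →
        EuclideanSpace ℝ (Fin d) × EuclideanSpace ℝ (Fin d)),
      IsKineticFlow (clampWeight K) T (volume.withDensity fun p => ENNReal.ofReal (f₀ p)) C Z ∧
      ∀ t ∈ Icc 0 T, (volume.withDensity fun p => ENNReal.ofReal (f₀ p)).map (Z t) =
        volume.withDensity fun p => ENNReal.ofReal (f t p) := by
  obtain ⟨h1, ⟨C, hC⟩, -, Z, hZ0, hZ, hpush⟩ := h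
  have hmap : ∀ t ∈ Icc 0 T, (volume.withDensity fun p => ENNReal.ofReal (f₀ p)).map (Z t) =
      volume.withDensity fun p => ENNReal.ofReal (f t p) := fun t ht =>
    map_withDensity_eq hf hf0 hf1 (h1 t ht).1 (h1 t ht).2.1 (h1 t ht).2.2 (hpush t ht)
  refine ⟨C.toNNReal, Z, ⟨hZ0, fun t ht => aemeasurable_of_forall_integral_eq hf hf0
    (h1 t ht).2.1 (h1 t ht).2.2 (hpush t ht), fun p t ht => (hZ p t ht).1, fun p t ht => ?_,
    fun t ht => ?_⟩, hmap⟩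
  · rw [hmap t ht, ← wfield_eq_field (h1 t ht).1 (h1 t ht).2.1 (h1 t ht).2.2]
    exact (hZ p t ht).2
  · rw [hmap t ht]
    exact withDensity_ofReal_le (hC t ht)

end Bridge

section Rank

theorem sum_intervalIntegral_partialSums {w φ : ℝ → ℝ} (hφ : Continuous φ) (A : Finset ℝ) :
    ∑ s ∈ A, ∫ u in (∑ r ∈ A with r < s, w r)..(∑ r ∈ A with r ≤ s, w r), φ u =
      ∫ u in (0 : ℝ)..(∑ r ∈ A, w r), φ u := by
  induction A using Finset.induction_on_max with
  | empty => simp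
  | insert a A ha ih =>
    have haA : a ∉ A := fun h => lt_irrefl _ (ha a h)
    have e1 : {r ∈ insert a A | r < a} = A := by
      ext r
      simp only [Finset.mem_filter, Finset.mem_insert]
      refine ⟨fun h => h.1.resolve_left h.2.ne, fun h => ⟨Or.inr h, ha r h⟩⟩
    have e2 : {r ∈ insert a A | r ≤ a} = insert a A := by
      refine Finset.filter_true_of_mem fun r hr => ?_
      rcases Finset.mem_insert.1 hr with rfl | h
      exacts [le_rfl, (ha r h).le]
    rw [Finset.sum_insert haA, e1, e2, Finset.sum_insert haA]
    have e3 : ∀ s ∈ A, ∫ u in (∑ r ∈ insert a A with r < s, w r)..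
          (∑ r ∈ insert a A with r ≤ s, w r), φ u =
        ∫ u in (∑ r ∈ A with r < s, w r)..(∑ r ∈ A with r ≤ s, w r), φ u := fun s hs => by
      rw [Finset.filter_insert, if_neg (ha s hs).not_gt, Finset.filter_insert,
        if_neg (ha s hs).not_ge]
    rw [Finset.sum_congr rfl e3, ih, add_comm,
      intervalIntegral.integral_add_adjacent_intervals (hφ.intervalIntegrable _ _)
        (hφ.intervalIntegrable _ _)]

theorem sub_mul_abs_le_integral_abs {a b c : ℝ} (s : ℝ) (hc : c ∈ Icc a b) :
    (b - a) * |s - c| ≤ 4 * ∫ u in a..b, |u - s| := by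
  have hab := hc.1.trans hc.2
  set m := (a + b) / 2 with hm
  have hcont : Continuous fun u : ℝ => |u - s| := by fun_prop
  have hsplit := intervalIntegral.integral_add_adjacent_intervals
    (hcont.intervalIntegrable (μ := volume) a m) (hcont.intervalIntegrable m b)
  have h1 : 0 ≤ ∫ u in a..m, |u - s| :=
    intervalIntegral.integral_nonneg (by linarith) fun _ _ => abs_nonneg _
  have h2 : 0 ≤ ∫ u in m..b, |u - s| :=
    intervalIntegral.integral_nonneg (by linarith) fun _ _ => abs_nonneg _
  have h3 : ∫ u in m..b, (u - s) ≤ ∫ u in m..b, |u - s| :=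
    intervalIntegral.integral_mono_on (by linarith)
      (Continuous.intervalIntegrable (by fun_prop) _ _)
      (hcont.intervalIntegrable _ _) fun _ _ => le_abs_self _
  have h4 : ∫ u in a..m, -(u - s) ≤ ∫ u in a..m, |u - s| :=
    intervalIntegral.integral_mono_on (by linarith)
      (Continuous.intervalIntegrable (by fun_prop) _ _)
      (hcont.intervalIntegrable _ _) fun _ _ => neg_le_abs _
  rw [intervalIntegral.integral_neg] at h4
  rw [intervalIntegral.integral_sub (by simp) (by simp), integral_id,
    intervalIntegral.integral_const, smul_eq_mul] at h3 h4
  have h5 : |s - c| ≤ max (s - a) (b - s) := by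
    rw [abs_le']
    exact ⟨(by linarith [hc.1] : s - c ≤ s - a).trans (le_max_left _ _),
      (by linarith [hc.2] : -(s - c) ≤ b - s).trans (le_max_right _ _)⟩
  refine (mul_le_mul_of_nonneg_left h5 (sub_nonneg.2 hab)).trans ?_
  rcases le_total s m with hs | hs
  · rw [max_eq_right (by linarith)]
    nlinarith
  · rw [max_eq_left (by linarith)]
    nlinarith

variable {N : ℕ}

/-- The fraction of the points `s k` lying strictly below `τ`. -/
def fracLT (s : Fin N → ℝ) (τ : ℝ) : ℝ := ((Finset.univ.filter fun k => s k < τ).card : ℝ) / N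

/-- The fraction of the points `s k` lying below `τ`. -/
def fracLE (s : Fin N → ℝ) (τ : ℝ) : ℝ := ((Finset.univ.filter fun k => s k ≤ τ).card : ℝ) / N

/-- The fraction of the points `s k` equal to `τ`. -/
def fracEQ (s : Fin N → ℝ) (τ : ℝ) : ℝ := ((Finset.univ.filter fun k => s k = τ).card : ℝ) / N

theorem fracLT_mono (s : Fin N → ℝ) : Monotone (fracLT s) := fun a b hab => by
  unfold fracLT
  gcongr

theorem fracLE_le_fracLT (s : Fin N → ℝ) {a b : ℝ} (hab : a < b) : fracLE s a ≤ fracLT s b := by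
  unfold fracLE fracLT
  gcongr with k

theorem sum_fracEQ_filter (s : Fin N → ℝ) (P : ℝ → Prop) [DecidablePred P] :
    ∑ r ∈ Finset.univ.image s with P r, fracEQ s r =
      ((Finset.univ.filter fun k => P (s k)).card : ℝ) / N := by
  unfold fracEQ
  rw [← Finset.sum_div, ← Nat.cast_sum]
  congr 2
  rw [Finset.card_eq_sum_card_fiberwise (f := s) (t := {r ∈ Finset.univ.image s | P r})]
  · refine Finset.sum_congr rfl fun r hr => ?_
    congr 1
    ext k
    simp only [Finset.mem_filter, Finset.mem_univ, true_and]
    refine ⟨fun h => ⟨h ▸ (Finset.mem_filter.1 hr).2, h⟩, fun h => h.2⟩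
  · intro k hk
    simpa using hk

theorem sum_comp_fracEQ (s : Fin N → ℝ) (g : ℝ → ℝ) :
    (N : ℝ)⁻¹ * ∑ j, g (s j) = ∑ r ∈ Finset.univ.image s, fracEQ s r * g r := by
  rw [Finset.sum_comp g s, Finset.mul_sum]
  refine Finset.sum_congr rfl fun r _ => ?_
  rw [nsmul_eq_mul, fracEQ]
  ring

theorem fracLE_sub_fracLT (s : Fin N → ℝ) (τ : ℝ) :
    fracLE s τ - fracLT s τ = fracEQ s τ := by
  unfold fracLE fracLT fracEQ
  rw [← sub_div]
  congr 1
  rw [sub_eq_iff_eq_add, ← Nat.cast_add, ← Finset.card_union_of_disjoint]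
  · congr 2
    ext k
    simp [le_iff_lt_or_eq, or_comm]
  · refine Finset.disjoint_filter.2 fun k _ h => h.not_lt

/-- A slope detecting whether a sample lies above or below its uniform quantile. -/
def rankSlope (s : Fin N → ℝ) (τ : ℝ) : ℝ := if τ ≤ fracLT s τ then 1 else -1

theorem abs_rankSlope_le (s : Fin N → ℝ) (τ : ℝ) : |rankSlope s τ| ≤ 1 := by
  unfold rankSlope
  split_ifs <;> simp

theorem intervalIntegrable_rankSlope (s : Fin N → ℝ) (a b : ℝ) :
    IntervalIntegrable (rankSlope s) volume a b := by
  have hm : Measurable (rankSlope s) :=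
    Measurable.ite (measurableSet_le measurable_id (fracLT_mono s).measurable)
      measurable_const measurable_const
  rw [intervalIntegrable_iff]
  exact Measure.integrableOn_of_bounded (M := 1) (by simp) hm.aestronglyMeasurable
    (Filter.Eventually.of_forall fun τ => abs_rankSlope_le s τ)

/-- A test function realizing the distance between a sample and the uniform law. -/
def rankTest (s : Fin N → ℝ) (x : ℝ) : ℝ := ∫ τ in (0 : ℝ)..x, rankSlope s τ

theorem rankTest_sub (s : Fin N → ℝ) (x y : ℝ) :
    rankTest s y - rankTest s x = ∫ τ in x..y, rankSlope s τ :=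
  intervalIntegral.integral_interval_sub_left (intervalIntegrable_rankSlope s _ _)
    (intervalIntegrable_rankSlope s _ _)

theorem abs_rankTest_sub_le (s : Fin N → ℝ) (x y : ℝ) :
    |rankTest s x - rankTest s y| ≤ |x - y| := by
  rw [rankTest_sub, ← Real.norm_eq_abs]
  refine (intervalIntegral.norm_integral_le_of_norm_le_const (C := 1)
    fun τ _ => abs_rankSlope_le s τ).trans (by simp)

theorem continuous_rankTest (s : Fin N → ℝ) : Continuous (rankTest s) := by
  have : LipschitzWith 1 (rankTest s) := LipschitzWith.of_dist_le_mul fun x y => by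
    simpa [Real.dist_eq] using abs_rankTest_sub_le s x y
  exact this.continuous

theorem rankTest_sub_eq_abs (s : Fin N → ℝ) {r u : ℝ} (hu : u ∈ Icc (fracLT s r) (fracLE s r)) :
    rankTest s u - rankTest s r = |u - r| := by
  rw [rankTest_sub]
  rcases le_total r u with h | h
  · rw [abs_of_nonneg (sub_nonneg.2 h), intervalIntegral.integral_congr_ae (g := fun _ => (1 : ℝ))]
    · simp
    · refine Filter.Eventually.of_forall fun τ hτ => ?_
      rw [uIoc_of_le h] at hτ
      exact if_pos (hτ.2.trans (hu.2.trans (fracLE_le_fracLT s hτ.1)))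
  · rw [abs_of_nonpos (sub_nonpos.2 h), intervalIntegral.integral_congr_ae (g := fun _ => (-1 : ℝ))]
    · simp
    · refine Filter.Eventually.of_forall fun τ hτ => ?_
      rw [uIoc_of_ge h] at hτ
      exact if_neg (not_le.2 ((fracLT_mono s hτ.2).trans_lt (hu.1.trans_lt hτ.1)))

theorem sum_abs_rank_sub_le (hN : 0 < N) (s c : Fin N → ℝ)
    (hc : ∀ j, c j ∈ Icc (fracLT s (s j)) (fracLE s (s j))) :
    (N : ℝ)⁻¹ * ∑ j, |s j - c j| ≤
      4 * ((∫ u in (0 : ℝ)..1, rankTest s u) - (N : ℝ)⁻¹ * ∑ j, rankTest s (s j)) := by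
  have hN' : (0 : ℝ) < N := by exact_mod_cast hN
  set A := Finset.univ.image s with hA
  have hpos : ∀ r ∈ A, 0 < fracEQ s r := fun r hr => by
    obtain ⟨k, -, rfl⟩ := Finset.mem_image.1 hr
    refine div_pos (Nat.cast_pos.2 (Finset.card_pos.2 ⟨k, by simp⟩)) hN'
  set I : ℝ → ℝ := fun r => ∫ u in fracLT s r..fracLE s r, |u - r| with hI
  have hsub : ∀ r, fracLT s r ≤ fracLE s r := fun r => by
    have := fracLE_sub_fracLT s r
    have h0 : 0 ≤ fracEQ s r := by unfold fracEQ; positivity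
    linarith
  have hle : ∀ j, |s j - c j| ≤ 4 * (I (s j) / fracEQ s (s j)) := fun j => by
    have h0 := hpos (s j) (Finset.mem_image_of_mem s (Finset.mem_univ j))
    have := sub_mul_abs_le_integral_abs (s j) (hc j)
    rw [fracLE_sub_fracLT] at this
    rw [mul_div_assoc', le_div_iff₀ h0]
    linarith
  have hfil : ∀ r, fracLT s r = ∑ q ∈ A with q < r, fracEQ s q := fun r =>
    (sum_fracEQ_filter s fun q => q < r).symm
  have hfil' : ∀ r, fracLE s r = ∑ q ∈ A with q ≤ r, fracEQ s q := fun r =>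
    (sum_fracEQ_filter s fun q => q ≤ r).symm
  have htot : ∑ q ∈ A, fracEQ s q = 1 := by
    have := sum_fracEQ_filter s fun _ => True
    simp only [Finset.filter_true, Finset.card_univ, Fintype.card_fin] at this
    rw [hA, this, div_self hN'.ne']
  have hInt : ∀ r, I r = (∫ u in fracLT s r..fracLE s r, rankTest s u) -
      fracEQ s r * rankTest s r := fun r => by
    have e : ∫ u in fracLT s r..fracLE s r, rankTest s r = fracEQ s r * rankTest s r := by
      rw [intervalIntegral.integral_const, fracLE_sub_fracLT, smul_eq_mul]
    rw [← e, ← intervalIntegral.integral_sub ((continuous_rankTest s).intervalIntegrable _ _)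
      (by simp)]
    refine intervalIntegral.integral_congr fun u hu => ?_
    rw [uIcc_of_le (hsub r)] at hu
    exact (rankTest_sub_eq_abs s hu).symm
  have hgap : ∑ r ∈ A, I r =
      (∫ u in (0 : ℝ)..1, rankTest s u) - (N : ℝ)⁻¹ * ∑ j, rankTest s (s j) := by
    rw [Finset.sum_congr rfl fun r _ => hInt r, Finset.sum_sub_distrib,
      sum_comp_fracEQ s (rankTest s)]
    congr 1
    have := sum_intervalIntegral_partialSums (w := fracEQ s) (continuous_rankTest s) A
    rw [htot] at this
    rw [← this]
    exact Finset.sum_congr rfl fun r _ => by rw [hfil r, hfil' r]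
  calc (N : ℝ)⁻¹ * ∑ j, |s j - c j| ≤ (N : ℝ)⁻¹ * ∑ j, 4 * (I (s j) / fracEQ s (s j)) := by
        gcongr with j
        exact hle j
    _ = 4 * ((N : ℝ)⁻¹ * ∑ j, (fun r => I r / fracEQ s r) (s j)) := by
        rw [← Finset.mul_sum]; ring
    _ = 4 * ∑ r ∈ A, I r := by
        rw [sum_comp_fracEQ s fun r => I r / fracEQ s r]
        congr 1
        exact Finset.sum_congr rfl fun r hr => by field_simp [(hpos r hr).ne']
    _ = _ := by rw [hgap]

end Rank

section ProbabilityIntegralTransform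

variable {Ω : Type*} [MeasurableSpace Ω] {μ : Measure Ω} [IsProbabilityMeasure μ]

theorem map_cdf_comp_eq_volume {ρ : Ω → ℝ} (hρ : Measurable ρ) {H : ℝ → ℝ} (hH : Continuous H)
    (hHρ : ∀ r, H r = μ.real {p | ρ p ≤ r}) (h0 : H 0 = 0) {R : ℝ} (hR : 0 ≤ R) (h1 : H R = 1) :
    μ.map (fun p => H (ρ p)) = volume.restrict (Icc (0 : ℝ) 1) := by
  have hmono : Monotone H := fun a b hab => by
    rw [hHρ, hHρ]
    exact measureReal_mono fun p (hp : ρ p ≤ a) => hp.trans hab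
  have hle1 : ∀ r, H r ≤ 1 := fun r => by rw [hHρ]; exact measureReal_le_one
  have hge0 : ∀ r, 0 ≤ H r := fun r => by rw [hHρ]; exact measureReal_nonneg
  have hm : Measurable fun p => H (ρ p) := hH.measurable.comp hρ
  have := Measure.isProbabilityMeasure_map (μ := μ) hm.aemeasurable
  refine Measure.ext_of_Iic _ _ fun c => ?_
  have hv : (volume.restrict (Icc (0 : ℝ) 1)) (Iic c) = ENNReal.ofReal (min c 1) := by
    rw [Measure.restrict_apply measurableSet_Iic]
    have : Iic c ∩ Icc 0 1 = Icc (0 : ℝ) (min c 1) := by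
      ext x
      simp only [mem_inter_iff, mem_Iic, mem_Icc, le_min_iff]
      tauto
    rw [this, Real.volume_Icc, sub_zero]
  rw [hv, Measure.map_apply hm measurableSet_Iic]
  rcases lt_or_ge c 0 with hc | hc
  · rw [min_eq_left (by linarith), ENNReal.ofReal_of_nonpos hc.le]
    convert measure_empty (μ := μ)
    ext p
    simp only [mem_preimage, mem_Iic, mem_empty_iff_false, iff_false, not_le]
    exact hc.trans_le (hge0 _)
  rcases lt_or_ge c 1 with hc1 | hc1
  swap
  · rw [min_eq_right hc1, ENNReal.ofReal_one]
    convert measure_univ (μ := μ)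
    ext p
    simpa using (hle1 _).trans hc1
  rw [min_eq_left hc1.le]
  have hne : (Icc 0 R ∩ H ⁻¹' {c}).Nonempty := by
    obtain ⟨r, hr, hrc⟩ := intermediate_value_Icc hR hH.continuousOn (show c ∈ Icc (H 0) (H R) by
      rw [h0, h1]; exact ⟨hc, hc1.le⟩)
    exact ⟨r, hr, hrc⟩
  have hcomp : IsCompact (Icc 0 R ∩ H ⁻¹' {c}) :=
    isCompact_Icc.inter_right (isClosed_singleton.preimage hH)
  obtain ⟨r, ⟨hr, hrc⟩, hmax⟩ := hcomp.exists_isGreatest hne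
  have hrc' : H r = c := hrc
  have e : (fun p => H (ρ p)) ⁻¹' Iic c = {p | ρ p ≤ r} := by
    ext p
    change H (ρ p) ≤ c ↔ ρ p ≤ r
    refine ⟨fun h => ?_, fun h => (hmono h).trans hrc'.le⟩
    by_contra! hlt
    have heq : H (ρ p) = c := le_antisymm h (hrc' ▸ hmono hlt.le)
    rcases le_total (ρ p) R with h2 | h2
    · exact absurd (hmax ⟨⟨hr.1.trans hlt.le, h2⟩, heq⟩) (not_le.2 hlt)
    · have := hmono h2
      linarith
  rw [e, ← hrc', hHρ, Measure.real, ENNReal.ofReal_toReal (measure_ne_top _ _)]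

end ProbabilityIntegralTransform

section AbsolutelyContinuousGronwall

open Filter Topology

theorem deriv_norm_le {F : Type*} [NormedAddCommGroup F] [NormedSpace ℝ F] {y : ℝ → F} {y' : F}
    {t : ℝ} (hy : HasDerivAt y y' t) : deriv (fun s => ‖y s‖) t ≤ ‖y'‖ := by
  by_cases hd : DifferentiableAt ℝ (fun s => ‖y s‖) t
  · refine (le_abs_self _).trans ?_
    rw [← Real.norm_eq_abs]
    refine le_of_tendsto_of_tendsto' (hasDerivAt_iff_tendsto_slope.1 hd.hasDerivAt).norm
      (hasDerivAt_iff_tendsto_slope.1 hy).norm fun s => ?_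
    simp only [slope, norm_smul, vsub_eq_sub]
    exact mul_le_mul_of_nonneg_left (abs_norm_sub_norm_le _ _) (norm_nonneg _)
  · rw [deriv_zero_of_not_differentiableAt hd]
    exact norm_nonneg _

theorem norm_le_add_integral_of_ae_hasDerivAt {F : Type*} [NormedAddCommGroup F] [NormedSpace ℝ F]
    {y y' : ℝ → F} {b : ℝ → ℝ} {T : ℝ} {L : NNReal} (hL : LipschitzOnWith L y (Icc 0 T))
    (hy : ∀ᵐ t ∂(volume.restrict (Icc 0 T)), HasDerivAt y (y' t) t ∧ ‖y' t‖ ≤ b t)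
    (hb : ContinuousOn b (Icc 0 T)) {t : ℝ} (ht : t ∈ Icc 0 T) :
    ‖y t‖ ≤ ‖y 0‖ + ∫ s in (0 : ℝ)..t, b s := by
  have hsub : uIcc 0 t ⊆ Icc 0 T := by
    rw [uIcc_of_le ht.1]; exact Icc_subset_Icc_right ht.2
  have hLφ : LipschitzOnWith L (fun s => ‖y s‖) (uIcc 0 t) := by
    have := lipschitzWith_one_norm.comp_lipschitzOnWith (hL.mono hsub)
    rwa [one_mul] at this
  have hac := hLφ.absolutelyContinuousOnInterval
  have h1 := hac.integral_deriv_eq_sub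
  have h2 : ∫ s in (0 : ℝ)..t, deriv (fun s => ‖y s‖) s ≤ ∫ s in (0 : ℝ)..t, b s := by
    refine intervalIntegral.integral_mono_ae_restrict ht.1 hac.intervalIntegrable_deriv
      (hb.mono hsub).intervalIntegrable ?_
    refine ae_mono (Measure.restrict_mono (Icc_subset_Icc_right ht.2) le_rfl) ?_
    filter_upwards [hy] with s hs using (deriv_norm_le hs.1).trans hs.2
  linarith

theorem le_mul_exp_of_le_add_integral {u : ℝ → ℝ} {T c A : ℝ} (hu : ContinuousOn u (Icc 0 T))
    (hA : 0 ≤ A) (h : ∀ t ∈ Icc 0 T, u t ≤ c + ∫ s in (0 : ℝ)..t, A * u s) {t : ℝ}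
    (ht : t ∈ Icc 0 T) : u t ≤ c * Real.exp (A * t) := by
  have hAu : ContinuousOn (fun s => A * u s) (Icc 0 T) := continuousOn_const.mul hu
  have hd : ∀ s ∈ Icc 0 T, HasDerivWithinAt (fun s => c + ∫ r in (0 : ℝ)..s, A * u r) (A * u s)
      (Icc 0 T) s := fun s hs => by
    have : Fact (s ∈ Icc 0 T) := ⟨hs⟩
    refine (intervalIntegral.integral_hasDerivWithinAt_right
      ((hAu.mono ?_).intervalIntegrable) ?_ (hAu s hs)).const_add c
    · rw [uIcc_of_le hs.1]; exact Icc_subset_Icc_right hs.2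
    · exact hAu.stronglyMeasurableAtFilter_nhdsWithin measurableSet_Icc s
  have hg : ∀ s ∈ Icc 0 T, HasDerivWithinAt
      (fun s => (c + ∫ r in (0 : ℝ)..s, A * u r) * Real.exp (-(A * s)))
      (A * u s * Real.exp (-(A * s)) +
        (c + ∫ r in (0 : ℝ)..s, A * u r) * (Real.exp (-(A * s)) * -(A * 1))) (Icc 0 T) s :=
    fun s hs => (hd s hs).mul (((hasDerivAt_id s).const_mul A).neg.exp.hasDerivWithinAt)
  have hanti : AntitoneOn (fun s => (c + ∫ r in (0 : ℝ)..s, A * u r) * Real.exp (-(A * s)))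
      (Icc 0 T) := by
    refine antitoneOn_of_hasDerivWithinAt_nonpos (convex_Icc 0 T)
      (fun s hs => (hg s hs).continuousWithinAt)
      (fun s hs => (hg s (interior_subset hs)).mono interior_subset) fun s hs => ?_
    have h1 := h s (interior_subset hs)
    have h2 := mul_nonneg (mul_nonneg hA (sub_nonneg.2 h1)) (Real.exp_pos (-(A * s))).le
    linarith
  have h0 := hanti ⟨le_rfl, ht.1.trans ht.2⟩ ht ht.1
  simp only [intervalIntegral.integral_same, add_zero, mul_zero, neg_zero, Real.exp_zero,
    mul_one] at h0
  refine (h t ht).trans ?_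
  rw [Real.exp_neg, ← div_eq_mul_inv, div_le_iff₀ (Real.exp_pos _)] at h0
  exact h0

end AbsolutelyContinuousGronwall

section Consistency

set_option linter.unusedSectionVars false

open Filter Topology
open scoped RealInnerProductSpace

variable {E : Type*} [NormedAddCommGroup E] [InnerProductSpace ℝ E] [FiniteDimensional ℝ E]
  [MeasureSpace E] [BorelSpace E] [(volume : Measure E).IsAddHaarMeasure]

/-- Averages over the configuration `q` approximate integrals against `μ`, with error at most `w`
times the Lipschitz constant of the test function on the region where both coordinates have norm at
most `b`. -/
def IsClose {N : ℕ} (μ : Measure (E × E)) (q : Fin N → E × E) (Q : Set (E × E)) (w : ℝ) : Prop :=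
  ∀ (ψ : E × E → ℝ) (L : ℝ), 0 < L → AEStronglyMeasurable ψ μ →
    (∀ p ∈ Q, ∀ p' ∈ Q, |ψ p - ψ p'| ≤ L * dist p p') →
    (∫ p, ψ p ∂μ) - (N : ℝ)⁻¹ * ∑ j, ψ (q j) ≤ L * w

/-- The region of phase space where both coordinates have norm at most `b`. -/
def phaseBox (E : Type*) [NormedAddCommGroup E] (b : ℝ) : Set (E × E) :=
  {p | ‖p.1‖ ≤ b ∧ ‖p.2‖ ≤ b}

variable {K : ℝ → ℝ} {κ K₀ L b w : ℝ} {μ : Measure (E × E)} [IsProbabilityMeasure μ] {D : NNReal}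
  {N : ℕ} {q : Fin N → E × E}

theorem abs_massIn_sub_le_of_nonneg (hμ : μ ≤ (D : ℝ≥0∞) • volume)
    (hb : ∀ᵐ p ∂μ, p ∈ phaseBox E b) {x : E} (hx : ‖x‖ ≤ b) {r r' : ℝ} (hr : 0 ≤ r)
    (hr' : 0 ≤ r') : |massIn μ x r - massIn μ x r'| ≤ massLip E D b * |r - r'| := by
  wlog h : r ≤ r' generalizing r r'
  · rw [abs_sub_comm, abs_sub_comm r]
    exact this hr' hr (le_of_not_ge h)
  · have h1 := massIn_le_add hμ hb hx hr h
    have h2 := massIn_mono (μ := μ) x h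
    rw [abs_of_nonpos (by linarith), abs_of_nonpos (by linarith)]
    linarith

theorem abs_massIn_dist_sub_le (hμ : μ ≤ (D : ℝ≥0∞) • volume)
    (hb : ∀ᵐ p ∂μ, p ∈ phaseBox E b) {x : E} (hx : ‖x‖ ≤ b) (p p' : E × E) :
    |massIn μ x (dist x p.1) - massIn μ x (dist x p'.1)| ≤ massLip E D b * dist p p' := by
  have h0 := massLip_nonneg (E := E) D.coe_nonneg ((norm_nonneg x).trans hx)
  refine (abs_massIn_sub_le_of_nonneg hμ hb hx dist_nonneg dist_nonneg).trans
    (mul_le_mul_of_nonneg_left ?_ h0)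
  have h1 : |dist x p.1 - dist x p'.1| ≤ dist p.1 p'.1 := by
    rw [dist_comm x, dist_comm x]
    exact abs_dist_sub_le _ _ _
  exact h1.trans (le_max_left _ _)

theorem norm_field_sub_average_le (hK : IsCommWeight K κ K₀ L) (hμ : μ ≤ (D : ℝ≥0∞) • volume)
    (hb : ∀ᵐ p ∂μ, p ∈ phaseBox E b) (hq : IsClose μ q (phaseBox E b) w) {x v : E}
    (hx : ‖x‖ ≤ b) (hv : ‖v‖ ≤ b) :
    ‖field K μ x v - (N : ℝ)⁻¹ • ∑ j, K (massIn μ x (dist x (q j).1)) • ((q j).2 - v)‖ ≤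
      (2 * b * L * massLip E D b + K₀) * w := by
  set y := field K μ x v - (N : ℝ)⁻¹ • ∑ j, K (massIn μ x (dist x (q j).1)) • ((q j).2 - v)
    with hy
  have hb0 : 0 ≤ b := (norm_nonneg x).trans hx
  have hm := massLip_nonneg (E := E) D.coe_nonneg hb0
  have hL := hK.lip_nonneg
  have hK0 := hK.bound_pos
  set A := 2 * b * L * massLip E D b + K₀ with hA
  have hA0 : 0 < A := by positivity
  have hInt2 : Integrable (fun p : E × E => p.2 - v) μ :=
    Integrable.of_bound (measurable_snd.sub_const v).aestronglyMeasurable (b + b) (by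
      filter_upwards [hb] with p hp
      exact (norm_sub_le _ _).trans (add_le_add hp.2 hv))
  have hInt := integrable_commWeight_smul hK x hInt2
  set ψ : E × E → ℝ := fun p => ⟪y, K (massIn μ x (dist x p.1)) • (p.2 - v)⟫ with hψ
  have h1 : (∫ p, ψ p ∂μ) = ⟪y, field K μ x v⟫ := integral_inner hInt y
  have h2 : (N : ℝ)⁻¹ * ∑ j, ψ (q j) =
      ⟪y, (N : ℝ)⁻¹ • ∑ j, K (massIn μ x (dist x (q j).1)) • ((q j).2 - v)⟫ := by
    rw [real_inner_smul_right, inner_sum]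
  have h3 : (∫ p, ψ p ∂μ) - (N : ℝ)⁻¹ * ∑ j, ψ (q j) = ‖y‖ * ‖y‖ := by
    rw [h1, h2, ← inner_sub_right, ← hy, real_inner_self_eq_norm_mul_norm]
  rcases (norm_nonneg y).eq_or_lt with h0 | h0
  · have := hq (fun _ => 0) 1 one_pos aestronglyMeasurable_const (fun p _ p' _ => by simp)
    simp only [integral_zero, Finset.sum_const_zero, mul_zero, sub_zero, one_mul] at this
    rw [← h0]; positivity
  · have h4 := hq ψ (‖y‖ * A) (by positivity) ((hInt.const_inner y).aestronglyMeasurable) ?_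
    · rw [h3, mul_assoc] at h4
      exact le_of_mul_le_mul_left h4 h0
    · intro p hp p' hp'
      rw [hψ]
      dsimp only
      rw [← inner_sub_right]
      refine (abs_real_inner_le_norm _ _).trans ?_
      rw [mul_assoc]
      refine mul_le_mul_of_nonneg_left ?_ h0.le
      set k := K (massIn μ x (dist x p.1))
      set k' := K (massIn μ x (dist x p'.1))
      have e : k • (p.2 - v) - k' • (p'.2 - v) = (k - k') • (p.2 - v) + k' • (p.2 - p'.2) := by
        simp only [smul_sub, sub_smul]; abel
      have e1 : |k - k'| ≤ L * (massLip E D b * dist p p') :=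
        (hK.lip _ _).trans (mul_le_mul_of_nonneg_left (abs_massIn_dist_sub_le hμ hb hx p p') hL)
      have e2 : ‖p.2 - v‖ ≤ 2 * b := (norm_sub_le _ _).trans (by linarith [hp.2])
      have e3 : ‖p.2 - p'.2‖ ≤ dist p p' := by
        rw [← dist_eq_norm]; exact le_max_right _ _
      rw [e]
      calc _ ≤ |k - k'| * ‖p.2 - v‖ + |k'| * ‖p.2 - p'.2‖ := by
            refine (norm_add_le _ _).trans ?_
            rw [norm_smul, norm_smul, Real.norm_eq_abs, Real.norm_eq_abs]
        _ ≤ L * (massLip E D b * dist p p') * (2 * b) + K₀ * dist p p' := by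
            gcongr
            exact hK.abs_le _
        _ = _ := by rw [hA]; ring

theorem average_abs_massIn_sub_rank_le [Nontrivial E] (hμ : μ ≤ (D : ℝ≥0∞) • volume)
    (hb : ∀ᵐ p ∂μ, p ∈ phaseBox E b) (hN : 0 < N) (hq : IsClose μ q (phaseBox E b) w) {x : E}
    (hx : ‖x‖ ≤ b) :
    (N : ℝ)⁻¹ * ∑ j, |massIn μ x (dist x (q j).1) -
      fracLE (fun k => dist x (q k).1) (dist x (q j).1)| ≤ 4 * ((massLip E D b + 1) * w) := by
  have hb0 : 0 ≤ b := (norm_nonneg x).trans hx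
  have hm := massLip_nonneg (E := E) D.coe_nonneg hb0
  set s : Fin N → ℝ := fun j => massIn μ x (dist x (q j).1) with hs
  have hmono : Monotone (massIn μ x) := fun _ _ h => massIn_mono x h
  have hrank := sum_abs_rank_sub_le hN s
    (fun j => fracLE (fun k => dist x (q k).1) (dist x (q j).1)) fun j => by
      unfold fracLT fracLE
      refine ⟨?_, ?_⟩
      · gcongr with k
        exact fun h => (hmono.reflect_lt h).le
      · refine div_le_div_of_nonneg_right (Nat.cast_le.2 (Finset.card_le_card
          (Finset.monotone_filter_right _ fun k _ h => hmono h))) (by positivity)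
  refine hrank.trans (mul_le_mul_of_nonneg_left ?_ (by norm_num))
  have hneg : ∀ r < 0, massIn μ x r = 0 := fun r hr => by
    have : {p : E × E | dist p.1 x ≤ r} = ∅ :=
      eq_empty_of_forall_notMem fun p hp => absurd (hr.trans_le' hp) (not_lt.2 dist_nonneg)
    rw [massIn, this, measureReal_empty]
  have hz : massIn μ x 0 = 0 := massIn_zero hμ x
  have hcont : Continuous (massIn μ x) := by
    have h1 : massIn μ x = fun r => massIn μ x (max r 0) := by
      funext r
      rcases lt_or_ge r 0 with h | h
      · rw [hneg r h, max_eq_right h.le, hz]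
      · rw [max_eq_left h]
    have h2 : LipschitzWith ⟨massLip E D b, hm⟩ fun r => massIn μ x (max r 0) :=
      LipschitzWith.of_dist_le_mul fun r r' => by
        rw [Real.dist_eq, Real.dist_eq]
        refine (abs_massIn_sub_le_of_nonneg hμ hb hx (le_max_right _ _)
          (le_max_right _ _)).trans (mul_le_mul_of_nonneg_left ?_ hm)
        exact abs_max_sub_max_le_abs _ _ _
    rw [h1]; exact h2.continuous
  have hone : massIn μ x (2 * b) = 1 := by
    have : ∀ᵐ p ∂μ, p ∈ {p : E × E | dist p.1 x ≤ 2 * b} := by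
      filter_upwards [hb] with p hp
      rw [dist_eq_norm]
      exact (norm_sub_le _ _).trans (by linarith [hp.1])
    exact (measureReal_congr (eventuallyEq_univ.2 this)).trans probReal_univ
  have hmap := map_cdf_comp_eq_volume (μ := μ) (ρ := fun p : E × E => dist p.1 x) (by fun_prop)
    hcont (fun r => rfl) hz (by positivity : 0 ≤ 2 * b) hone
  have hmeas : Measurable fun p : E × E => massIn μ x (dist p.1 x) :=
    hcont.measurable.comp (by fun_prop)
  have hInt : (∫ u in (0 : ℝ)..1, rankTest s u) =
      ∫ p, rankTest s (massIn μ x (dist x p.1)) ∂μ := by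
    rw [intervalIntegral.integral_of_le zero_le_one, ← integral_Icc_eq_integral_Ioc, ← hmap,
      integral_map hmeas.aemeasurable (continuous_rankTest s).aestronglyMeasurable]
    simp only [dist_comm]
  rw [hInt]
  refine hq (fun p => rankTest s (massIn μ x (dist x p.1))) _ (by positivity) ?_ ?_
  · simp only [dist_comm x]
    exact ((continuous_rankTest s).measurable.comp hmeas).aestronglyMeasurable
  · intro p _ p' _
    refine (abs_rankTest_sub_le s _ _).trans ((abs_massIn_dist_sub_le hμ hb hx p p').trans ?_)
    gcongr
    linarith

/-- The constant controlling the consistency error of the particle force. -/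
def consistencyConst (E : Type*) [NormedAddCommGroup E] [InnerProductSpace ℝ E] [MeasureSpace E]
    (K₀ L D b : ℝ) : ℝ :=
  2 * b * L * massLip E D b + K₀ + 8 * b * L * (massLip E D b + 1)

theorem norm_field_sub_force_le [Nontrivial E] (hK : IsCommWeight K κ K₀ L)
    (hμ : μ ≤ (D : ℝ≥0∞) • volume) (hb : ∀ᵐ p ∂μ, p ∈ phaseBox E b) (hN : 0 < N)
    (hq : IsClose μ q (phaseBox E b) w) (hqb : ∀ j, q j ∈ phaseBox E b) {x v : E}
    (hx : ‖x‖ ≤ b) (hv : ‖v‖ ≤ b) :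
    ‖field K μ x v - (N : ℝ)⁻¹ • ∑ j,
      K (fracLE (fun k => dist x (q k).1) (dist x (q j).1)) • ((q j).2 - v)‖ ≤
      consistencyConst E K₀ L D b * w := by
  have hb0 : 0 ≤ b := (norm_nonneg x).trans hx
  have hL := hK.lip_nonneg
  have h1 := norm_field_sub_average_le hK hμ hb hq hx hv
  have h2 : ‖(N : ℝ)⁻¹ • ∑ j, K (massIn μ x (dist x (q j).1)) • ((q j).2 - v) -
      (N : ℝ)⁻¹ • ∑ j, K (fracLE (fun k => dist x (q k).1) (dist x (q j).1)) • ((q j).2 - v)‖ ≤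
      2 * b * L * ((N : ℝ)⁻¹ * ∑ j, |massIn μ x (dist x (q j).1) -
        fracLE (fun k => dist x (q k).1) (dist x (q j).1)|) := by
    rw [← smul_sub, ← Finset.sum_sub_distrib, norm_smul, Real.norm_of_nonneg (by positivity),
      mul_left_comm, Finset.mul_sum]
    refine mul_le_mul_of_nonneg_left ((norm_sum_le _ _).trans
      (Finset.sum_le_sum fun j _ => ?_)) (by positivity)
    rw [← sub_smul, norm_smul, Real.norm_eq_abs]
    have h3 : ‖(q j).2 - v‖ ≤ 2 * b := (norm_sub_le _ _).trans (by linarith [(hqb j).2])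
    calc _ ≤ L * |massIn μ x (dist x (q j).1) -
          fracLE (fun k => dist x (q k).1) (dist x (q j).1)| * (2 * b) :=
          mul_le_mul (hK.lip _ _) h3 (norm_nonneg _) (by positivity)
      _ = _ := by ring
  have h3 := average_abs_massIn_sub_rank_le hμ hb hN hq hx
  have h4 := mul_le_mul_of_nonneg_left h3 (by positivity : 0 ≤ 2 * b * L)
  refine (norm_sub_le_norm_sub_add_norm_sub _
    ((N : ℝ)⁻¹ • ∑ j, K (massIn μ x (dist x (q j).1)) • ((q j).2 - v)) _).trans ?_
  unfold consistencyConst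
  linarith

end Consistency

section Stability

set_option linter.unusedSectionVars false

open Filter Topology

variable {E : Type*} [NormedAddCommGroup E] [InnerProductSpace ℝ E] [FiniteDimensional ℝ E]
  [MeasureSpace E] [BorelSpace E] [(volume : Measure E).IsAddHaarMeasure]

namespace IsKineticFlow

variable {K : ℝ → ℝ} {κ K₀ L T b w : ℝ} {μ₀ : Measure (E × E)} [IsProbabilityMeasure μ₀]
  {D : NNReal} {Z : ℝ → E × E → E × E} {S : Set (E × E)} {N : ℕ} {z : Fin N → E × E}

theorem dist_le_exp_mul (hK : IsCommWeight K κ K₀ L) (hZ : IsKineticFlow K T μ₀ D Z)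
    (hc : IsConfined T μ₀ Z S b) {p p' : E × E} (hp : p ∈ S) (hp' : p' ∈ S) {t : ℝ}
    (ht : t ∈ Icc 0 T) :
    dist (Z t p) (Z t p') ≤ Real.exp ((1 + 2 * fieldLip E K₀ L D b) * T) * dist p p' := by
  have hb : 0 ≤ b := radius_nonneg (ht.1.trans ht.2) hc
  have hF := fieldLip_nonneg (E := E) hK.bound_pos.le hK.lip_nonneg D.coe_nonneg hb
  have h := norm_le_gronwallBound_of_Icc (K₀ := 1 + 2 * fieldLip E K₀ L D b) (ε := 0)
    (f := fun s => Z s p - Z s p')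
    (f' := fun s => ((Z s p).2, field K (μ₀.map (Z s)) (Z s p).1 (Z s p).2) -
      ((Z s p').2, field K (μ₀.map (Z s)) (Z s p').1 (Z s p').2))
    (δ := dist p p') (fun s hs => ((hZ.fst p s hs).prodMk (hZ.snd p s hs)).sub
      ((hZ.fst p' s hs).prodMk (hZ.snd p' s hs))) (by rw [hZ.init, hZ.init, dist_eq_norm])
    (fun s hs => ?_) dist_nonneg le_rfl (by positivity) ht
  · rw [gronwallBound_ε0] at h
    rw [dist_eq_norm, mul_comm]
    exact h
  · have h1 : ‖(Z s p).1 - (Z s p').1‖ ≤ ‖Z s p - Z s p'‖ := norm_fst_le (Z s p - Z s p')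
    have h2 : ‖(Z s p).2 - (Z s p').2‖ ≤ ‖Z s p - Z s p'‖ := _root_.norm_snd_le (Z s p - Z s p')
    have h3 := hZ.norm_field_sub_le hK hc le_rfl hs hs (hc.fst_le p hp s hs)
      (hc.fst_le p' hp' s hs) (hc.snd_le p hp s hs) (v' := (Z s p').2)
    rw [sub_self, abs_zero, zero_add, dist_eq_norm, dist_eq_norm] at h3
    have h4 := norm_nonneg (Z s p - Z s p')
    rw [add_zero]
    refine max_le ?_ ?_
    · refine h2.trans (le_mul_of_one_le_left h4 (by linarith))
    · refine h3.trans ?_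
      calc _ ≤ fieldLip E K₀ L D b * (‖Z s p - Z s p'‖ + ‖Z s p - Z s p'‖) := by gcongr
        _ ≤ _ := by linarith

theorem isClose_map (hK : IsCommWeight K κ K₀ L) (hZ : IsKineticFlow K T μ₀ D Z)
    (hc : IsConfined T μ₀ Z S b) (hw : IsClose μ₀ z S w) (hz : ∀ i, z i ∈ S) {t : ℝ}
    (ht : t ∈ Icc 0 T) {q : Fin N → E × E} (hq : ∀ i, q i ∈ phaseBox E b) :
    IsClose (μ₀.map (Z t)) q (phaseBox E b)
      (Real.exp ((1 + 2 * fieldLip E K₀ L D b) * T) * w +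
        (N : ℝ)⁻¹ * ∑ i, ‖Z t (z i) - q i‖) := by
  intro ψ l hl hψ hlip
  set Λ := Real.exp ((1 + 2 * fieldLip E K₀ L D b) * T) with hΛ
  have hbox : ∀ p ∈ S, Z t p ∈ phaseBox E b := fun p hp =>
    ⟨hc.fst_le p hp t ht, hc.snd_le p hp t ht⟩
  have h1 := hw (fun p => ψ (Z t p)) (l * Λ) (mul_pos hl (Real.exp_pos _))
    (hψ.comp_aemeasurable (hZ.aemeasurable t ht)) fun p hp p' hp' => by
      refine (hlip _ (hbox p hp) _ (hbox p' hp')).trans ?_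
      rw [mul_assoc]
      exact mul_le_mul_of_nonneg_left (hZ.dist_le_exp_mul hK hc hp hp' ht) hl.le
  rw [← integral_map (hZ.aemeasurable t ht) hψ] at h1
  have h2 : ∑ i, ψ (Z t (z i)) - ∑ i, ψ (q i) ≤ l * ∑ i, ‖Z t (z i) - q i‖ := by
    rw [← Finset.sum_sub_distrib, Finset.mul_sum]
    refine Finset.sum_le_sum fun i _ => (le_abs_self _).trans ?_
    rw [← dist_eq_norm]
    exact hlip _ (hbox _ (hz i)) _ (hq i)
  have h3 := mul_le_mul_of_nonneg_left h2 (by positivity : 0 ≤ (N : ℝ)⁻¹)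
  linarith

theorem lipschitzOnWith (hK : IsCommWeight K κ K₀ L) (hZ : IsKineticFlow K T μ₀ D Z)
    (hc : IsConfined T μ₀ Z S b) {p : E × E} (hp : p ∈ S) :
    ∃ l : NNReal, LipschitzOnWith l (fun t => Z t p) (Icc 0 T) := by
  refine ⟨max b.toNNReal (2 * K₀ * b).toNNReal, ?_⟩
  refine LipschitzOnWith.prodMk (f := fun t => (Z t p).1) (g := fun t => (Z t p).2) ?_ ?_
  · refine LipschitzOnWith.of_dist_le_mul fun s hs t ht => ?_
    rw [dist_eq_norm]
    refine (hZ.norm_fst_sub_le hc ht hs hp).trans ?_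
    exact mul_le_mul_of_nonneg_right (Real.le_coe_toNNReal b) (abs_nonneg _)
  · refine LipschitzOnWith.of_dist_le_mul fun s hs t ht => ?_
    rw [dist_eq_norm]
    refine (hZ.norm_snd_sub_le hK hc ht hs hp).trans ?_
    exact mul_le_mul_of_nonneg_right (Real.le_coe_toNNReal _) (abs_nonneg _)

/-- The exponential rate in the stability estimate. -/
def _root_.stabilityRate (E : Type*) [NormedAddCommGroup E] [InnerProductSpace ℝ E] [MeasureSpace E]
    (K₀ L D b : ℝ) : ℝ :=
  1 + 2 * fieldLip E K₀ L D b + consistencyConst E K₀ L D b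

theorem isClose_of_particle_system [Nontrivial E] (hK : IsCommWeight K κ K₀ L)
    (hZ : IsKineticFlow K T μ₀ D Z) (hc : IsConfined T μ₀ Z S b) (hw0 : 0 ≤ w)
    (hw : IsClose μ₀ z S w) (hz : ∀ i, z i ∈ S) (hN : 0 < N) {q : Fin N → ℝ → E × E}
    (hq0 : ∀ i, q i 0 = z i) (hqb : ∀ i, ∀ t ∈ Icc 0 T, q i t ∈ phaseBox E b)
    (hql : ∀ i, ∃ l : NNReal, LipschitzOnWith l (q i) (Icc 0 T))
    (hqd : ∀ᵐ t ∂(volume.restrict (Icc 0 T)), ∀ i, HasDerivAt (q i) ((q i t).2,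
      (N : ℝ)⁻¹ • ∑ j, K (fracLE (fun k => dist (q i t).1 (q k t).1)
        (dist (q i t).1 (q j t).1)) • ((q j t).2 - (q i t).2)) t) {t : ℝ} (ht : t ∈ Icc 0 T) :
    IsClose (μ₀.map (Z t)) (fun i => q i t) (phaseBox E b)
      (Real.exp ((1 + 2 * fieldLip E K₀ L D b) * T) * w *
        Real.exp (stabilityRate E K₀ L D b * T)) := by
  have hT : 0 ≤ T := ht.1.trans ht.2
  have hb : 0 ≤ b := radius_nonneg hT hc
  have hF := fieldLip_nonneg (E := E) hK.bound_pos.le hK.lip_nonneg D.coe_nonneg hb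
  have hA : 0 ≤ consistencyConst E K₀ L D b := by
    have := massLip_nonneg (E := E) D.coe_nonneg hb
    have := hK.bound_pos
    have := hK.lip_nonneg
    unfold consistencyConst; positivity
  set F := fieldLip E K₀ L D b
  set A := consistencyConst E K₀ L D b
  set Λw := Real.exp ((1 + 2 * F) * T) * w with hΛw
  have hΛ0 : 0 ≤ Λw := by positivity
  set u : ℝ → ℝ := fun s => Λw + (N : ℝ)⁻¹ * ∑ i, ‖Z s (z i) - q i s‖ with hu
  have hclose : ∀ s ∈ Icc 0 T, IsClose (μ₀.map (Z s)) (fun i => q i s) (phaseBox E b) (u s) :=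
    fun s hs => hZ.isClose_map hK hc hw hz hs fun i => hqb i s hs
  have hyl : ∀ i, ∃ l : NNReal, LipschitzOnWith l (fun s => Z s (z i) - q i s) (Icc 0 T) :=
    fun i => by
      obtain ⟨l, hl⟩ := hZ.lipschitzOnWith hK hc (hz i)
      obtain ⟨l', hl'⟩ := hql i
      exact ⟨l + l', hl.sub hl'⟩
  have hyc : ∀ i, ContinuousOn (fun s => ‖Z s (z i) - q i s‖) (Icc 0 T) := fun i => by
    obtain ⟨l, hl⟩ := hyl i
    exact hl.continuousOn.norm
  have huc : ContinuousOn u (Icc 0 T) :=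
    continuousOn_const.add (continuousOn_const.mul (continuousOn_finsetSum _ fun i _ => hyc i))
  have hsub : uIcc 0 t ⊆ Icc 0 T := by
    rw [uIcc_of_le ht.1]; exact Icc_subset_Icc_right ht.2
  have hyd : ∀ᵐ s ∂(volume.restrict (Icc 0 T)), ∀ i,
      HasDerivAt (fun s => Z s (z i) - q i s)
        (((Z s (z i)).2, field K (μ₀.map (Z s)) (Z s (z i)).1 (Z s (z i)).2) - ((q i s).2,
          (N : ℝ)⁻¹ • ∑ j, K (fracLE (fun k => dist (q i s).1 (q k s).1)
            (dist (q i s).1 (q j s).1)) • ((q j s).2 - (q i s).2))) s ∧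
      ‖((Z s (z i)).2, field K (μ₀.map (Z s)) (Z s (z i)).1 (Z s (z i)).2) - ((q i s).2,
          (N : ℝ)⁻¹ • ∑ j, K (fracLE (fun k => dist (q i s).1 (q k s).1)
            (dist (q i s).1 (q j s).1)) • ((q j s).2 - (q i s).2))‖ ≤
        (1 + 2 * F) * ‖Z s (z i) - q i s‖ + A * u s := by
    have hIoo : ∀ᵐ s ∂(volume.restrict (Icc 0 T)), s ∈ Ioo 0 T := by
      rw [← Measure.restrict_congr_set Ioo_ae_eq_Icc]
      exact ae_restrict_mem measurableSet_Ioo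
    filter_upwards [hqd, hIoo] with s hs hsI i
    have hsT : s ∈ Icc 0 T := Ioo_subset_Icc_self hsI
    have hnhds : Icc 0 T ∈ 𝓝 s := Icc_mem_nhds hsI.1 hsI.2
    refine ⟨(((hZ.fst (z i) s hsT).prodMk (hZ.snd (z i) s hsT)).hasDerivAt hnhds).sub (hs i), ?_⟩
    have h1 : ‖(Z s (z i)).1 - (q i s).1‖ ≤ ‖Z s (z i) - q i s‖ := norm_fst_le (Z s (z i) - q i s)
    have h2 : ‖(Z s (z i)).2 - (q i s).2‖ ≤ ‖Z s (z i) - q i s‖ :=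
      _root_.norm_snd_le (Z s (z i) - q i s)
    have h3 := hZ.norm_field_sub_le hK hc le_rfl hsT hsT (hc.fst_le _ (hz i) s hsT)
      (hqb i s hsT).1 (hc.snd_le _ (hz i) s hsT) (v' := (q i s).2)
    rw [sub_self, abs_zero, zero_add, dist_eq_norm, dist_eq_norm] at h3
    have hprob := hZ.isProbabilityMeasure hsT
    have h4 := norm_field_sub_force_le hK (hZ.density s hsT) (hZ.ae_map hc hsT) hN (hclose s hsT)
      (fun j => hqb j s hsT) (hqb i s hsT).1 (hqb i s hsT).2
    have hu0 : 0 ≤ u s := by rw [hu]; positivity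
    have h5 := norm_nonneg (Z s (z i) - q i s)
    have h6 : 0 ≤ A * u s := by positivity
    have h7 : 0 ≤ F * ‖Z s (z i) - q i s‖ := by positivity
    refine max_le ?_ ?_
    · refine h2.trans ?_
      linarith
    · refine (norm_sub_le_norm_sub_add_norm_sub _
        (field K (μ₀.map (Z s)) (q i s).1 (q i s).2) _).trans ?_
      have h8 : F * (‖(Z s (z i)).1 - (q i s).1‖ + ‖(Z s (z i)).2 - (q i s).2‖) ≤
          F * (‖Z s (z i) - q i s‖ + ‖Z s (z i) - q i s‖) := by gcongr
      linarith [h3.trans h8, h4]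
  have hgron : ∀ s ∈ Icc 0 T, u s ≤ Λw + ∫ r in (0 : ℝ)..s, stabilityRate E K₀ L D b * u r := by
    intro s hs
    have hsub : uIcc 0 s ⊆ Icc 0 T := by
      rw [uIcc_of_le hs.1]; exact Icc_subset_Icc_right hs.2
    have hbc : ∀ i, ContinuousOn (fun r => (1 + 2 * F) * ‖Z r (z i) - q i r‖ + A * u r)
        (Icc 0 T) := fun i => (continuousOn_const.mul (hyc i)).add (continuousOn_const.mul huc)
    have hi : ∀ i, ‖Z s (z i) - q i s‖ ≤
        ∫ r in (0 : ℝ)..s, ((1 + 2 * F) * ‖Z r (z i) - q i r‖ + A * u r) := fun i => by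
      obtain ⟨l, hl⟩ := hyl i
      have := norm_le_add_integral_of_ae_hasDerivAt hl (hyd.mono fun r hr => hr i) (hbc i) hs
      rwa [hZ.init, hq0, sub_self, norm_zero, zero_add] at this
    have hN' : (N : ℝ) ≠ 0 := by exact_mod_cast hN.ne'
    have hsum : (N : ℝ)⁻¹ * ∑ i, ‖Z s (z i) - q i s‖ ≤
        ∫ r in (0 : ℝ)..s, stabilityRate E K₀ L D b * u r := by
      calc _ ≤ (N : ℝ)⁻¹ * ∑ i, ∫ r in (0 : ℝ)..s,
            ((1 + 2 * F) * ‖Z r (z i) - q i r‖ + A * u r) :=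
            mul_le_mul_of_nonneg_left (Finset.sum_le_sum fun i _ => hi i) (by positivity)
        _ = ∫ r in (0 : ℝ)..s, (N : ℝ)⁻¹ * ∑ i : Fin N,
            ((1 + 2 * F) * ‖Z r (z i) - q i r‖ + A * u r) := by
            rw [intervalIntegral.integral_const_mul, intervalIntegral.integral_finsetSum
              fun i _ => ((hbc i).mono hsub).intervalIntegrable]
        _ ≤ _ := by
            refine intervalIntegral.integral_mono_on hs.1 ?_ ?_ fun r hr => ?_
            · exact ((continuousOn_const.mul
                (continuousOn_finsetSum _ fun i _ => hbc i)).mono hsub).intervalIntegrable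
            · exact ((continuousOn_const.mul huc).mono hsub).intervalIntegrable
            · rw [Finset.sum_add_distrib, ← Finset.mul_sum, Finset.sum_const, Finset.card_univ,
                Fintype.card_fin, nsmul_eq_mul, mul_add, inv_mul_cancel_left₀ hN', mul_left_comm]
              have : (1 + 2 * F) * ((N : ℝ)⁻¹ * ∑ i, ‖Z r (z i) - q i r‖) ≤ (1 + 2 * F) * u r :=
                mul_le_mul_of_nonneg_left (le_add_of_nonneg_left hΛ0) (by positivity)
              unfold stabilityRate
              linarith
    exact add_le_add_right hsum Λw
  have hM : 0 ≤ stabilityRate E K₀ L D b := by unfold stabilityRate; positivity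
  have hfin := le_mul_exp_of_le_add_integral huc hM hgron ht
  intro ψ l hl hψ hlip
  refine (hclose t ht ψ l hl hψ hlip).trans (mul_le_mul_of_nonneg_left (hfin.trans ?_) hl.le)
  exact mul_le_mul_of_nonneg_left
    (Real.exp_le_exp.2 (mul_le_mul_of_nonneg_left ht.2 hM)) hΛ0

end IsKineticFlow

end Stability

section ParticleBounds

theorem norm_velocity_le {E : Type*} [NormedAddCommGroup E] [NormedSpace ℝ E] {N : ℕ} {K₀ T R : ℝ}
    {V : Fin N → ℝ → E} {c : Fin N → Fin N → ℝ → ℝ} (hc0 : 0 ≤ K₀) (hc : ∀ i j t, |c i j t| ≤ K₀)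
    (hR : 0 ≤ R) (h0 : ∀ i, ‖V i 0‖ ≤ R)
    (hl : ∀ i, ∃ l : NNReal, LipschitzOnWith l (V i) (Icc 0 T))
    (hd : ∀ᵐ t ∂(volume.restrict (Icc 0 T)), ∀ i,
      HasDerivAt (V i) ((N : ℝ)⁻¹ • ∑ j, c i j t • (V j t - V i t)) t)
    {t : ℝ} (ht : t ∈ Icc 0 T) (i : Fin N) : ‖V i t‖ ≤ R * Real.exp (2 * K₀ * T) := by
  choose l hl using hl
  have hL : LipschitzOnWith (∑ i, l i) (fun t i => V i t) (Icc 0 T) := by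
    refine LipschitzOnWith.of_dist_le_mul fun s hs t ht => ?_
    refine (dist_pi_le_iff (by positivity)).2 fun i => ((hl i).dist_le_mul s hs t ht).trans ?_
    exact mul_le_mul_of_nonneg_right
      (NNReal.coe_le_coe.2 (Finset.single_le_sum (fun _ _ => zero_le) (Finset.mem_univ i)))
      dist_nonneg
  have hN : (N : ℝ) ≠ 0 := by
    have := i.pos
    positivity
  have hd' : ∀ᵐ t ∂(volume.restrict (Icc 0 T)),
      HasDerivAt (fun t i => V i t) (fun i => (N : ℝ)⁻¹ • ∑ j, c i j t • (V j t - V i t)) t ∧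
      ‖fun i => (N : ℝ)⁻¹ • ∑ j, c i j t • (V j t - V i t)‖ ≤ 2 * K₀ * ‖fun i => V i t‖ := by
    filter_upwards [hd] with t ht
    refine ⟨hasDerivAt_pi.2 ht, (pi_norm_le_iff_of_nonneg (by positivity)).2 fun i => ?_⟩
    rw [norm_smul, Real.norm_of_nonneg (by positivity)]
    calc _ ≤ (N : ℝ)⁻¹ * ∑ _j : Fin N, K₀ * (2 * ‖fun i => V i t‖) := by
          refine mul_le_mul_of_nonneg_left ((norm_sum_le _ _).trans
            (Finset.sum_le_sum fun j _ => ?_)) (by positivity)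
          rw [norm_smul]
          refine mul_le_mul (hc i j t) ((norm_sub_le _ _).trans ?_) (norm_nonneg _) hc0
          have h1 := norm_le_pi_norm (fun i => V i t) i
          have h2 := norm_le_pi_norm (fun i => V i t) j
          linarith
      _ = _ := by
          rw [Finset.sum_const, Finset.card_univ, Fintype.card_fin, nsmul_eq_mul,
            inv_mul_cancel_left₀ hN]
          ring
  have hcont : ContinuousOn (fun t => ‖fun i => V i t‖) (Icc 0 T) := hL.continuousOn.norm
  have h := le_mul_exp_of_le_add_integral hcont (by positivity : 0 ≤ 2 * K₀) (fun s hs =>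
    norm_le_add_integral_of_ae_hasDerivAt hL hd' (continuousOn_const.mul hcont) hs) ht
  refine (norm_le_pi_norm (fun i => V i t) i).trans (h.trans ?_)
  have h1 : ‖fun i => V i 0‖ ≤ R := (pi_norm_le_iff_of_nonneg hR).2 h0
  have h2 := ht.2
  gcongr

theorem norm_position_le {E : Type*} [NormedAddCommGroup E] [NormedSpace ℝ E] {T R M : ℝ}
    {X V : ℝ → E} {l : NNReal} (hl : LipschitzOnWith l X (Icc 0 T)) (hM : 0 ≤ M)
    (hV : ∀ t ∈ Icc 0 T, ‖V t‖ ≤ M) (h0 : ‖X 0‖ ≤ R)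
    (hd : ∀ᵐ t ∂(volume.restrict (Icc 0 T)), HasDerivAt X (V t) t) {t : ℝ} (ht : t ∈ Icc 0 T) :
    ‖X t‖ ≤ R + T * M := by
  have h := norm_le_add_integral_of_ae_hasDerivAt hl (b := fun _ => M) (by
    filter_upwards [hd, ae_restrict_mem measurableSet_Icc] with s hs hsT using ⟨hs, hV s hsT⟩)
    continuousOn_const ht
  rw [intervalIntegral.integral_const, sub_zero, smul_eq_mul] at h
  have := mul_le_mul_of_nonneg_right ht.2 hM
  linarith

end ParticleBounds

section EmpiricalMeasure

variable {d N : ℕ} {x v : Fin N → EuclideanSpace ℝ (Fin d)}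

theorem isProbabilityMeasure_empPair (hN : 0 < N) : IsProbabilityMeasure (empPair x v) := by
  refine ⟨?_⟩
  have hN' : (N : ℝ≥0∞) ≠ 0 := by exact_mod_cast hN.ne'
  simp [empPair, ENNReal.inv_mul_cancel hN' (ENNReal.natCast_ne_top N)]

theorem integral_empPair (ψ : EuclideanSpace ℝ (Fin d) × EuclideanSpace ℝ (Fin d) → ℝ) :
    ∫ p, ψ p ∂(empPair x v) = (N : ℝ)⁻¹ * ∑ i, ψ (x i, v i) := by
  rw [empPair, integral_smul_measure, integral_finsetSum_measure fun i _ => integrable_dirac (by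
    exact enorm_lt_top)]
  simp

theorem ae_empPair {p : EuclideanSpace ℝ (Fin d) × EuclideanSpace ℝ (Fin d) → Prop}
    (h : ∀ i, p (x i, v i)) : ∀ᵐ z ∂(empPair x v), p z := by
  refine Measure.ae_smul_measure ?_ _
  rw [← Measure.sum_fintype, Measure.ae_sum_iff]
  intro i
  rw [ae_dirac_eq]
  exact h i

end EmpiricalMeasure

section MeanField

theorem CSforce_eq {d N : ℕ} (K : ℝ → ℝ) (Y W : Fin N → EuclideanSpace ℝ (Fin d)) (i : Fin N) :
    CSforce K Y W i = (N : ℝ)⁻¹ • ∑ j, clampWeight K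
      (fracLE (fun k => dist (Y i) (Y k)) (dist (Y i) (Y j))) • (W j - W i) := by
  unfold CSforce
  congr 1
  refine Finset.sum_congr rfl fun j _ => ?_
  have h : Mpart Y (Y i) (dist (Y i) (Y j)) =
      fracLE (fun k => dist (Y i) (Y k)) (dist (Y i) (Y j)) := by
    unfold Mpart fracLE
    simp only [dist_comm (Y i)]
  have hN : (0 : ℝ) < N := by exact_mod_cast i.pos
  rw [h, clampWeight_eq]
  refine ⟨by unfold fracLE; positivity, ?_⟩
  unfold fracLE
  rw [div_le_one hN]
  exact_mod_cast (Finset.card_filter_le _ _).trans (by simp)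

theorem W1_le_zero_of_subsingleton {E : Type*} [MeasurableSpace E] [PseudoMetricSpace E]
    [Subsingleton E] (μ ν : Measure E) [IsProbabilityMeasure μ] [IsProbabilityMeasure ν] :
    W1 μ ν ≤ 0 := by
  refine W1_le fun φ _ _ => ?_
  obtain ⟨p⟩ := nonempty_of_isProbabilityMeasure μ
  have h : φ = fun _ => φ p := funext fun q => by rw [Subsingleton.elim q p]
  rw [h]
  simp

end MeanField

/-- The mean-field limit for the topological Cucker–Smale model:
if `f_t` is the bounded weak solution with initial datum `f₀` and `μ^N_t` is the
empirical measure of a solution of the `N`-agent system with initial data in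
`B_{R_x} × B_{R_v}`, then for `0 ≤ t ≤ T`,
`W₁(f_t,μ^N_t) ≤ C(T) max{W₁(f₀,μ^N₀), √(W₁(f₀,μ^N₀))}`, with `C(T)` depending
only on `T`, `R_x`, `R_v` and `‖f₀‖_∞`. -/
theorem topological_CS_mean_field_limit {d : ℕ} (K : ℝ → ℝ)
    (hKpos : ∀ z ∈ Set.Icc (0:ℝ) 1, 0 < K z)
    (hKanti : AntitoneOn K (Set.Icc (0:ℝ) 1))
    (LK : NNReal) (hKlip : LipschitzOnWith LK K (Set.Icc (0:ℝ) 1))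
    (T Rx Rv B : ℝ) (hT : 0 < T) (hRx : 0 < Rx) (hRv : 0 < Rv) (hB : 0 < B) :
    ∃ C : ℝ, 0 < C ∧
      ∀ (f₀ : EuclideanSpace ℝ (Fin d) × EuclideanSpace ℝ (Fin d) → ℝ),
        Measurable f₀ → (∀ p, 0 ≤ f₀ p) → (∫ p, f₀ p) = 1 →
        (∀ᵐ p ∂volume, f₀ p ≤ B) →
        (∀ p, f₀ p ≠ 0 → p ∈ closedBall (0 : EuclideanSpace ℝ (Fin d)) Rx ×ˢ
          closedBall (0 : EuclideanSpace ℝ (Fin d)) Rv) →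
      ∀ (f : ℝ → EuclideanSpace ℝ (Fin d) × EuclideanSpace ℝ (Fin d) → ℝ),
        IsWeakSolCS K T f₀ f →
      ∀ (N : ℕ), 0 < N →
      ∀ (x v : Fin N → EuclideanSpace ℝ (Fin d)),
        (∀ i, x i ∈ closedBall (0 : EuclideanSpace ℝ (Fin d)) Rx) →
        (∀ i, v i ∈ closedBall (0 : EuclideanSpace ℝ (Fin d)) Rv) →
      ∀ (XN VN : Fin N → ℝ → EuclideanSpace ℝ (Fin d)),
        (∀ i, XN i 0 = x i ∧ VN i 0 = v i) →
        (∀ i, ∃ L : NNReal, LipschitzOnWith L (XN i) (Set.Icc 0 T)) →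
        (∀ i, ∃ L : NNReal, LipschitzOnWith L (VN i) (Set.Icc 0 T)) →
        (∀ᵐ t ∂(volume.restrict (Set.Icc (0:ℝ) T)), ∀ i,
          HasDerivAt (XN i) (VN i t) t ∧
          HasDerivAt (VN i)
            (CSforce K (fun k => XN k t) (fun k => VN k t) i) t) →
      ∀ t ∈ Set.Icc 0 T,
        W1 (volume.withDensity fun p => ENNReal.ofReal (f t p))
            (empPair (fun k => XN k t) (fun k => VN k t)) ≤
          C * max
            (W1 (volume.withDensity fun p => ENNReal.ofReal (f₀ p)) (empPair x v))
            (Real.sqrt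
              (W1 (volume.withDensity fun p => ENNReal.ofReal (f₀ p)) (empPair x v))) := by
  have hK := isCommWeight_clampWeight hKpos hKanti hKlip
  have hK0 := hK.bound_pos
  rcases Nat.eq_zero_or_pos d with hd | hd
  · subst hd
    refine ⟨1, one_pos, fun f₀ _ _ _ _ _ f hsol N hN x v _ _ XN VN _ _ _ _ t ht => ?_⟩
    have h1 := hsol.1 t ht
    have := isProbabilityMeasure_withDensity_ofReal (μ := volume) h1.2.1 h1.2.2
    have := isProbabilityMeasure_empPair (x := fun k => XN k t) (v := fun k => VN k t) hN
    refine (W1_le_zero_of_subsingleton _ _).trans ?_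
    rw [one_mul]
    exact (Real.sqrt_nonneg _).trans (le_max_right _ _)
  have : NeZero d := ⟨hd.ne'⟩
  set M := Rv * Real.exp (2 * K 0 * T) with hM
  have hM0 : 0 ≤ M := by positivity
  set b := max (flowRadius (K 0) T Rx Rv) (Rx + T * M + M) with hb
  set D := densBound (EuclideanSpace ℝ (Fin d)) B.toNNReal (K 0) T with hD
  set Λ := Real.exp ((1 + 2 * fieldLip (EuclideanSpace ℝ (Fin d)) (K 0) LK D b) * T) with hΛ
  set G := Real.exp (stabilityRate (EuclideanSpace ℝ (Fin d)) (K 0) LK D b * T) with hG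
  refine ⟨Λ * G, by positivity, fun f₀ hf hf0 hf1 hfB hfS f hsol N hN x v hx hv XN VN h0 hXl hVl
    hode t ht => ?_⟩
  set μ₀ := volume.withDensity fun p => ENNReal.ofReal (f₀ p) with hμ₀
  set S := closedBall (0 : EuclideanSpace ℝ (Fin d)) Rx ×ˢ
    closedBall (0 : EuclideanSpace ℝ (Fin d)) Rv with hS
  have hprob : IsProbabilityMeasure μ₀ := isProbabilityMeasure_withDensity_ofReal hf0 hf1
  have hprobN := isProbabilityMeasure_empPair (x := x) (v := v) hN
  have hμS : ∀ᵐ p ∂μ₀, p ∈ S :=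
    ae_withDensity_ofReal (measurableSet_closedBall.prod measurableSet_closedBall) hfS
  obtain ⟨C, Z, hZ, hmap⟩ := hsol.exists_isKineticFlow hf hf0 hf1
  have hc' := hZ.isConfined hT hK hRv.le hμS
  have hc : IsConfined T μ₀ Z S b := ⟨hc'.ae_mem,
    fun p hp s hs => (hc'.fst_le p hp s hs).trans (le_max_left _ _),
    fun p hp s hs => (hc'.snd_le p hp s hs).trans (le_max_left _ _)⟩
  have hZD := hZ.isKineticFlow_densBound hK hc (withDensity_ofReal_le hfB)
  have hSR : S ⊆ closedBall 0 (max Rx Rv) := fun p hp => by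
    have h1 : ‖p.1‖ ≤ Rx := by simpa using hp.1
    have h2 : ‖p.2‖ ≤ Rv := by simpa using hp.2
    rw [mem_closedBall_zero_iff]
    exact max_le_max h1 h2
  set w := W1 μ₀ (empPair x v) with hw
  have hw0 : 0 ≤ w := W1_nonneg _ _
  have hclose : IsClose μ₀ (fun i => (x i, v i)) S w := fun ψ l hl _ hlip => by
    rw [← integral_empPair (x := x) (v := v) ψ]
    exact integral_sub_integral_le_W1 hSR hμS (ae_empPair fun i => ⟨hx i, hv i⟩) hl hlip
  have hVb : ∀ i, ∀ s ∈ Icc 0 T, ‖VN i s‖ ≤ M := fun i s hs => by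
    refine norm_velocity_le hK0.le (c := fun i j s => clampWeight K
      (fracLE (fun k => dist (XN i s) (XN k s)) (dist (XN i s) (XN j s))))
      (fun i j s => hK.abs_le _) hRv.le (fun i => ?_) hVl ?_ hs i
    · rw [(h0 i).2]; simpa using hv i
    · filter_upwards [hode] with s hs i
      rw [← CSforce_eq K (fun k => XN k s) (fun k => VN k s)]
      exact (hs i).2
  have hXb : ∀ i, ∀ s ∈ Icc 0 T, ‖XN i s‖ ≤ Rx + T * M := fun i s hs => by
    obtain ⟨l, hl⟩ := hXl i
    refine norm_position_le hl hM0 (hVb i) ?_ (hode.mono fun s hs => (hs i).1) hs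
    rw [(h0 i).1]; simpa using hx i
  have hTM : 0 ≤ T * M := by positivity
  have hfin := hZD.isClose_of_particle_system hK hc hw0 hclose (fun i => ⟨hx i, hv i⟩) hN
    (q := fun i s => (XN i s, VN i s)) (fun i => by rw [(h0 i).1, (h0 i).2])
    (fun i s hs => ⟨(hXb i s hs).trans ((le_add_of_nonneg_right hM0).trans (le_max_right _ _)),
      (hVb i s hs).trans ((by linarith : M ≤ Rx + T * M + M).trans (le_max_right _ _))⟩)
    (fun i => by
      obtain ⟨l, hl⟩ := hXl i
      obtain ⟨l', hl'⟩ := hVl i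
      exact ⟨_, hl.prodMk hl'⟩)
    (by
      filter_upwards [hode] with s hs i
      rw [← CSforce_eq K (fun k => XN k s) (fun k => VN k s)]
      exact (hs i).1.prodMk (hs i).2) ht
  rw [hmap t ht] at hfin
  refine W1_le fun φ hφ _ => ?_
  rw [integral_empPair]
  refine (hfin φ 1 one_pos hφ.continuous.aestronglyMeasurable fun p _ p' _ => ?_).trans ?_
  · simpa [Real.dist_eq] using hφ.dist_le_mul p p'
  · rw [one_mul, mul_right_comm]
    exact mul_le_mul_of_nonneg_left (le_max_left _ _) (by positivity)
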